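/- Let G be a finite group, let x ∈ G with x of order 2, let K = x^G with |K| ≥ 3, and suppose that K² = {1} ∪ D where D = d^G is the conjugacy class of an element d of order strictly greater than 2. Then there exist an odd prime p and a positive integer r such that ⟨D⟩ is a p-group and |K| = p^r. -/

import Mathlib

open Pointwise

/-- The conjugacy class of `x` in `G`. -/
def conjClass {G : Type*} [Group G] (x : G) : Set G :=
  {a : G | ∃ g : G, a = g⁻¹ * x * g}

open Pointwise
set_option linter.unusedSectionVars false
set_option linter.style.haveILetI false

namespace Sq
open Matrix Finset

/-- A Wedderburn decomposition of the group algebra. -/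
structure CT (k G : Type*) [Field k] [Group G] where
  N : ℕ
  n : Fin N → ℕ
  hn : ∀ i, n i ≠ 0
  F : MonoidAlgebra k G ≃ₐ[k] (Π i, Matrix (Fin (n i)) (Fin (n i)) k)

section
variable {k G : Type*} [Field k] [Group G]

theorem CT.exists (k G : Type*) [Field k] [IsAlgClosed k] [CharZero k] [Group G] [Fintype G] :
    Nonempty (CT k G) := by
  classical
  have : NeZero (Nat.card G : k) := ⟨by simp⟩
  obtain ⟨N, n, hn, ⟨F⟩⟩ :=
    IsSemisimpleRing.exists_algEquiv_pi_matrix_of_isAlgClosed k (MonoidAlgebra k G)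
  exact ⟨⟨N, n, fun i => (hn i).out, F⟩⟩

/-- the i-th irreducible representation -/
noncomputable def CT.rho (T : CT k G) (i : Fin T.N) : G →* Matrix (Fin (T.n i)) (Fin (T.n i)) k where
  toFun g := T.F (MonoidAlgebra.single g 1) i
  map_one' := by
    have : MonoidAlgebra.single (1:G) (1:k) = 1 := rfl
    rw [this, map_one]; rfl
  map_mul' g h := by
    have : MonoidAlgebra.single (g*h) (1:k) = MonoidAlgebra.single g 1 * MonoidAlgebra.single h 1 := by
      simp
    rw [this, map_mul]; rfl

theorem CT.rho_apply (T : CT k G) (i : Fin T.N) (g : G) :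
    T.rho i g = T.F (MonoidAlgebra.single g 1) i := rfl

/-- the i-th irreducible character -/
noncomputable def CT.chi (T : CT k G) (i : Fin T.N) (g : G) : k := (T.rho i g).trace

variable [Fintype G]

theorem CT.F_apply (T : CT k G) (i : Fin T.N) (a : MonoidAlgebra k G) :
    T.F a i = ∑ g, a.coeff g • T.rho i g := by
  classical
  have : a = ∑ g, a.coeff g • MonoidAlgebra.single g (1:k) := by
    ext h
    simp
  conv_lhs => rw [this]
  simp only [map_sum, Finset.sum_apply, CT.rho_apply, map_smul, Pi.smul_apply]

theorem trace_mulLeft_pi {N : ℕ} (n : Fin N → ℕ) (a : Π i, Matrix (Fin (n i)) (Fin (n i)) k) :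
    LinearMap.trace k _ (LinearMap.mulLeft k a) = ∑ i, (n i : k) * (a i).trace := by
  classical
  rw [LinearMap.trace_eq_matrix_trace k (Pi.basis fun i => Matrix.stdBasis k (Fin (n i)) (Fin (n i)))]
  rw [Matrix.trace, Fintype.sum_sigma]
  refine Finset.sum_congr rfl fun i _ => ?_
  rw [Fintype.sum_prod_type]
  have key : ∀ x y : Fin (n i), ((Matrix.stdBasis k (Fin (n i)) (Fin (n i))).repr (a i * Matrix.single x y 1)) (x, y) = a i x x := by
    intro x y
    simp [Matrix.stdBasis, Matrix.ofLinearEquiv]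
  simp only [Matrix.diag_apply, LinearMap.toMatrix_apply, Pi.basis_repr, LinearMap.mulLeft_apply, Pi.mul_apply,
    Pi.basis_apply, Pi.single_eq_same, Matrix.stdBasis_eq_single, key]
  simp [Matrix.trace, Finset.mul_sum]
  

theorem CT.F1 [DecidableEq G] (T : CT k G) (g : G) :
    ∑ i, (T.n i : k) * T.chi i g = if g = 1 then (Fintype.card G : k) else 0 := by
  have h1 := trace_mulLeft_pi T.n (T.F (MonoidAlgebra.single g 1))
  have h2 : LinearMap.mulLeft k (T.F (MonoidAlgebra.single g 1)) =
      T.F.toLinearEquiv.conj (LinearMap.mulLeft k (MonoidAlgebra.single g (1:k))) := by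
    refine LinearMap.ext fun x => ?_
    simp [LinearEquiv.conj_apply]
  rw [h2, LinearMap.trace_conj'] at h1
  have h3 : ∑ i, (T.n i : k) * T.chi i g = ∑ i, (T.n i : k) * (T.F (MonoidAlgebra.single g 1) i).trace := rfl
  rw [h3, ← h1]
  rw [LinearMap.trace_eq_matrix_trace k (MonoidAlgebra.basis G k)]
  have : ∀ h : G, (MonoidAlgebra.basis G k).repr (MonoidAlgebra.single g (1:k) * MonoidAlgebra.single h 1) h = if g = 1 then 1 else 0 := by
    intro h
    rw [MonoidAlgebra.single_mul_single, mul_one, ← MonoidAlgebra.basis_apply, Module.Basis.repr_self]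
    rw [Finsupp.single_apply]
    simp
  simp only [Matrix.trace, Matrix.diag_apply, LinearMap.toMatrix_apply, LinearMap.mulLeft_apply, MonoidAlgebra.basis_apply, this]
  simp

theorem CT.chi_mul_comm (T : CT k G) (i) (g h : G) : T.chi i (g * h) = T.chi i (h * g) := by
  rw [CT.chi, CT.chi, map_mul, map_mul, Matrix.trace_mul_comm]

theorem CT.chi_conj (T : CT k G) (i) (g t : G) : T.chi i (t * g * t⁻¹) = T.chi i g := by
  rw [T.chi_mul_comm]; simp

theorem CT.chi_one (T : CT k G) (i) : T.chi i 1 = T.n i := by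
  simp [CT.chi]

theorem CT.ex_span (T : CT k G) (i) (X : Matrix (Fin (T.n i)) (Fin (T.n i)) k) :
    ∃ a : G → k, X = ∑ g, a g • T.rho i g := by
  refine ⟨(T.F.symm (Pi.single i X)).coeff, ?_⟩
  rw [← T.F_apply]; simp

theorem CT.scalar_of_commute (T : CT k G) (i) (M : Matrix (Fin (T.n i)) (Fin (T.n i)) k)
    (h : ∀ g, Commute (T.rho i g) M) : ∃ c : k, M = c • 1 := by
  have h2 : ∀ X, Commute X M := by
    intro X
    obtain ⟨a, rfl⟩ := T.ex_span i X
    exact Commute.sum_left _ _ _ fun g _ => (h g).smul_left _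
  obtain ⟨c, hc⟩ := Matrix.mem_range_scalar_of_commute_single (M := M) fun i j _ => h2 _
  exact ⟨c, by rw [← hc, Matrix.scalar_apply, Matrix.smul_one_eq_diagonal]⟩

/-- central character evaluated on a class function -/
noncomputable def CT.om (T : CT k G) (i : Fin T.N) (a : G → k) : k :=
  (∑ g, a g * T.chi i g) / T.n i

variable [CharZero k]

theorem CT.n_ne (T : CT k G) (i) : (T.n i : k) ≠ 0 := by
  exact_mod_cast T.hn i

theorem CT.sum_class (T : CT k G) (i) (a : G → k) (ha : ∀ g t, a (t * g * t⁻¹) = a g) :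
    ∑ g, a g • T.rho i g = T.om i a • 1 := by
  obtain ⟨c, hc⟩ := T.scalar_of_commute i (∑ g, a g • T.rho i g) (by
    intro t
    rw [commute_iff_eq, Finset.mul_sum, Finset.sum_mul]
    refine (Fintype.sum_equiv (MulAut.conj t).toEquiv _ _ fun g => ?_).symm.symm
    simp only [MulEquiv.toEquiv_eq_coe, EquivLike.coe_coe, MulAut.conj_apply, ha]
    rw [smul_mul_assoc, mul_smul_comm, ← map_mul, ← map_mul]; simp)
  have h := congrArg Matrix.trace hc
  simp only [Matrix.trace_sum, Matrix.trace_smul, Matrix.trace_one, smul_eq_mul, Fintype.card_fin] at h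
  rw [hc, CT.om]
  congr 1
  rw [eq_div_iff (T.n_ne i)]
  exact h.symm

theorem CT.F2 (T : CT k G) (i) (g : G) :
    ∑ t, T.rho i (t * g * t⁻¹) = (Fintype.card G * T.chi i g / T.n i) • 1 := by
  obtain ⟨c, hc⟩ := T.scalar_of_commute i (∑ t, T.rho i (t * g * t⁻¹)) (by
    intro s
    rw [commute_iff_eq, Finset.mul_sum, Finset.sum_mul]
    refine Fintype.sum_equiv (Equiv.mulLeft s) _ _ fun t => ?_
    simp only [Equiv.coe_mulLeft, ← map_mul]; congr 1; group)
  have h := congrArg Matrix.trace hc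
  have h2 : ∀ t, (T.rho i (t * g * t⁻¹)).trace = T.chi i g := fun t => T.chi_conj i g t
  simp only [Matrix.trace_sum, h2, Matrix.trace_smul, Matrix.trace_one, smul_eq_mul, Fintype.card_fin,
    Finset.sum_const, nsmul_eq_mul, Finset.card_univ] at h
  rw [hc]; congr 1
  rw [eq_div_iff (T.n_ne i), h]

theorem CT.chi_mul_chi (T : CT k G) (i) (g h : G) :
    T.chi i g * T.chi i h = T.n i / Fintype.card G * ∑ t, T.chi i (t * g * t⁻¹ * h) := by
  have h1 := congrArg (fun M => (M * T.rho i h).trace) (T.F2 i g)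
  simp only [Finset.sum_mul, Matrix.trace_sum, ← map_mul, smul_mul_assoc, one_mul, Matrix.trace_smul, smul_eq_mul] at h1
  have h2 : ∑ t, T.chi i (t * g * t⁻¹ * h) = Fintype.card G * T.chi i g / T.n i * T.chi i h := h1
  rw [h2]
  have := T.n_ne i
  have h3 : (Fintype.card G : k) ≠ 0 := by simp
  field_simp

theorem CT.F3 [DecidableEq G] (T : CT k G) (g h : G) :
    ∑ i, T.chi i g * T.chi i h = ∑ t, if t * g * t⁻¹ = h⁻¹ then 1 else 0 := by
  have h3 : (Fintype.card G : k) ≠ 0 := by simp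
  have : ∀ i, T.chi i g * T.chi i h = ∑ t, (T.n i * T.chi i (t * g * t⁻¹ * h)) / Fintype.card G := by
    intro i
    rw [chi_mul_chi, Finset.mul_sum]
    exact Finset.sum_congr rfl fun t _ => by ring
  simp only [this]
  rw [Finset.sum_comm]
  refine Finset.sum_congr rfl fun t _ => ?_
  rw [← Finset.sum_div, T.F1]
  simp only [mul_eq_one_iff_eq_inv]
  split_ifs <;> simp [h3]

theorem CT.orth (T : CT k G) (i j) :
    ∑ g, T.chi i g * T.chi j g⁻¹ = if i = j then (Fintype.card G : k) else 0 := by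
  classical
  have h3 : (Fintype.card G : k) ≠ 0 := by simp
  set a := T.F.symm (Pi.single j 1) with ha
  have hFa : T.F a = Pi.single j 1 := by simp [ha]
  have hco : ∀ h, a.coeff h = T.n j * T.chi j h⁻¹ / Fintype.card G := by
    intro h
    have e1 : ∑ l, (T.n l : k) * ((T.F a l) * T.rho l h⁻¹).trace = a.coeff h * Fintype.card G := by
      have : ∀ l, ((T.F a l) * T.rho l h⁻¹).trace = ∑ g, a.coeff g * T.chi l (g * h⁻¹) := by
        intro l
        rw [T.F_apply, Finset.sum_mul, Matrix.trace_sum]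
        refine Finset.sum_congr rfl fun g _ => ?_
        rw [smul_mul_assoc, Matrix.trace_smul, ← map_mul]; rfl
      simp only [this, Finset.mul_sum]
      rw [Finset.sum_comm]
      have : ∀ g, ∑ l, (T.n l : k) * (a.coeff g * T.chi l (g * h⁻¹)) = a.coeff g * if g * h⁻¹ = 1 then (Fintype.card G : k) else 0 := by
        intro g
        rw [← T.F1, Finset.mul_sum]
        exact Finset.sum_congr rfl fun l _ => by ring
      simp [this, mul_inv_eq_one]
    rw [hFa, Finset.sum_eq_single j] at e1
    · rw [eq_div_iff h3, ← e1]; simp [CT.chi]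
    · intro l _ hl
      simp [Pi.single_eq_of_ne hl]
    · simp
  have h5 := congrArg Matrix.trace (T.F_apply i a)
  rw [hFa, Matrix.trace_sum] at h5
  simp only [hco, Matrix.trace_smul, smul_eq_mul] at h5
  have h6 : ∑ g, T.chi i g * T.chi j g⁻¹ = (Fintype.card G / T.n j) * ∑ g, T.n j * T.chi j g⁻¹ / Fintype.card G * (T.rho i g).trace := by
    rw [Finset.mul_sum]
    refine Finset.sum_congr rfl fun g _ => ?_
    have := T.n_ne j
    rw [CT.chi]; field_simp
  rw [h6, ← h5]
  split_ifs with hij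
  · subst hij
    have := T.n_ne i
    simp; field_simp
  · simp [Pi.single_eq_of_ne hij]

theorem CT.n_eq_one_of_scalar (T : CT k G) (i) (h : ∀ g, ∃ c : k, T.rho i g = c • 1) : T.n i = 1 := by
  have h2 : ∀ X : Matrix (Fin (T.n i)) (Fin (T.n i)) k, ∃ c : k, X = c • 1 := by
    intro X
    obtain ⟨a, rfl⟩ := T.ex_span i X
    choose c hc using h
    exact ⟨∑ g, a g * c g, by simp only [hc, smul_smul, Finset.sum_smul]⟩
  by_contra hne
  have h0 := T.hn i
  have : 1 < T.n i := by omega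
  obtain ⟨c, hc⟩ := h2 (Matrix.single ⟨0, by omega⟩ ⟨1, this⟩ 1)
  have := congrFun (congrFun hc ⟨0, by omega⟩) ⟨1, this⟩
  simp at this

theorem CT.exists_triv (T : CT k G) : ∃ i0, (∀ g, T.rho i0 g = 1) ∧ T.n i0 = 1 ∧
    ∀ j, (∀ g, T.rho j g = 1) → j = i0 := by
  classical
  have h3 : (Fintype.card G : k) ≠ 0 := by simp
  have : ∃ i, ∑ g, T.chi i g ≠ 0 := by
    by_contra! hcon
    have : ∑ i, (T.n i : k) * ∑ g, T.chi i g = Fintype.card G := by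
      simp only [Finset.mul_sum]
      rw [Finset.sum_comm]
      simp [T.F1]
    simp [hcon] at this
    exact h3 this.symm
  obtain ⟨i, hi⟩ := this
  have hsc := T.sum_class i (fun _ => 1) (fun _ _ => rfl)
  have hom : T.om i (fun _ => 1) ≠ 0 := by
    simp only [CT.om, one_mul]
    exact div_ne_zero hi (T.n_ne i)
  have h1 : ∀ g, T.rho i g = 1 := by
    intro h
    have : (∑ g, (1:k) • T.rho i g) * T.rho i h = ∑ g, (1:k) • T.rho i g := by
      simp only [one_smul, Finset.sum_mul, ← map_mul]
      exact Fintype.sum_equiv (Equiv.mulRight h) _ _ fun g => rfl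
    rw [hsc, smul_mul_assoc, one_mul] at this
    exact smul_right_injective _ hom this
  have hn : T.n i = 1 := T.n_eq_one_of_scalar i fun g => ⟨1, by simp [h1]⟩
  refine ⟨i, h1, hn, fun j hj => ?_⟩
  have hnj : T.n j = 1 := T.n_eq_one_of_scalar j fun g => ⟨1, by simp [hj]⟩
  by_contra hne
  have := T.orth j i
  simp [CT.chi, h1, hj, hn, hnj, hne] at this

theorem CT.om_integral (T : CT k G) (i) (J : Finset G) (hJ : ∀ g t, t * g * t⁻¹ ∈ J ↔ g ∈ J) :
    IsIntegral ℤ ((∑ g ∈ J, T.chi i g) / T.n i) := by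
  classical
  have hs := T.sum_class i (fun g => if g ∈ J then 1 else 0) (fun g t => by simp [hJ])
  have hom : T.om i (fun g => if g ∈ J then 1 else 0) = (∑ g ∈ J, T.chi i g) / T.n i := by
    simp [CT.om]
  rw [hom] at hs
  have h1 : IsIntegral ℤ (∑ g ∈ J, MonoidAlgebra.of ℤ G g) := IsIntegral.of_finite ℤ _
  have h2 := h1.map (MonoidAlgebra.lift ℤ _ G (T.rho i))
  have h3 : MonoidAlgebra.lift ℤ _ G (T.rho i) (∑ g ∈ J, MonoidAlgebra.of ℤ G g) =
      ∑ g, (if g ∈ J then (1:k) else 0) • T.rho i g := by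
    simp [map_sum]
  rw [h3, hs, ← Algebra.algebraMap_eq_smul_one] at h2
  have : Nonempty (Fin (T.n i)) := ⟨⟨0, Nat.pos_of_ne_zero (T.hn i)⟩⟩
  exact (isIntegral_algebraMap_iff (FaithfulSMul.algebraMap_injective _ _)).1 h2
end
end Sq

open Pointwise
set_option linter.unusedSectionVars false

namespace Sq
open Matrix Finset
section
variable {k : Type*} [Field k] [CharZero k] {m : Type*} [Fintype m] [DecidableEq m]

theorem trace_integral [IsAlgClosed k] (M : Matrix m m k) (a b : ℕ) (hN : a < b) (h : M ^ a = M ^ b) :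
    IsIntegral ℤ M.trace := by
  rw [Matrix.trace_eq_sum_roots_charpoly]
  have : ∀ l ∈ M.charpoly.roots, IsIntegral ℤ l := by
    intro l hl
    have h1 : Module.End.HasEigenvalue (Matrix.toLin' M) l := by
      rw [Module.End.hasEigenvalue_iff_isRoot_charpoly, Matrix.charpoly_toLin']
      exact Polynomial.isRoot_of_mem_roots hl
    obtain ⟨v, hv⟩ := h1.exists_hasEigenvector
    have h3 := hv.pow_apply a
    have h3' := hv.pow_apply b
    rw [← Matrix.toLin'_pow] at h3 h3'
    rw [h, h3'] at h3
    have h4 : l ^ b = l ^ a := smul_left_injective k hv.2 h3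
    refine ⟨Polynomial.X ^ b - Polynomial.X ^ a, ?_, ?_⟩
    · apply Polynomial.monic_X_pow_sub
      rw [Polynomial.degree_X_pow]; exact_mod_cast hN
    · simp [h4]
  exact IsIntegral.multiset_sum this

theorem idem_trace_nat (E : Matrix m m k) (h : E * E = E) :
    ∃ r : ℕ, E.trace = r ∧ (r = 0 → E = 0) := by
  have hi : IsIdempotentElem (Matrix.toLin' E) := by
    rw [IsIdempotentElem, Module.End.mul_eq_comp, ← Matrix.toLin'_mul, h]
  have h1 := (LinearMap.IsIdempotentElem.isProj_range _ hi).trace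
  rw [Matrix.trace_toLin'_eq] at h1
  refine ⟨_, h1, fun h0 => ?_⟩
  rw [h0] at h1
  have h2 := (LinearMap.IsIdempotentElem.trace_eq_zero_iff hi).1 (by rw [Matrix.trace_toLin'_eq, h1]; simp)
  exact Matrix.toLin'.injective (by simpa using h2)

theorem idem_trace (E : Matrix m m k) (h : E * E = E) :
    ∃ r : ℕ, E.trace = r ∧ r ≤ Fintype.card m ∧ (r = 0 → E = 0) ∧ (r = Fintype.card m → E = 1) := by
  obtain ⟨r, hr, hr0⟩ := idem_trace_nat E h
  obtain ⟨r', hr', hr0'⟩ := idem_trace_nat (1 - E) (by simp [sub_mul, mul_sub, h])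
  have hs : r + r' = Fintype.card m := by
    have : ((r + r' : ℕ) : k) = Fintype.card m := by
      push_cast; rw [← hr, ← hr', Matrix.trace_sub, Matrix.trace_one]; ring
    exact_mod_cast this
  refine ⟨r, hr, by omega, hr0, fun h1 => ?_⟩
  have := hr0' (by omega)
  exact (sub_eq_zero.1 this).symm

end

/-- trace function of a matrix representation -/
def IsRT (k : Type*) [Field k] {L : Type*} [Group L] (f : L → k) : Prop :=
  ∃ (m : Type) (_ : Fintype m) (_ : DecidableEq m) (ρ : L →* Matrix m m k), ∀ g, f g = (ρ g).trace

section
variable {k : Type*} [Field k] [CharZero k] {L : Type*} [Group L]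

theorem IsRT.comp {L' : Type*} [Group L'] {f : L → k} (hf : IsRT k f) (φ : L' →* L) :
    IsRT k (fun g => f (φ g)) := by
  obtain ⟨m, i1, i2, ρ, h⟩ := hf
  exact ⟨m, i1, i2, ρ.comp φ, fun g => h _⟩

theorem CT.isRT (T : CT k L) (i) : IsRT k (T.chi i) := ⟨_, _, _, T.rho i, fun _ => rfl⟩

theorem IsRT.mul_inv {f f' : L → k} (hf : IsRT k f) (hf' : IsRT k f') :
    IsRT k (fun g => f g * f' g⁻¹) := by
  obtain ⟨m, i1, i2, ρ, h⟩ := hf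
  obtain ⟨m', i1', i2', ρ', h'⟩ := hf'
  refine ⟨m × m', inferInstance, inferInstance,
    { toFun := fun g => Matrix.kronecker (ρ g) (ρ' g⁻¹)ᵀ
      map_one' := by simp [Matrix.kronecker]
      map_mul' := fun g g' => by
        simp only [Matrix.kronecker]
        rw [← Matrix.mul_kronecker_mul, map_mul, _root_.mul_inv_rev, map_mul, Matrix.transpose_mul] }, fun g => ?_⟩
  simp [h, h', Matrix.kronecker, Matrix.trace_kronecker]

theorem IsRT.conj {f : L → k} (hf : IsRT k f) (g t : L) : f (t * g * t⁻¹) = f g := by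
  obtain ⟨m, i1, i2, ρ, h⟩ := hf
  rw [h, h, map_mul, Matrix.trace_mul_comm, ← map_mul]; simp

variable [Fintype L]

theorem avg_idem {m : Type*} [Fintype m] [DecidableEq m] (ρ : L →* Matrix m m k) :
    ((Fintype.card L : k)⁻¹ • ∑ g, ρ g) * ((Fintype.card L : k)⁻¹ • ∑ g, ρ g) = (Fintype.card L : k)⁻¹ • ∑ g, ρ g := by
  have h3 : (Fintype.card L : k) ≠ 0 := by simp
  have : ∀ g, ρ g * ∑ h, ρ h = ∑ h, ρ h := by
    intro g
    rw [Finset.mul_sum]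
    exact Fintype.sum_equiv (Equiv.mulLeft g) _ _ fun t => by simp
  rw [smul_mul_assoc, mul_smul_comm, Finset.sum_mul]
  simp only [this, Finset.sum_const, Finset.card_univ, ← Nat.cast_smul_eq_nsmul k, smul_smul]
  congr 1; field_simp

theorem IsRT.avg {f : L → k} (hf : IsRT k f) : ∃ r : ℕ, ∑ g, f g = Fintype.card L * r := by
  have h3 : (Fintype.card L : k) ≠ 0 := by simp
  obtain ⟨m, i1, i2, ρ, h⟩ := hf
  obtain ⟨r, hr, -⟩ := idem_trace_nat _ (avg_idem ρ)
  refine ⟨r, ?_⟩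
  rw [← hr]
  simp only [h, Matrix.trace_smul, Matrix.trace_sum, smul_eq_mul]
  field_simp

theorem IsRT.integral [IsAlgClosed k] {f : L → k} (hf : IsRT k f) (g : L) : IsIntegral ℤ (f g) := by
  obtain ⟨m, i1, i2, ρ, h⟩ := hf
  rw [h]
  refine trace_integral _ 0 (Fintype.card L) Fintype.card_pos ?_
  rw [← map_pow ρ g (Fintype.card L), pow_card_eq_one]; simp

/-! tensor powers -/
section tensor
variable {m : Type*} [Fintype m] [DecidableEq m] {n : ℕ}

/-- tensor product of a family of matrices -/
def tpv (v : Fin n → Matrix m m k) : Matrix (Fin n → m) (Fin n → m) k :=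
  fun a b => ∏ i, v i (a i) (b i)

theorem tpv_mul (v w : Fin n → Matrix m m k) : tpv v * tpv w = tpv (fun i => v i * w i) := by
  ext a b
  simp only [Matrix.mul_apply, tpv]
  rw [Finset.prod_univ_sum]
  simp [Finset.prod_mul_distrib]

/-- permutation matrices on tensor powers -/
def Pm (k : Type*) [Field k] (m : Type*) [DecidableEq m] {n : ℕ} (π : Equiv.Perm (Fin n)) : Matrix (Fin n → m) (Fin n → m) k :=
  fun a b => if a = b ∘ π then 1 else 0

theorem mul_Pm (X : Matrix (Fin n → m) (Fin n → m) k) (π : Equiv.Perm (Fin n)) (a b) :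
    (X * Pm k m π) a b = X a (b ∘ π) := by
  simp [Matrix.mul_apply, Pm]

theorem Pm_mul (X : Matrix (Fin n → m) (Fin n → m) k) (π : Equiv.Perm (Fin n)) (a b) :
    (Pm k m π * X) a b = X (a ∘ π.symm) b := by
  have : ∀ c : Fin n → m, a = c ∘ π ↔ c = a ∘ π.symm := by
    intro c
    rw [Equiv.eq_comp_symm, eq_comm]
  simp [Matrix.mul_apply, Pm, this]

theorem Pm_tpv (v : Fin n → Matrix m m k) (π : Equiv.Perm (Fin n)) :
    Pm k m π * tpv v = tpv (v ∘ π) * Pm k m π := by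
  ext a b
  rw [Pm_mul, mul_Pm]
  simp only [tpv]
  refine Fintype.prod_equiv π.symm _ _ fun i => ?_
  simp

theorem Pm_Pm (π τ : Equiv.Perm (Fin n)) : Pm k m π * Pm k m τ = Pm k m (τ * π) := by
  ext a b
  rw [mul_Pm]
  simp only [Pm, Function.comp_assoc, Equiv.Perm.coe_mul]
  congr

theorem tpv_one : tpv (fun _ : Fin n => (1 : Matrix m m k)) = 1 := by
  ext a b
  simp only [tpv, Matrix.one_apply]
  rw [Finset.prod_ite_zero]
  simp [funext_iff]

theorem path_pow (M : Matrix m m k) (n : ℕ) (C : Matrix m m k) :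
    ∑ a : Fin (n + 1) → m, (∏ i : Fin n, M (a i.castSucc) (a i.succ)) * C (a (Fin.last n)) (a 0) =
      (M ^ n * C).trace := by
  induction n generalizing C with
  | zero =>
    rw [pow_zero, one_mul]
    simp only [Finset.univ_eq_empty, Finset.prod_empty, one_mul, Matrix.trace, Matrix.diag_apply]
    exact Fintype.sum_equiv (Equiv.funUnique (Fin 1) m) _ _ fun a => by simp
  | succ n ih =>
    rw [pow_succ, mul_assoc, ← ih (M * C)]
    rw [← (Fin.snocEquiv (fun _ => m)).sum_comp, Fintype.sum_prod_type, Finset.sum_comm]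
    refine Finset.sum_congr rfl fun a _ => ?_
    rw [Matrix.mul_apply, Finset.mul_sum]
    refine Finset.sum_congr rfl fun x _ => ?_
    simp only [Fin.snocEquiv, Equiv.coe_fn_mk]
    rw [Fin.prod_univ_castSucc]
    have h0 : (Fin.snoc a x : Fin (n+2) → m) 0 = a 0 := by
      simp
    have h1 : ∀ i : Fin n, (Fin.snoc a x : Fin (n+2) → m) i.castSucc.succ = a i.succ := by
      intro i
      have := Fin.snoc_castSucc (α := fun _ => m) x a i.succ
      rw [← Fin.succ_castSucc] at this
      simpa using this
    simp only [Fin.snoc_castSucc, h0, h1, Fin.succ_last, Fin.snoc_last]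
    ring
end tensor

theorem adams [IsAlgClosed k] {f : L → k} (hf : IsRT k f) (h : L) (hc : ∀ g, Commute h g) (n : ℕ) :
    IsIntegral ℤ ((Fintype.card L : k)⁻¹ * ∑ g, f (h * g ^ (n + 1))) := by
  classical
  obtain ⟨m, i1, i2, ρ, hρ⟩ := hf
  let tp : L →* Matrix (Fin (n+1) → m) (Fin (n+1) → m) k :=
    { toFun := fun g => tpv (fun _ => ρ g)
      map_one' := by simp [tpv_one]
      map_mul' := fun g g' => by rw [tpv_mul, map_mul] }
  let w : Fin (n+1) → L := fun i => if i = Fin.last n then h else 1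
  let τ : Equiv.Perm (Fin (n+1)) := finRotate (n+1)
  let Tm : Matrix (Fin (n+1) → m) (Fin (n+1) → m) k := tpv (fun i => ρ (w i)) * Pm k m τ
  set A := (Fintype.card L : k)⁻¹ • ∑ g, tp g with hA
  have hAA : A * A = A := avg_idem tp
  have hw : ∀ i g, w i * g = g * w i := by
    intro i g
    simp only [w]; split_ifs
    · exact hc g
    · simp
  have hcom : ∀ g, Commute (tp g) Tm := by
    intro g
    change tpv (fun _ => ρ g) * (tpv (fun i => ρ (w i)) * Pm k m τ) = tpv (fun i => ρ (w i)) * Pm k m τ * tpv (fun _ => ρ g)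
    rw [mul_assoc _ _ (tpv _), Pm_tpv, ← mul_assoc, ← mul_assoc, tpv_mul, tpv_mul]
    congr 2
    ext1 i
    simp only [Function.comp, ← map_mul, hw]
  have hAT : Commute A Tm := (Commute.sum_left _ _ _ fun g _ => hcom g).smul_left _
  -- powers of Tm take finitely many values
  have hpow : ∀ j : ℕ, ∃ (v : Fin (n+1) → L) (π : Equiv.Perm (Fin (n+1))), Tm ^ j = tpv (fun i => ρ (v i)) * Pm k m π := by
    intro j
    induction j with
    | zero => 
      refine ⟨1, 1, ?_⟩
      ext a b
      rw [mul_Pm]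
      simp [tpv_one]
    | succ j ih =>
      obtain ⟨v, π, hv⟩ := ih
      refine ⟨fun i => v i * w (π i), τ * π, ?_⟩
      rw [pow_succ, hv]
      change _ * (tpv (fun i => ρ (w i)) * Pm k m τ) = _
      rw [mul_assoc, ← mul_assoc (Pm k m π), Pm_tpv, mul_assoc (tpv _) (Pm k m π), Pm_Pm, ← mul_assoc, tpv_mul]
      simp only [Function.comp, map_mul]
  choose v π hvπ using hpow
  obtain ⟨a, b, hab, he⟩ := Finite.exists_ne_map_eq_of_infinite (fun j : ℕ => (v j, π j))
  simp only [Prod.mk.injEq] at he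
  have hTe : Tm ^ a = Tm ^ b := by rw [hvπ, hvπ, he.1, he.2]
  have hApow : ∀ j : ℕ, A ^ (j+1) = A := by
    intro j
    induction j with
    | zero => simp
    | succ j ih => rw [pow_succ, ih, hAA]
  have hM : (A * Tm) ^ (a+1) = (A * Tm) ^ (b+1) := by
    rw [hAT.mul_pow, hAT.mul_pow, hApow, hApow, pow_succ, hTe, ← pow_succ]
  have hint : IsIntegral ℤ (A * Tm).trace := by
    rcases lt_or_gt_of_ne hab with hlt | hlt
    · exact trace_integral _ (a+1) (b+1) (by omega) hM
    · exact trace_integral _ (b+1) (a+1) (by omega) hM.symm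
  convert hint using 1
  rw [hA, smul_mul_assoc, Matrix.trace_smul, Finset.sum_mul, Matrix.trace_sum, smul_eq_mul]
  congr 1
  refine Finset.sum_congr rfl fun g _ => ?_
  change _ = (tpv (fun _ => ρ g) * (tpv (fun i => ρ (w i)) * Pm k m τ)).trace
  rw [← mul_assoc, tpv_mul, hρ]
  simp only [Matrix.trace, Matrix.diag_apply, mul_Pm]
  have := path_pow (ρ g) n (ρ g * ρ h)
  have e1 : (ρ g ^ n * (ρ g * ρ h)).trace = (ρ (h * g ^ (n+1))).trace := by
    rw [← map_mul, ← map_pow, ← map_mul]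
    congr 2
    rw [(hc _).eq]; group
  rw [e1] at this
  simp only [Matrix.trace, Matrix.diag_apply] at this
  rw [← this]
  refine Finset.sum_congr rfl fun a _ => ?_
  simp only [tpv, τ]
  rw [Fin.prod_univ_castSucc]
  congr 1
  · refine Finset.prod_congr rfl fun i _ => ?_
    have : w i.castSucc = 1 := by simp [w, (Fin.castSucc_lt_last i).ne]
    rw [this]; simp
  · simp [w]
end
end Sq

open Pointwise
set_option linter.unusedSectionVars false

namespace Sq
open Finset
open scoped Classical
noncomputable section P2
universe u
variable {k : Type*} [Field k] [CharZero k] [IsAlgClosed k]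

/-- order of the centralizer -/
def cc {L : Type*} [Group L] (s : L) : ℕ := Nat.card (Subgroup.centralizer ({s} : Set L))

theorem class_card {L : Type*} [Group L] [Fintype L] (s : L) :
    #{t : L | IsConj s t} * cc s = Fintype.card L := by
  have h := MulAction.card_orbit_mul_card_stabilizer_eq_card_group (ConjAct L) s
  rw [cc, Subgroup.nat_card_centralizer_nat_card_stabilizer, Nat.card_eq_fintype_card]
  rw [ConjAct.card] at h
  rw [← h]
  congr 1
  rw [Fintype.card_subtype]
  congr 1
  ext t
  simp only [mem_filter, mem_univ, true_and]
  rw [ConjAct.mem_orbit_conjAct, isConj_comm]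

theorem cc_pos {L : Type*} [Group L] [Fintype L] (s : L) : cc s ≠ 0 := by
  intro h
  have := class_card s
  rw [h, mul_zero] at this
  exact Fintype.card_ne_zero this.symm

theorem class_int {L : Type*} [Group L] [Fintype L] (E : Finset L) (ψ : L → k) (c : k)
    (hE : ∀ s ∈ E, ∀ t, IsConj s t → t ∈ E) (hψ : ∀ s t, IsConj s t → ψ s = ψ t)
    (H : ∀ s ∈ E, IsIntegral ℤ ((Fintype.card L : k) / cc s * ψ s / c)) :
    IsIntegral ℤ ((∑ s ∈ E, ψ s) / c) := by
  rw [← Finset.sum_fiberwise (g := ConjClasses.mk) E, Finset.sum_div]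
  refine IsIntegral.sum _ fun j _ => ?_
  obtain ⟨s, rfl⟩ := ConjClasses.mk_surjective j
  by_cases hs : s ∈ E
  · have h1 : (E.filter fun i => ConjClasses.mk i = ConjClasses.mk s) = ({t : L | IsConj s t} : Finset L) := by
      ext t
      simp only [mem_filter, mem_univ, true_and, ConjClasses.mk_eq_mk_iff_isConj]
      exact ⟨fun h => h.2.symm, fun h => ⟨hE s hs t h, h.symm⟩⟩
    rw [h1]
    have h2 : ∑ t ∈ ({t : L | IsConj s t} : Finset L), ψ t = #{t : L | IsConj s t} * ψ s := by
      rw [← nsmul_eq_mul, ← Finset.sum_const]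
      refine Finset.sum_congr rfl fun t ht => ?_
      simp only [mem_filter, mem_univ, true_and] at ht
      exact (hψ _ _ ht).symm
    rw [h2]
    have h3 := H s hs
    rw [← class_card s] at h3
    refine (congrArg (IsIntegral ℤ) ?_).mp h3
    have : (cc s : k) ≠ 0 := by exact_mod_cast cc_pos s
    push_cast; field_simp
  · have h1 : (E.filter fun i => ConjClasses.mk i = ConjClasses.mk s) = ∅ := by
      apply Finset.filter_eq_empty_iff.2
      intro t ht h
      exact hs (hE t ht s (ConjClasses.mk_eq_mk_iff_isConj.1 h))
    rw [h1]; simp [isIntegral_zero]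

theorem split_exists {a b : ℕ} (hab : Nat.Coprime a b) (ha : 0 < a) (hb : 0 < b) : ∃ N : ℕ, 0 < N ∧
    ∀ (L : Type u) [Group L], (∀ s z : L, s ^ b = 1 → z ^ a = 1 → Commute s z → (s * z) ^ N = z) ∧
      (∀ g : L, g ^ (a * b) = 1 → (g ^ N) ^ a = 1 ∧ (g * (g ^ N)⁻¹) ^ b = 1) := by
  obtain ⟨N, hN1, hN2⟩ := Nat.chineseRemainder hab 1 0
  obtain ⟨c, hc⟩ := (Nat.modEq_zero_iff_dvd.1 hN2)
  have hN1' : (N + a * b) ≡ 1 [MOD a] := by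
    have : a * b ≡ 0 [MOD a] := Nat.modEq_zero_iff_dvd.2 (dvd_mul_right _ _)
    simpa using hN1.add this
  have h1 : 1 ≤ N + a * b := by have := Nat.mul_pos ha hb; omega
  obtain ⟨e, he⟩ := (Nat.modEq_iff_dvd' h1).1 hN1'.symm
  refine ⟨N + a * b, by omega, fun L _ => ⟨fun s z hs hz hsz => ?_, fun g hg => ⟨?_, ?_⟩⟩⟩
  · have e1 : N + a * b = b * (c + a) := by rw [hc]; ring
    have e2 : N + a * b = 1 + a * e := by omega
    rw [hsz.mul_pow]
    conv_lhs => rw [e1]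
    rw [pow_mul, hs, one_pow, one_mul, ← e1, e2, pow_add, pow_mul, hz]; simp
  · have e1 : N + a * b = b * (c + a) := by rw [hc]; ring
    rw [← pow_mul, e1, show b * (c + a) * a = a * b * (c + a) by ring, pow_mul, hg, one_pow]
  · have e2 : N + a * b = 1 + a * e := by omega
    rw [e2, pow_add, pow_one, mul_inv_rev, ← mul_assoc]
    have : g * (g ^ (a * e))⁻¹ * g⁻¹ = (g ^ (a * e))⁻¹ := by
      rw [(((Commute.refl g).pow_right (a * e)).inv_right).eq]; simp
    rw [this, inv_pow, ← pow_mul, show a * e * b = a * b * e by ring, pow_mul, hg]; simp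

theorem decomp {L : Type u} [Group L] [Fintype L] {a b : ℕ} (hab : Nat.Coprime a b) (ha : 0 < a) (hb : 0 < b)
    (E : Finset L) (hE : ∀ g ∈ E, g ^ (a * b) = 1) (φ : L → k) :
    ∑ g ∈ E, φ g = ∑ s : L with s ^ b = 1, ∑ z : L with z ^ a = 1 ∧ Commute s z ∧ s * z ∈ E, φ (s * z) := by
  obtain ⟨N, -, hN⟩ := split_exists.{u} hab ha hb
  obtain ⟨h1, h2⟩ := hN L
  rw [Finset.sum_sigma']
  refine Finset.sum_bij' (fun g _ => ⟨g * (g ^ N)⁻¹, g ^ N⟩) (fun p _ => p.1 * p.2) ?_ ?_ ?_ ?_ ?_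
  · intro g hg
    simp only [mem_sigma, mem_filter, mem_univ, true_and]
    refine ⟨(h2 g (hE g hg)).2, (h2 g (hE g hg)).1, ?_, by simpa using hg⟩
    exact ((Commute.refl g).pow_right N).mul_left ((Commute.refl (g^N)).inv_left)
  · rintro ⟨s, z⟩ hp
    simp only [mem_sigma, mem_filter, mem_univ, true_and] at hp
    exact hp.2.2.2
  · intro g hg; simp
  · rintro ⟨s, z⟩ hp
    simp only [mem_sigma, mem_filter, mem_univ, true_and] at hp
    have := h1 s z hp.1 hp.2.1 hp.2.2.1
    simp [this]
  · intro g hg; simp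

/-- sums over a centralizer -/
theorem sum_cent {L : Type*} [Group L] [Fintype L] (s : L) (P : L → Prop) (φ : L → k)
    (P' : ↥(Subgroup.centralizer ({s} : Set L)) → Prop) [DecidablePred P'] (φ' : ↥(Subgroup.centralizer ({s} : Set L)) → k)
    (hP : ∀ z, P' z ↔ P z) (hφ : ∀ z, φ' z = φ z) :
    ∑ z ∈ Finset.univ.filter P', φ' z = ∑ z : L with P z ∧ Commute s z, φ z := by
  refine Finset.sum_bij (fun z _ => (z : L)) ?_ ?_ ?_ ?_
  · rintro ⟨z, hz⟩ h
    simp only [mem_filter, mem_univ, true_and] at h ⊢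
    exact ⟨(hP _).1 h, (Subgroup.mem_centralizer_iff.1 hz s rfl)⟩
  · rintro ⟨z, hz⟩ _ ⟨w, hw⟩ _ h
    simpa using h
  · intro z hz
    simp only [mem_filter, mem_univ, true_and] at hz
    refine ⟨⟨z, Subgroup.mem_centralizer_iff.2 ?_⟩, ?_, rfl⟩
    · rintro _ rfl; exact hz.2
    · simpa [hP] using hz.1
  · intros; exact hφ _

theorem pow_part {L : Type*} [Group L] [Fintype L] (z : L) (q n c : ℕ) (hq : q.Prime) (hn : z ^ n = 1) (hn0 : n ≠ 0)
    (hd : n ∣ c) (hc : c ≠ 0) :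
    z ^ q ^ n.factorization q = 1 ↔ z ^ q ^ c.factorization q = 1 := by
  constructor
  · intro h
    obtain ⟨e, he⟩ := Nat.pow_dvd_pow q ((Nat.factorization_le_iff_dvd hn0 hc).2 hd q)
    rw [he, pow_mul, h, one_pow]
  · intro h
    have h1 := orderOf_dvd_of_pow_eq_one h
    have h2 := orderOf_dvd_of_pow_eq_one hn
    apply orderOf_dvd_iff_pow_eq_one.1
    obtain ⟨j, hj, hj'⟩ := (Nat.dvd_prime_pow hq).1 h1
    rw [hj'] at h2 ⊢
    exact Nat.pow_dvd_pow q ((hq.pow_dvd_iff_le_factorization hn0).1 h2)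

end P2
end Sq

open Pointwise
set_option linter.unusedSectionVars false

namespace Sq
open Finset
open scoped Classical
noncomputable section P3
universe u
variable {k : Type*} [Field k] [CharZero k] [IsAlgClosed k]

theorem int_nat_mul {x : k} (n : ℕ) (h : IsIntegral ℤ x) : IsIntegral ℤ ((n : k) * x) := by
  have : IsIntegral ℤ (n : k) := by simpa using isIntegral_algebraMap (R := ℤ) (A := k) (x := (n : ℤ))
  exact this.mul h

theorem int_int_mul {x : k} (n : ℤ) (h : IsIntegral ℤ x) : IsIntegral ℤ ((n : k) * x) := by
  have : IsIntegral ℤ (n : k) := by simpa using isIntegral_algebraMap (R := ℤ) (A := k) (x := (n : ℤ))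
  exact this.mul h

theorem int_coprime {x : k} (c d : ℕ) (hcd : Nat.Coprime c d) (h1 : IsIntegral ℤ ((c : k) * x))
    (h2 : IsIntegral ℤ ((d : k) * x)) : IsIntegral ℤ x := by
  have h3 := (int_int_mul (Nat.gcdA c d) h1).add (int_int_mul (Nat.gcdB c d) h2)
  have h4 := Nat.gcd_eq_gcd_ab c d
  rw [hcd.gcd_eq_one] at h4
  have h5 : (1 : k) = c * (Nat.gcdA c d : ℤ) + d * (Nat.gcdB c d : ℤ) := by exact_mod_cast h4
  refine (congrArg (IsIntegral ℤ) ?_).mp h3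
  calc _ = (c * (Nat.gcdA c d : ℤ) + d * (Nat.gcdB c d : ℤ)) * x := by ring
    _ = x := by rw [← h5, one_mul]

theorem lemQ_cent {q : ℕ} (hq : q.Prime) {L : Type u} [Group L] [Fintype L] (s h : L)
    (hh' : h ∈ Subgroup.centralizer ({s} : Set L)) (f : L → k)
    (this : IsIntegral ℤ ((∑ z : Subgroup.centralizer ({s} : Set L) with
       z ^ (q ^ (Fintype.card (Subgroup.centralizer ({s} : Set L))).factorization q) = 1,
         (fun z => f (Subgroup.subtype _ z)) (⟨h, hh'⟩ * z)) /
      (q ^ (Fintype.card (Subgroup.centralizer ({s} : Set L))).factorization q : ℕ))) :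
    IsIntegral ℤ ((Fintype.card L : k) / cc s * (∑ z : L with z ^ q ^ (Fintype.card L).factorization q = 1 ∧ Commute s z,
      f (h * z)) / (q ^ (Fintype.card L).factorization q : ℕ)) := by
  have hcard : Fintype.card L ≠ 0 := Fintype.card_ne_zero
  set a := q ^ (Fintype.card L).factorization q with ha
  set b := Fintype.card L / a with hb
  have hab : a * b = Fintype.card L := Nat.ordProj_mul_ordCompl_eq_self _ _
  have ha0 : 0 < a := pow_pos hq.pos _
  have hak : (a : k) ≠ 0 := by exact_mod_cast ha0.ne'
  have hcc : Fintype.card (Subgroup.centralizer ({s} : Set L)) = cc s := by rw [cc, Nat.card_eq_fintype_card]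
  have hdvd : cc s ∣ Fintype.card L := Dvd.intro_left _ (class_card s)
  rw [hcc] at this
  rw [sum_cent s (fun z => z ^ q ^ (cc s).factorization q = 1) (fun z => f (h * z))] at this
  rotate_left
  · intro z
    rw [Subtype.ext_iff, Subgroup.coe_pow, Subgroup.coe_one]
  · intro z; rfl
  set S := ∑ z : L with z ^ a = 1 ∧ Commute s z, f (h * z) with hS
  have e2 : ∑ z : L with z ^ q ^ (cc s).factorization q = 1 ∧ Commute s z, f (h * z) = S := by
    refine Finset.sum_congr ?_ fun _ _ => rfl
    ext z
    simp only [mem_filter, mem_univ, true_and]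
    refine and_congr_left fun hz => ?_
    refine pow_part z q _ _ hq ?_ (cc_pos s) hdvd hcard
    have hz' : z ∈ Subgroup.centralizer ({s} : Set L) := Subgroup.mem_centralizer_iff.2 (by
      rintro _ rfl; exact hz)
    have := pow_card_eq_one' (G := Subgroup.centralizer ({s} : Set L)) (x := ⟨z, hz'⟩)
    rw [Subtype.ext_iff, Subgroup.coe_pow, Subgroup.coe_one] at this
    exact this
  rw [e2] at this
  obtain ⟨e, he⟩ := Nat.ordCompl_dvd_ordCompl_of_dvd hdvd q
  refine (congrArg (IsIntegral ℤ) ?_).mp (int_nat_mul e this)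
  have e3 := Nat.ordProj_mul_ordCompl_eq_self (cc s) q
  have hc0 : (cc s : k) ≠ 0 := by exact_mod_cast cc_pos s
  rw [← ha, ← hb] at he
  have h6 : (q ^ (cc s).factorization q * b) = cc s * e := by
    rw [he, ← mul_assoc, e3]
  have h7 : (((q ^ (cc s).factorization q : ℕ) : k) * b) = cc s * e := by exact_mod_cast h6
  have h8 : ((q ^ (cc s).factorization q : ℕ) : k) ≠ 0 := by
    exact_mod_cast (pow_pos hq.pos _).ne'
  rw [← hab, Nat.cast_mul]
  generalize ((q ^ (cc s).factorization q : ℕ) : k) = Y at *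
  field_simp
  linear_combination (-S) * h7

theorem psi_conj {L : Type u} [Group L] [Fintype L] (F : L → L → k) (hF : ∀ t s z, F (t * s * t⁻¹) (t * z * t⁻¹) = F s z)
    (P : L → Prop) (hP : ∀ t z, P (t * z * t⁻¹) ↔ P z)
    (s s' : L) (h : IsConj s s') : ∑ z : L with P z ∧ Commute s z, F s z = ∑ z : L with P z ∧ Commute s' z, F s' z := by
  obtain ⟨t, rfl⟩ := isConj_iff.1 h
  refine Finset.sum_bij' (fun z _ => t * z * t⁻¹) (fun z _ => t⁻¹ * z * t) ?_ ?_ ?_ ?_ ?_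
  · intro z hz
    simp only [mem_filter, mem_univ, true_and, hP] at hz ⊢
    exact ⟨hz.1, by rw [Commute.conj_iff]; exact hz.2⟩
  · intro z hz
    simp only [mem_filter, mem_univ, true_and] at hz ⊢
    refine ⟨?_, ?_⟩
    · rw [← hP t]; convert hz.1 using 1; group
    · rw [← Commute.conj_iff t]; convert hz.2 using 1; group
  · intro z _; group
  · intro z _; group
  · intro z _; rw [hF]

theorem lemQ (q : ℕ) (hq : q.Prime) : ∀ n : ℕ, ∀ (L : Type u) [Group L] [Fintype L], Fintype.card L = n → ∀ f : L → k,
    IsRT k f → ∀ h : L, (∀ g, Commute h g) →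
    IsIntegral ℤ ((∑ z : L with z ^ (q ^ (Fintype.card L).factorization q) = 1, f (h * z)) /
      (q ^ (Fintype.card L).factorization q : ℕ)) := by
  intro n
  induction n using Nat.strong_induction_on with
  | _ n ih =>
  intro L _ _ hn f hf h hh
  have hcard : Fintype.card L ≠ 0 := Fintype.card_ne_zero
  set a := q ^ (Fintype.card L).factorization q with ha
  set b := Fintype.card L / a with hb
  have hab : a * b = Fintype.card L := Nat.ordProj_mul_ordCompl_eq_self _ _
  have hqb : q.Coprime b := Nat.coprime_ordCompl hq hcard
  have hcop : a.Coprime b := hqb.pow_left _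
  have ha0 : 0 < a := pow_pos hq.pos _
  have hb0 : 0 < b := Nat.pos_of_ne_zero fun h => hcard (by rw [← hab, h, mul_zero])
  have hak : (a : k) ≠ 0 := by exact_mod_cast ha0.ne'
  have hbk : (b : k) ≠ 0 := by exact_mod_cast hb0.ne'
  obtain ⟨N, hN0, hN⟩ := split_exists.{u} hcop ha0 hb0
  obtain ⟨hN1, -⟩ := hN L
  have I1 := adams hf h hh (N - 1)
  rw [Nat.sub_add_cancel hN0] at I1
  set X := ∑ z : L with z ^ a = 1, f (h * z) with hX
  let ψ : L → k := fun s => ∑ z : L with z ^ a = 1 ∧ Commute s z, f (h * z)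
  have hd : ∑ g : L, f (h * g ^ N) = ∑ s : L with s ^ b = 1, ψ s := by
    rw [decomp hcop ha0 hb0 Finset.univ (fun g _ => by rw [hab]; exact pow_card_eq_one) (fun g => f (h * g ^ N))]
    refine Finset.sum_congr rfl fun s hs => ?_
    simp only [mem_filter, mem_univ, true_and, and_true] at hs ⊢
    refine Finset.sum_congr rfl fun z hz => ?_
    simp only [mem_filter, mem_univ, true_and] at hz
    rw [hN1 s z hs hz.1 hz.2]
  have I2 : IsIntegral ℤ ((∑ s : L with s ^ b = 1, ψ s) / a) := by
    rw [← hd]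
    refine (congrArg (IsIntegral ℤ) ?_).mp (int_nat_mul b I1)
    rw [← hab]; push_cast; field_simp
  have hnc : IsIntegral ℤ ((∑ s : L with s ^ b = 1 ∧ ¬ ∀ g, Commute s g, ψ s) / a) := by
    refine class_int _ ψ a ?_ ?_ ?_
    · intro s hs t hst
      obtain ⟨c, rfl⟩ := isConj_iff.1 hst
      simp only [mem_filter, mem_univ, true_and] at hs ⊢
      refine ⟨by rw [conj_pow, hs.1]; simp, fun hc => hs.2 fun g => ?_⟩
      rw [← Commute.conj_iff c]; exact hc _
    · intro s s' hss
      refine psi_conj (fun _ z => f (h * z)) ?_ (fun z => z ^ a = 1) ?_ s s' hss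
      · intro t s z
        rw [← hf.conj (h * z) t]
        congr 1
        rw [← mul_assoc, ← mul_assoc, ← mul_assoc, (hh t).eq]
      · intro t z
        rw [conj_pow]; simp
    · intro s hs
      simp only [mem_filter, mem_univ, true_and] at hs
      have hlt : Fintype.card (Subgroup.centralizer ({s} : Set L)) < n := by
        rw [← hn]
        refine Fintype.card_subtype_lt (p := fun z => z ∈ Subgroup.centralizer ({s} : Set L)) (x := (not_forall.1 hs.2).choose) fun hc => ?_
        exact (not_forall.1 hs.2).choose_spec (Subgroup.mem_centralizer_iff.1 hc s rfl)
      have hh' : h ∈ Subgroup.centralizer ({s} : Set L) := Subgroup.mem_centralizer_iff.2 (by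
        rintro _ rfl; exact (hh _).symm)
      have := ih _ hlt (Subgroup.centralizer ({s} : Set L)) rfl _ (hf.comp (Subgroup.subtype _)) ⟨h, hh'⟩
        (fun g => Subtype.ext (hh g))
      exact lemQ_cent hq s h hh' f (by convert this)
  let Z : Subgroup L := 
    { carrier := {s | s ^ b = 1 ∧ ∀ g, Commute s g}
      one_mem' := ⟨by simp, fun g => Commute.one_left g⟩
      mul_mem' := fun {s t} hs ht => ⟨by rw [(hs.2 t).mul_pow, hs.1, ht.1, one_mul], fun g => (hs.2 g).mul_left (ht.2 g)⟩
      inv_mem' := fun {s} hs => ⟨by rw [inv_pow, hs.1, inv_one], fun g => (hs.2 g).inv_left⟩ }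
  have hZ : (Nat.card Z).Coprime a := by
    apply Nat.Coprime.pow_right
    rw [Nat.coprime_comm, hq.coprime_iff_not_dvd]
    intro hdvd
    have : Fact q.Prime := ⟨hq⟩
    obtain ⟨z, hz⟩ := exists_prime_orderOf_dvd_card' q hdvd
    have h1 : (z : L) ^ b = 1 := z.2.1
    have h2 : z ^ b = 1 := Subtype.ext (by simpa using h1)
    have h3 := orderOf_dvd_of_pow_eq_one h2
    rw [hz] at h3
    exact hq.ne_one (Nat.eq_one_of_dvd_coprimes hqb dvd_rfl h3)
  have hsum : ∑ s : L with s ^ b = 1, ψ s = (Nat.card Z : k) * X + ∑ s : L with s ^ b = 1 ∧ ¬ ∀ g, Commute s g, ψ s := by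
    rw [← Finset.sum_filter_add_sum_filter_not _ (fun s : L => ∀ g, Commute s g), Finset.filter_filter, Finset.filter_filter]
    congr 1
    have : Nat.card Z = #{s : L | s ^ b = 1 ∧ ∀ g, Commute s g} := by
      rw [Nat.card_eq_fintype_card, Fintype.card_subtype]; congr
    rw [this, ← nsmul_eq_mul, ← Finset.sum_const]
    refine Finset.sum_congr rfl fun s hs => ?_
    simp only [mem_filter, mem_univ, true_and] at hs
    simp only [ψ, hX, hs.2, and_true]
  refine int_coprime (Nat.card Z) a hZ ?_ ?_
  · refine (congrArg (IsIntegral ℤ) ?_).mp (I2.sub hnc)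
    rw [hsum]; ring
  · rw [mul_div_cancel₀ _ hak]
    exact IsIntegral.sum _ fun z _ => hf.integral _
end P3
end Sq

open Pointwise
set_option linter.unusedSectionVars false

namespace Sq
open Finset
open scoped Classical
noncomputable section P4
universe u
variable {k : Type*} [Field k] [CharZero k] [IsAlgClosed k]

theorem oddQ {q : ℕ} (hq : q.Prime) (hq2 : q ≠ 2) {L : Type u} [Group L] [Fintype L] {f : L → k} (hf : IsRT k f) :
    IsIntegral ℤ ((∑ g : L with Odd (orderOf g), f g) / (q ^ (Fintype.card L).factorization q : ℕ)) := by
  have hcard : Fintype.card L ≠ 0 := Fintype.card_ne_zero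
  set a := q ^ (Fintype.card L).factorization q with ha
  set b := Fintype.card L / a with hb
  have hab : a * b = Fintype.card L := Nat.ordProj_mul_ordCompl_eq_self _ _
  have hqb : q.Coprime b := Nat.coprime_ordCompl hq hcard
  have hcop : a.Coprime b := hqb.pow_left _
  have ha0 : 0 < a := pow_pos hq.pos _
  have hb0 : 0 < b := Nat.pos_of_ne_zero fun h => hcard (by rw [← hab, h, mul_zero])
  have haodd : Odd a := (hq.odd_of_ne_two hq2).pow
  have hord : ∀ s z : L, s ^ b = 1 → z ^ a = 1 → Commute s z → (Odd (orderOf (s * z)) ↔ Odd (orderOf s)) := by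
    intro s z hs hz hsz
    have h1 := orderOf_dvd_of_pow_eq_one hs
    have h2 := orderOf_dvd_of_pow_eq_one hz
    rw [hsz.orderOf_mul_eq_mul_orderOf_of_coprime ((hcop.symm.coprime_dvd_left h1).coprime_dvd_right h2), Nat.odd_mul]
    exact and_iff_left (haodd.of_dvd_nat h2)
  rw [decomp hcop ha0 hb0 _ (fun g _ => by rw [hab]; exact pow_card_eq_one) f]
  have e : ∑ s : L with s ^ b = 1, ∑ z : L with z ^ a = 1 ∧ Commute s z ∧ s * z ∈ ({g : L | Odd (orderOf g)} : Finset L), f (s * z)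
     = ∑ s : L with s ^ b = 1 ∧ Odd (orderOf s), ∑ z : L with z ^ a = 1 ∧ Commute s z, f (s * z) := by
    rw [← Finset.filter_filter, Finset.sum_filter (s := ({s : L | s ^ b = 1} : Finset L))]
    refine Finset.sum_congr rfl fun s hs => ?_
    simp only [mem_filter, mem_univ, true_and] at hs
    split_ifs with h
    · refine Finset.sum_congr ?_ fun _ _ => rfl
      ext z
      simp only [mem_filter, mem_univ, true_and]
      refine ⟨fun h => ⟨h.1, h.2.1⟩, fun h' => ⟨h'.1, h'.2, (hord s z hs h'.1 h'.2).2 h⟩⟩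
    · apply Finset.sum_eq_zero
      intro z hz
      simp only [mem_filter, mem_univ, true_and] at hz
      exact absurd ((hord s z hs hz.1 hz.2.1).1 hz.2.2) h
  rw [e]
  refine class_int _ (fun s => ∑ z : L with z ^ a = 1 ∧ Commute s z, f (s * z)) a ?_ ?_ ?_
  · intro s hs t hst
    obtain ⟨c, rfl⟩ := isConj_iff.1 hst
    simp only [mem_filter, mem_univ, true_and] at hs ⊢
    refine ⟨by rw [conj_pow, hs.1]; simp, ?_⟩
    have : orderOf (c * s * c⁻¹) = orderOf s := by
      simpa using orderOf_injective (MulAut.conj c).toMonoidHom (MulAut.conj c).injective s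
    rw [this]; exact hs.2
  · intro s s' hss
    refine psi_conj (fun s z => f (s * z)) ?_ (fun z => z ^ a = 1) ?_ s s' hss
    · intro t s z
      rw [← hf.conj (s * z) t]
      congr 1; group
    · intro t z
      rw [conj_pow]; simp
  · intro s hs
    have hs' : s ∈ Subgroup.centralizer ({s} : Set L) := Subgroup.mem_centralizer_iff.2 (by rintro _ rfl; rfl)
    have := lemQ (k := k) q hq _ (Subgroup.centralizer ({s} : Set L)) rfl _ (hf.comp (Subgroup.subtype _)) ⟨s, hs'⟩
        (fun g => Subtype.ext (Subgroup.mem_centralizer_iff.1 g.2 s rfl))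
    exact lemQ_cent hq s s hs' f (by convert this)

theorem int_div_nat (S : k) (m : ℕ) (hm : m ≠ 0)
    (h : ∀ q, q.Prime → q ∣ m → IsIntegral ℤ (S / (q ^ m.factorization q : ℕ))) (h1 : IsIntegral ℤ S) : IsIntegral ℤ (S / m) := by
  induction m using Nat.recOnPosPrimePosCoprime with
  | prime_pow p n hp hn =>
    have := h p hp (dvd_pow_self _ hn.ne')
    simpa [hp.factorization_self] using this
  | zero => exact absurd rfl hm
  | one => simpa using h1
  | coprime a b ha hb hab iha ihb =>
    have ha0 : (a : k) ≠ 0 := by exact_mod_cast (by omega)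
    have hb0 : (b : k) ≠ 0 := by exact_mod_cast (by omega)
    have key : ∀ a b : ℕ, 1 < a → 1 < b → a.Coprime b → (∀ q, q.Prime → q ∣ a * b → IsIntegral ℤ (S / (q ^ (a * b).factorization q : ℕ)))
        → ∀ q, q.Prime → q ∣ a → IsIntegral ℤ (S / (q ^ a.factorization q : ℕ)) := by
      intro a b ha hb hab h q hq hqa
      have := h q hq (hqa.mul_right _)
      rw [Nat.factorization_mul (by omega) (by omega), Finsupp.add_apply,
        Nat.factorization_eq_zero_of_not_dvd (n := b) (p := q) (fun hqb => hq.ne_one (Nat.eq_one_of_dvd_coprimes hab hqa hqb)), add_zero] at this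
      exact this
    refine int_coprime a b hab ?_ ?_
    · refine (congrArg (IsIntegral ℤ) ?_).mp (ihb (by omega) (key b a hb ha hab.symm (by rwa [mul_comm b a])))
      push_cast; field_simp
    · refine (congrArg (IsIntegral ℤ) ?_).mp (iha (by omega) (key a b ha hb hab h))
      push_cast; field_simp

theorem odd_int {L : Type u} [Group L] [Fintype L] {f : L → k} (hf : IsRT k f) (e m : ℕ) (hm : Odd m)
    (hc : Fintype.card L = 2 ^ e * m) :
    IsIntegral ℤ ((∑ g : L with Odd (orderOf g), f g) / (m : k)) := by
  refine int_div_nat _ m (by rintro rfl; simp at hm) ?_ (IsIntegral.sum _ fun g _ => hf.integral g)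
  intro q hq hqm
  have hq2 : q ≠ 2 := by
    rintro rfl
    rw [← Nat.not_even_iff_odd, even_iff_two_dvd] at hm
    exact hm hqm
  have := oddQ hq hq2 hf
  rw [hc, Nat.factorization_mul (by positivity) (by rintro rfl; simp at hm), Finsupp.add_apply,
    Nat.factorization_eq_zero_of_not_dvd (n := 2 ^ e) (p := q) (fun h => hq2 ?_), zero_add] at this
  · exact this
  · exact (Nat.prime_dvd_prime_iff_eq hq Nat.prime_two).1 (hq.dvd_of_dvd_pow h)

/-! rationality -/

/-- rational elements -/
def IsQ (x : k) : Prop := x ∈ (algebraMap ℚ k).fieldRange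

theorem IsQ.nat (n : ℕ) : IsQ (n : k) := natCast_mem (algebraMap ℚ k).fieldRange n

theorem IsQ.int {x : k} (h : IsQ x) (h' : IsIntegral ℤ x) : ∃ n : ℤ, x = n := by
  obtain ⟨q, rfl⟩ := h
  rw [isIntegral_algebraMap_iff (algebraMap ℚ k).injective, IsIntegrallyClosed.isIntegral_iff] at h'
  obtain ⟨n, rfl⟩ := h'
  exact ⟨n, by simp⟩

theorem rat_aux {L : Type u} [Group L] [Fintype L] {f : L → k} (E : Finset L)
    (hE : ∀ g ∈ E, ∀ h, Subgroup.zpowers g = Subgroup.zpowers h → h ∈ E)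
    (hr : ∀ g ∈ E, IsQ (∑ h : L with Subgroup.zpowers g = Subgroup.zpowers h, f h)) : IsQ (∑ g ∈ E, f g) := by
  rw [← Finset.sum_fiberwise (g := Subgroup.zpowers) E]
  refine sum_mem fun j _ => ?_
  by_cases hj : ∃ g ∈ E, Subgroup.zpowers g = j
  · obtain ⟨g, hg, rfl⟩ := hj
    have h0 := hr g hg
    have e : E.filter (fun i => Subgroup.zpowers i = Subgroup.zpowers g) = ({h : L | Subgroup.zpowers g = Subgroup.zpowers h} : Finset L) := ?_
    · rw [e]; exact h0
    ext h
    simp only [mem_filter, mem_univ, true_and]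
    exact ⟨fun h => h.2.symm, fun h' => ⟨hE g hg _ h', h'.symm⟩⟩
  · rw [Finset.filter_eq_empty_iff.2 (fun g hg h => hj ⟨g, hg, h⟩)]
    simp [zero_mem]

theorem rat_cyc {L : Type u} [Group L] [Fintype L] {f : L → k} (hf : IsRT k f) : ∀ (n : ℕ) (g : L), orderOf g = n →
    IsQ (∑ h : L with Subgroup.zpowers g = Subgroup.zpowers h, f h) := by
  intro n
  induction n using Nat.strong_induction_on with
  | _ n ih =>
  intro g hg
  obtain ⟨r, hr⟩ := (hf.comp (Subgroup.subtype (Subgroup.zpowers g))).avg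
  have e : ∑ x : Subgroup.zpowers g, f (Subgroup.subtype (Subgroup.zpowers g) x) = ∑ h : L with h ∈ Subgroup.zpowers g, f h := by
    rw [Finset.sum_subtype (p := fun h => h ∈ Subgroup.zpowers g)]
    · rfl
    · simp
  rw [e] at hr
  have hr' : IsQ (∑ h : L with h ∈ Subgroup.zpowers g, f h) := by
    rw [hr]; exact mul_mem (IsQ.nat _) (IsQ.nat _)
  have hs : IsQ (∑ h : L with h ∈ Subgroup.zpowers g ∧ ¬ Subgroup.zpowers g = Subgroup.zpowers h, f h) := by
    apply rat_aux
    · intro x hx y hxy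
      simp only [mem_filter, mem_univ, true_and, ← Subgroup.zpowers_le] at hx ⊢
      rwa [← hxy]
    · intro x hx
      simp only [mem_filter, mem_univ, true_and] at hx
      refine ih _ ?_ x rfl
      rw [← hg, ← Nat.card_zpowers, ← Nat.card_zpowers]
      refine lt_of_le_of_ne (Subgroup.card_le_of_le (Subgroup.zpowers_le.2 hx.1)) fun h => hx.2 ?_
      exact (Subgroup.eq_of_le_of_card_ge (Subgroup.zpowers_le.2 hx.1) h.ge).symm
  have : ∑ h : L with Subgroup.zpowers g = Subgroup.zpowers h, f h = (∑ h : L with h ∈ Subgroup.zpowers g, f h)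
      - ∑ h : L with h ∈ Subgroup.zpowers g ∧ ¬ Subgroup.zpowers g = Subgroup.zpowers h, f h := by
    rw [eq_sub_iff_add_eq, ← Finset.sum_filter_add_sum_filter_not ({h : L | h ∈ Subgroup.zpowers g} : Finset L)
      (fun h => Subgroup.zpowers g = Subgroup.zpowers h), Finset.filter_filter, Finset.filter_filter]
    congr 1
    refine Finset.sum_congr ?_ fun _ _ => rfl
    ext h
    simp only [mem_filter, mem_univ, true_and]
    refine ⟨fun h' => ⟨by rw [h']; exact Subgroup.mem_zpowers h, h'⟩, fun h' => h'.2⟩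
  rw [this]
  exact sub_mem hr' hs

theorem rat_sum {L : Type u} [Group L] [Fintype L] {f : L → k} (hf : IsRT k f) (E : Finset L)
    (hE : ∀ g ∈ E, ∀ h, Subgroup.zpowers g = Subgroup.zpowers h → h ∈ E) : IsQ (∑ g ∈ E, f g) :=
  rat_aux E hE fun g _ => rat_cyc hf _ g rfl

theorem odd_sum {L : Type u} [Group L] [Fintype L] {f : L → k} (hf : IsRT k f) (e m : ℕ) (hm : Odd m)
    (hc : Fintype.card L = 2 ^ e * m) :
    ∃ n : ℤ, ∑ g : L with Odd (orderOf g), f g = m * n := by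
  have hm0 : (m : k) ≠ 0 := by
    have : m ≠ 0 := by rintro rfl; simp at hm
    exact_mod_cast this
  obtain ⟨n, hn⟩ := IsQ.int (div_mem (rat_sum hf ({g : L | Odd (orderOf g)} : Finset L) (by
    intro g hg h hgh
    simp only [mem_filter, mem_univ, true_and] at hg ⊢
    rwa [← Nat.card_zpowers, ← hgh, Nat.card_zpowers])) (IsQ.nat m)) (odd_int hf e m hm hc)
  exact ⟨n, by rw [← hn]; field_simp⟩
end P4
end Sq

open Pointwise
set_option linter.unusedSectionVars false

namespace Sq
open Finset
open scoped Classical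
noncomputable section P5
universe u

/-- algebraic closure of the 2-adic numbers -/
abbrev K2 := PadicAlgCl 2

theorem n_add {a b : K2} {c : ℝ} (ha : ‖a‖ < c) (hb : ‖b‖ < c) : ‖a + b‖ < c :=
  lt_of_le_of_lt (PadicAlgCl.isNonarchimedean 2 a b) (max_lt ha hb)
theorem n_add_le {a b : K2} {c : ℝ} (ha : ‖a‖ ≤ c) (hb : ‖b‖ ≤ c) : ‖a + b‖ ≤ c :=
  le_trans (PadicAlgCl.isNonarchimedean 2 a b) (max_le ha hb)
theorem n_sub {a b : K2} {c : ℝ} (ha : ‖a‖ < c) (hb : ‖b‖ < c) : ‖a - b‖ < c := by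
  rw [sub_eq_add_neg]; exact n_add ha (by rwa [norm_neg])
theorem n_sub_le {a b : K2} {c : ℝ} (ha : ‖a‖ ≤ c) (hb : ‖b‖ ≤ c) : ‖a - b‖ ≤ c := by
  rw [sub_eq_add_neg]; exact n_add_le ha (by rwa [norm_neg])
theorem n_sum {ι : Type*} (s : Finset ι) (f : ι → K2) {c : ℝ} (hc : 0 < c) (h : ∀ i ∈ s, ‖f i‖ < c) : ‖∑ i ∈ s, f i‖ < c := by
  induction s using Finset.induction_on with
  | empty => simpa using hc
  | insert a s ha ih =>
    rw [Finset.sum_insert ha]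
    exact n_add (h _ (mem_insert_self _ _)) (ih fun i hi => h i (mem_insert_of_mem hi))
theorem n_sum_le {ι : Type*} (s : Finset ι) (f : ι → K2) {c : ℝ} (hc : 0 ≤ c) (h : ∀ i ∈ s, ‖f i‖ ≤ c) : ‖∑ i ∈ s, f i‖ ≤ c := by
  induction s using Finset.induction_on with
  | empty => simpa using hc
  | insert a s ha ih =>
    rw [Finset.sum_insert ha]
    exact n_add_le (h _ (mem_insert_self _ _)) (ih fun i hi => h i (mem_insert_of_mem hi))
theorem n_mul {a b : K2} (ha : ‖a‖ < 1) (hb : ‖b‖ ≤ 1) : ‖a * b‖ < 1 := by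
  rw [norm_mul]; nlinarith [norm_nonneg a, norm_nonneg b]
theorem n_mul_le {a b : K2} (ha : ‖a‖ ≤ 1) (hb : ‖b‖ ≤ 1) : ‖a * b‖ ≤ 1 := by
  rw [norm_mul]; exact mul_le_one₀ ha (norm_nonneg _) hb

theorem n_ext (n : ℤ) : ‖(n : K2)‖ = ‖(n : ℚ_[2])‖ := by
  rw [← PadicAlgCl.norm_extends 2 (n : ℚ_[2]), map_intCast]

theorem n_int (n : ℤ) : ‖(n : K2)‖ ≤ 1 := by
  have := n_ext n
  rw [this]; exact Padic.norm_int_le_one n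

theorem n_even (n : ℤ) : ‖(n : K2)‖ < 1 ↔ Even n := by
  have := n_ext n
  rw [this, Padic.norm_intCast_lt_one_iff, even_iff_two_dvd]; rfl

theorem n_pow8 (n : ℤ) (j : ℕ) : ‖(n : K2)‖ ≤ (2:ℝ) ^ (-(j:ℤ)) ↔ (2 ^ j : ℤ) ∣ n := by
  have := n_ext n
  rw [this]
  have h := Padic.norm_int_le_pow_iff_dvd (p := 2) n j
  simpa using h

theorem n_two : ‖(2 : K2)‖ = 1 / 2 := by
  have := PadicAlgCl.valuation_p 2
  have h2 := PadicAlgCl.valuation_coe 2 (2 : K2)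
  rw [← h2]
  have h3 : ((2:ℕ) : K2) = 2 := by norm_num
  rw [← h3, this]; norm_num

theorem n_odd (n : ℤ) (h : Odd n) : ‖(n : K2)‖ = 1 := by
  have h1 := n_int n
  have h2 := (n_even n).not.2 (by rwa [Int.not_even_iff_odd])
  linarith [not_lt.1 h2]

theorem n_oddN (n : ℕ) (h : Odd n) : ‖(n : K2)‖ = 1 := by
  have := n_odd n (by exact_mod_cast h)
  simpa using this

theorem n_integral {a : K2} (h : IsIntegral ℤ a) : ‖a‖ ≤ 1 := by
  have h1 : IsIntegral (Valuation.integer (Valued.v : Valuation K2 NNReal)) a := h.tower_top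
  have h2 := (Valuation.integer.integers (Valued.v : Valuation K2 NNReal)).isIntegral_iff_v_le_one.1 h1
  rw [← PadicAlgCl.valuation_coe]
  exact_mod_cast h2

/-- congruence -/
def Cg (a b : K2) : Prop := ‖a - b‖ < 1

theorem Cg.refl (a : K2) : Cg a a := by simp [Cg]
theorem Cg.symm {a b : K2} (h : Cg a b) : Cg b a := by rwa [Cg, norm_sub_rev]
theorem Cg.trans {a b c : K2} (h : Cg a b) (h' : Cg b c) : Cg a c := by
  have := n_add h h'
  simpa [Cg] using this
theorem Cg.add {a b c d : K2} (h : Cg a b) (h' : Cg c d) : Cg (a + c) (b + d) := by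
  have := n_add h h'
  rw [Cg]; convert this using 2; ring
theorem Cg.sum {ι : Type*} (s : Finset ι) (f g : ι → K2) (h : ∀ i ∈ s, Cg (f i) (g i)) : Cg (∑ i ∈ s, f i) (∑ i ∈ s, g i) := by
  rw [Cg, ← Finset.sum_sub_distrib]
  exact n_sum _ _ one_pos h
theorem Cg.mul {a b c d : K2} (h : Cg a b) (h' : Cg c d) (hb : ‖b‖ ≤ 1) (hc : ‖c‖ ≤ 1) : Cg (a * c) (b * d) := by
  have := n_add (n_mul h hc) (n_mul h' hb)
  rw [Cg]; convert this using 2; ring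
theorem Cg.int {a b : ℤ} : Cg (a : K2) b ↔ (Even a ↔ Even b) := by
  rw [Cg, ← Int.cast_sub, n_even, Int.even_sub]
/-- odd multiplier -/
theorem Cg.odd_mul {n : ℤ} (hn : Odd n) {a : K2} (ha : ‖a‖ ≤ 1) : Cg (n * a) a := by
  have : (n : K2) * a - a = ((n - 1 : ℤ) : K2) * a := by push_cast; ring
  rw [Cg, this]
  refine n_mul ((n_even _).2 ?_) ha
  exact hn.sub_odd odd_one

section
variable {m : Type*} [Fintype m] [DecidableEq m]

theorem four_idem (X : Matrix m m K2) (h : X ^ 4 = 1) :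
    let E := (4 : K2)⁻¹ • (1 + X + X ^ 2 + X ^ 3)
    E * E = E := by
  intro E
  have hX : X * E = E := by
    simp only [E, mul_smul_comm]
    congr 1
    simp only [mul_add, mul_one, ← pow_succ']
    rw [← pow_two, h]; abel
  have h2 : X ^ 2 * E = E := by rw [pow_two, mul_assoc, hX, hX]
  have h3 : X ^ 3 * E = E := by rw [pow_succ, mul_assoc, hX, h2]
  conv_lhs => lhs; simp only [E]
  rw [smul_mul_assoc, add_mul, add_mul, add_mul, hX, h2, h3, one_mul]
  rw [show E + E + E + E = (4 : K2) • E by module, smul_smul]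
  norm_num

theorem tr_congr (U M : Matrix m m K2) (hU : U ^ 4 = 1) (hc : Commute U M) (N : ℕ) (hN : 0 < N) (hM : M ^ N = 1) :
    Cg M.trace (U * M).trace := by
  obtain ⟨i, hi⟩ := IsAlgClosed.exists_pow_nat_eq (-1 : K2) (n := 2) (by norm_num)
  let E : K2 → Matrix m m K2 := fun c => (4 : K2)⁻¹ • (1 + (c • U) + (c • U) ^ 2 + (c • U) ^ 3)
  have hE : ∀ c : K2, c ^ 4 = 1 → E c * E c = E c := by
    intro c hc'
    refine four_idem (c • U) ?_
    rw [smul_pow, hU, hc', one_smul]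
  have hEc : ∀ c, Commute (E c) M := by
    intro c
    have h1 : Commute (c • U) M := hc.smul_left c
    exact ((((Commute.one_left M).add_left h1).add_left (h1.pow_left 2)).add_left (h1.pow_left 3)).smul_left _
  have hEi : ∀ c : K2, c ^ 4 = 1 → ‖(E c * M).trace‖ ≤ 1 := by
    intro c hc'
    apply n_integral
    refine trace_integral _ 1 (N+1) (by omega) ?_
    have hp : ∀ j : ℕ, E c ^ (j+1) = E c := by
      intro j
      induction j with
      | zero => simp
      | succ j ih => rw [pow_succ, ih, hE c hc']
    rw [pow_one, (hEc c).mul_pow, hp, pow_succ M, hM, one_mul]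
  have i3 : i ^ 3 = - i := by rw [pow_succ, hi]; ring
  have i4 : i ^ 4 = 1 := by rw [show i ^ 4 = (i ^ 2) ^ 2 by ring, hi]; norm_num
  have key : 1 - U = (1 - i) • E (-i) + (2 : K2) • E (-1) + (1 + i) • E i := by
    simp only [E, smul_pow, smul_smul, smul_add]
    have : (1 : Matrix m m K2) - U = (((1 - i) * 4⁻¹ + 2 * 4⁻¹ + (1+i) * 4⁻¹)) • (1 : Matrix m m K2)
       + ((1 - i) * (4⁻¹ * (-i)) + 2 * (4⁻¹ * (-1)) + (1 + i) * (4⁻¹ * i)) • U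
       + ((1 - i) * (4⁻¹ * (-i) ^ 2) + 2 * (4⁻¹ * (-1) ^ 2) + (1 + i) * (4⁻¹ * i ^ 2)) • U ^ 2
       + ((1 - i) * (4⁻¹ * (-i) ^ 3) + 2 * (4⁻¹ * (-1) ^ 3) + (1 + i) * (4⁻¹ * i ^ 3)) • U ^ 3 := by
      have c0 : (((1 - i) * 4⁻¹ + 2 * 4⁻¹ + (1+i) * 4⁻¹)) = 1 := by ring
      have c1 : ((1 - i) * (4⁻¹ * (-i)) + 2 * (4⁻¹ * (-1)) + (1 + i) * (4⁻¹ * i)) = -1 := by linear_combination (1/2) * hi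
      have c2 : ((1 - i) * (4⁻¹ * (-i) ^ 2) + 2 * (4⁻¹ * (-1) ^ 2) + (1 + i) * (4⁻¹ * i ^ 2)) = 0 := by linear_combination (1/2) * hi
      have c3 : ((1 - i) * (4⁻¹ * (-i) ^ 3) + 2 * (4⁻¹ * (-1) ^ 3) + (1 + i) * (4⁻¹ * i ^ 3)) = 0 := by linear_combination (1/2) * i4
      rw [c0, c1, c2, c3]; simp [sub_eq_add_neg]
    rw [this]; module
  have hn1 : ‖1 - i‖ < 1 := by
    have : ‖1 - i‖ ^ 2 < 1 := by
      rw [← norm_pow, show (1 - i) ^ 2 = 2 * (-i) by linear_combination hi, norm_mul, n_two, norm_neg]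
      have : ‖i‖ ^ 4 = 1 := by rw [← norm_pow, i4, norm_one]
      have : ‖i‖ = 1 := (pow_eq_one_iff_of_nonneg (norm_nonneg _) (by norm_num)).1 this
      rw [this]; norm_num
    nlinarith [norm_nonneg (1 - i)]
  have hn2 : ‖1 + i‖ < 1 := by
    rw [show 1 + i = 2 - (1 - i) by ring]
    exact n_sub (by rw [n_two]; norm_num) hn1
  have : M.trace - (U * M).trace = (1 - i) * (E (-i) * M).trace + 2 * (E (-1) * M).trace + (1 + i) * (E i * M).trace := by
    rw [← Matrix.trace_sub, show M - U * M = (1 - U) * M by noncomm_ring, key]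
    simp [add_mul, Matrix.trace_add, Matrix.trace_smul]
  rw [Cg, this]
  refine n_add (n_add (n_mul hn1 (hEi _ ?_)) (n_mul (by rw [n_two]; norm_num) (hEi _ ?_))) (n_mul hn2 (hEi _ i4))
  · rw [← i4]; ring
  · norm_num
end

theorem rt_congr {L : Type*} [Group L] [Fintype L] {f : L → K2} (hf : IsRT K2 f) (u g : L) (hu : u ^ 4 = 1) (hc : Commute u g) :
    Cg (f g) (f (u * g)) := by
  obtain ⟨m, i1, i2, ρ, h⟩ := hf
  rw [h, h, map_mul]
  refine tr_congr _ _ (by rw [← map_pow, hu, map_one]) (hc.map ρ) (Fintype.card L) Fintype.card_pos ?_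
  rw [← map_pow, pow_card_eq_one, map_one]

end P5
end Sq

open Pointwise
set_option linter.unusedSectionVars false

namespace Sq
open Finset
open scoped Classical
noncomputable section P6
universe u
section gen
variable {k : Type*} [Field k] [CharZero k] [IsAlgClosed k] {G : Type u} [Group G] [Fintype G] (T : CT k G)

theorem CT.s_int (i) (y : G) (hy : y ^ 2 = 1) : ∃ s : ℤ, T.chi i y = s ∧ (s = T.n i → T.rho i y = 1) ∧ (s = - T.n i → T.rho i y = -1) := by
  set R := T.rho i y with hR
  have hRR : R * R = 1 := by rw [hR, ← map_mul, ← pow_two, hy, map_one]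
  have h2 : (2 : k) ≠ 0 := two_ne_zero
  have hE : ((2:k)⁻¹ • (1 + R)) * ((2:k)⁻¹ • (1 + R)) = (2:k)⁻¹ • (1 + R) := by
    rw [smul_mul_smul_comm, add_mul, mul_add, mul_add, hRR, one_mul, mul_one, one_mul,
      show (1 + R) + (R + 1) = (2 : k) • (1 + R) by module, smul_smul]
    congr 1; field_simp
  obtain ⟨r, hr, -, hr0, hr1⟩ := idem_trace _ hE
  have h1 : T.chi i y = R.trace := rfl
  rw [Matrix.trace_smul, Matrix.trace_add, Matrix.trace_one, Fintype.card_fin, smul_eq_mul, ← h1] at hr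
  refine ⟨2 * r - T.n i, ?_, ?_, ?_⟩
  · push_cast; rw [← hr]; field_simp; ring
  · intro h
    have := hr1 (by rw [Fintype.card_fin]; omega)
    have h3 := congrArg (fun M => (2:k) • M) this
    simp only [smul_smul, mul_inv_cancel₀ h2, one_smul] at h3
    have h4 : R = (2 : k) • (1 : Matrix _ _ k) - 1 := by rw [← h3]; abel
    rw [h4]; module
  · intro h
    have := hr0 (by omega)
    rw [smul_eq_zero] at this
    have := this.resolve_left (inv_ne_zero h2)
    exact (neg_eq_of_add_eq_zero_right this).symm

theorem CT.triv_of_gen (x : G) (hgen : Subgroup.closure {y | IsConj x y} = ⊤) (i) (h : T.rho i x = 1) (g : G) : T.rho i g = 1 := by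
  have : Subgroup.closure {y | IsConj x y} ≤ (T.rho i).ker := by
    rw [Subgroup.closure_le]
    intro y hy
    obtain ⟨c, rfl⟩ := isConj_iff.1 hy
    change T.rho i (c * x * c⁻¹) = 1
    rw [map_mul, map_mul, h, mul_one, ← map_mul]; simp
  rw [hgen] at this
  exact this (Subgroup.mem_top g)

theorem CT.n_one_of_neg (x : G) (hgen : Subgroup.closure {y | IsConj x y} = ⊤) (i) (h : T.rho i x = -1) : T.n i = 1 := by
  apply T.n_eq_one_of_scalar
  intro g
  have hg : g ∈ Subgroup.closure {y | IsConj x y} := by rw [hgen]; trivial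
  suffices T.rho i g = 1 ∨ T.rho i g = -1 by
    rcases this with h | h
    · exact ⟨1, by rw [h, one_smul]⟩
    · exact ⟨-1, by rw [h]; module⟩
  induction hg using Subgroup.closure_induction with
  | mem y hy =>
    obtain ⟨c, rfl⟩ := isConj_iff.1 hy
    right
    rw [map_mul, map_mul, h, mul_neg, mul_one, neg_mul, ← map_mul]; simp
  | one => left; simp
  | mul a b _ _ ha hb =>
    rw [map_mul]
    rcases ha with h | h <;> rcases hb with h' | h' <;> rw [h, h'] <;> simp
  | inv a _ ha =>
    have h1 : T.rho i a * T.rho i a⁻¹ = 1 := by rw [← map_mul]; simp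
    rcases ha with h | h <;> rw [h] at h1
    · left; simpa using h1
    · right; rw [neg_mul, one_mul] at h1; rw [← h1]; simp

/-- the Q identity -/
theorem CT.Q_id (i) (x : G) (K : Finset G) (hK : ∀ g t, t * g * t⁻¹ ∈ K ↔ g ∈ K) (hKx : ∀ y ∈ K, IsConj x y) :
    ∑ y ∈ K, T.chi i (x * y) = #K * (T.chi i x) ^ 2 / T.n i := by
  have h := T.sum_class i (fun g => if g ∈ K then 1 else 0) (by intro g t; simp [hK])
  have h2 : T.om i (fun g => if g ∈ K then 1 else 0) = #K * T.chi i x / T.n i := by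
    simp only [CT.om, ite_mul, one_mul, zero_mul]
    rw [← Finset.sum_filter, Finset.filter_mem_eq_inter, Finset.univ_inter]
    congr 1
    rw [← nsmul_eq_mul, ← Finset.sum_const]
    refine Finset.sum_congr rfl fun y hy => ?_
    obtain ⟨c, rfl⟩ := isConj_iff.1 (hKx y hy)
    exact T.chi_conj i x c
  rw [h2] at h
  have h3 := congrArg (fun M => (T.rho i x * M).trace) h
  simp only [ite_smul, one_smul, zero_smul] at h3
  rw [← Finset.sum_filter, Finset.filter_mem_eq_inter, Finset.univ_inter, Finset.mul_sum, Matrix.trace_sum] at h3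
  simp only [← map_mul] at h3
  rw [mul_smul_comm, mul_one, Matrix.trace_smul] at h3
  change ∑ y ∈ K, T.chi i (x * y) = _ • T.chi i x at h3
  rw [h3, smul_eq_mul]; ring

/-- section sums -/
def CT.S (E : Finset G) (i j : Fin T.N) : k := ∑ g ∈ E, T.chi i g * T.chi j g⁻¹

theorem CT.S_vec (E : Finset G) (hE : ∀ g t, t * g * t⁻¹ ∈ E ↔ g ∈ E) (i) (z : G) :
    ∑ j, T.S E i j * T.chi j z = if z ∈ E then Fintype.card G * T.chi i z else 0 := by
  simp only [CT.S, Finset.sum_mul, mul_assoc]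
  rw [Finset.sum_comm]
  simp only [← Finset.mul_sum, T.F3]
  simp only [Finset.mul_sum, mul_ite, mul_one, mul_zero]
  rw [Finset.sum_comm]
  have : ∀ t : G, ∑ g ∈ E, (if t * g⁻¹ * t⁻¹ = z⁻¹ then T.chi i g else 0) = if z ∈ E then T.chi i z else 0 := by
    intro t
    have : ∀ g, t * g⁻¹ * t⁻¹ = z⁻¹ ↔ g = t⁻¹ * z * t⁻¹⁻¹ := by
      intro g
      rw [← inv_inj, inv_inv]
      constructor
      · rintro rfl; group
      · rintro rfl; group
    simp only [this]
    rw [Finset.sum_ite_eq', T.chi_conj]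
    simp only [hE]
  simp only [this]
  split_ifs <;> simp

theorem CT.S_mul (E E' : Finset G) (hE : ∀ g t, t * g * t⁻¹ ∈ E ↔ g ∈ E) (i l) :
    ∑ j, T.S E i j * T.S E' j l = Fintype.card G * T.S (E' ∩ E) i l := by
  conv_lhs => simp only [CT.S, Finset.mul_sum, ← mul_assoc]
  rw [Finset.sum_comm]
  simp only [← Finset.sum_mul]
  have := T.S_vec E hE i
  simp only [CT.S] at this
  simp only [this]
  rw [CT.S, Finset.mul_sum, ← Finset.filter_mem_eq_inter, Finset.sum_filter]
  refine Finset.sum_congr rfl fun g _ => ?_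
  split_ifs
  · ring
  · simp

theorem CT.S_symm (E : Finset G) (hE : ∀ g, g⁻¹ ∈ E ↔ g ∈ E) (i j) : T.S E i j = T.S E j i := by
  rw [CT.S, CT.S]
  refine Finset.sum_bij' (fun g _ => g⁻¹) (fun g _ => g⁻¹) ?_ ?_ ?_ ?_ ?_ <;> intro g hg <;> simp [hE, hg, mul_comm]

theorem CT.om_class (i) (a : G → k) (ha : ∀ g t, a (t * g * t⁻¹) = a g) :
    T.om i a = ∑ c : ConjClasses G, a (Quotient.out c) * ((∑ g : G with ConjClasses.mk g = c, T.chi i g) / T.n i) := by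
  rw [CT.om, ← Finset.sum_fiberwise (g := ConjClasses.mk) Finset.univ, Finset.sum_div]
  refine Finset.sum_congr rfl fun c _ => ?_
  rw [mul_div_assoc', Finset.mul_sum]
  congr 1
  refine Finset.sum_congr rfl fun g hg => ?_
  simp only [mem_filter, mem_univ, true_and] at hg
  congr 1
  have : IsConj (Quotient.out c) g := by
    rw [← ConjClasses.mk_eq_mk_iff_isConj, hg]; exact Quotient.out_eq c
  obtain ⟨t, rfl⟩ := isConj_iff.1 this
  exact ha _ _

theorem class_conj (c : ConjClasses G) (g t : G) :
    t * g * t⁻¹ ∈ ({g : G | ConjClasses.mk g = c} : Finset G) ↔ g ∈ ({g : G | ConjClasses.mk g = c} : Finset G) := by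
  simp only [mem_filter, mem_univ, true_and]
  rw [ConjClasses.mk_eq_mk_iff_isConj.2 (isConj_iff.2 ⟨t, rfl⟩ : IsConj g (t * g * t⁻¹))]

/-- coefficient at one -/
theorem CT.coeff_one (a : G → k) : ∑ i, (T.n i : k) ^ 2 * T.om i a = Fintype.card G * a 1 := by
  have : ∀ i, (T.n i : k) ^ 2 * T.om i a = ∑ g, a g * (T.n i * T.chi i g) := by
    intro i
    rw [CT.om]
    have := T.n_ne i
    have h : ∑ g, a g * (T.n i * T.chi i g) = T.n i * ∑ g, a g * T.chi i g := by
      rw [Finset.mul_sum]; exact Finset.sum_congr rfl fun g _ => by ring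
    rw [h]; field_simp
  simp only [this]
  rw [Finset.sum_comm]
  simp only [← Finset.mul_sum, T.F1]
  simp [mul_comm]

/-- convolution -/
theorem CT.om_conv (i) (a b : G → k) (ha : ∀ g t, a (t * g * t⁻¹) = a g) (hb : ∀ g t, b (t * g * t⁻¹) = b g) :
    T.om i (fun g => ∑ h, a h * b (h⁻¹ * g)) = T.om i a * T.om i b := by
  have h1 := T.sum_class i a ha
  have h2 := T.sum_class i b hb
  have h3 : (∑ g, a g • T.rho i g) * (∑ g, b g • T.rho i g) = ∑ g, (∑ h, a h * b (h⁻¹ * g)) • T.rho i g := by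
    rw [Finset.sum_mul]
    simp only [Finset.sum_smul]
    rw [Finset.sum_comm]
    refine Finset.sum_congr rfl fun h _ => ?_
    rw [Finset.mul_sum]
    refine Fintype.sum_equiv (Equiv.mulLeft h) _ _ fun g => ?_
    simp only [Equiv.coe_mulLeft, smul_mul_smul_comm, ← map_mul]
    congr 2; group
  rw [h1, h2, smul_mul_smul_comm, mul_one] at h3
  have h4 := congrArg Matrix.trace h3
  rw [Matrix.trace_smul, Matrix.trace_one, Matrix.trace_sum, Fintype.card_fin] at h4
  simp only [Matrix.trace_smul, smul_eq_mul] at h4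
  rw [CT.om]
  change (∑ g, (∑ h, a h * b (h⁻¹ * g)) * (T.rho i g).trace) / _ = _
  rw [← h4, mul_div_assoc, div_self (T.n_ne i), mul_one]
end gen
end P6
end Sq

open Pointwise
set_option linter.unusedSectionVars false

namespace Sq
open Finset
open scoped Classical
noncomputable section P7
universe u

structure Pk {G : Type u} [Group G] [Fintype G] (m : ℕ) (x u : G) (O : Subgroup G) : Prop where
  hm : Odd m
  card : Fintype.card G = 8 * m
  hu : u ^ 2 = x
  hx2 : x ^ 2 = 1
  hx1 : x ≠ 1
  inv : ∀ y : G, orderOf y = 2 → IsConj x y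
  four : ∀ v : G, orderOf v = 4 → IsConj u v
  no8 : ∀ g : G, ¬ 8 ∣ orderOf g
  gen : Subgroup.closure {y | IsConj x y} = ⊤
  odd : ∀ y, IsConj x y → Odd (orderOf (x * y))
  hO : ∀ g, g ∈ O ↔ Commute u g ∧ Odd (orderOf g)
  cO : cc u = 4 * Nat.card O

variable {G : Type u} [Group G] [Fintype G] {m : ℕ} {x u : G} {O : Subgroup G}

def E1 (G : Type u) [Group G] [Fintype G] : Finset G := {g : G | Odd (orderOf g)}
def E2 (G : Type u) [Group G] [Fintype G] : Finset G := {g : G | ¬ Odd (orderOf g) ∧ ¬ 4 ∣ orderOf g}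
def E4 (G : Type u) [Group G] [Fintype G] : Finset G := {g : G | 4 ∣ orderOf g}

theorem orderOf_cj (g t : G) : orderOf (t * g * t⁻¹) = orderOf g := by
  have := MulAut.conj_apply t g
  rw [← this]; exact orderOf_injective (MulAut.conj t).toMonoidHom (MulAut.conj t).injective g

theorem E1_conj (g t : G) : t * g * t⁻¹ ∈ E1 G ↔ g ∈ E1 G := by simp [E1, orderOf_cj]
theorem E2_conj (g t : G) : t * g * t⁻¹ ∈ E2 G ↔ g ∈ E2 G := by simp [E2, orderOf_cj]
theorem E4_conj (g t : G) : t * g * t⁻¹ ∈ E4 G ↔ g ∈ E4 G := by simp [E4, orderOf_cj]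
theorem E1_inv (g : G) : g⁻¹ ∈ E1 G ↔ g ∈ E1 G := by simp [E1]
theorem E2_inv (g : G) : g⁻¹ ∈ E2 G ↔ g ∈ E2 G := by simp [E2]
theorem E4_inv (g : G) : g⁻¹ ∈ E4 G ↔ g ∈ E4 G := by simp [E4]
theorem E12 : E1 G ∩ E2 G = ∅ := by ext; simp +contextual [E1, E2]
theorem E21 : E2 G ∩ E1 G = ∅ := by rw [inter_comm, E12]
theorem E14 : E1 G ∩ E4 G = ∅ := by
  ext g; simp only [E1, E4, mem_inter, mem_filter, mem_univ, true_and, notMem_empty, iff_false, not_and]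
  intro h h'; have := h.of_dvd_nat h'; revert this; decide
theorem E41 : E4 G ∩ E1 G = ∅ := by rw [inter_comm, E14]
theorem E24 : E2 G ∩ E4 G = ∅ := by ext; simp +contextual [E4, E2]
theorem E42 : E4 G ∩ E2 G = ∅ := by rw [inter_comm, E24]

theorem E_sum {k : Type*} [Field k] (f : G → k) : ∑ g, f g = ∑ g ∈ E1 G, f g + ∑ g ∈ E2 G, f g + ∑ g ∈ E4 G, f g := by
  rw [← Finset.sum_union (by rw [Finset.disjoint_iff_inter_eq_empty, E12]),
    ← Finset.sum_union (by rw [Finset.disjoint_iff_inter_eq_empty, union_inter_distrib_right, E14, E24, union_empty])]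
  congr 1
  ext g
  simp only [E1, E2, E4, mem_union, mem_filter, mem_univ, true_and, true_iff]; tauto

theorem E_card : Fintype.card G = #(E1 G) + #(E2 G) + #(E4 G) := by
  have := E_sum (k := ℚ) (fun _ : G => 1)
  simp at this
  exact_mod_cast this

namespace Pk



theorem ox (P : Pk m x u O) : orderOf x = 2 := orderOf_eq_prime P.hx2 P.hx1

theorem ou (P : Pk m x u O) : orderOf u = 4 := by
  have := orderOf_eq_prime_pow (x := u) (p := 2) (n := 1) (by rw [pow_one, P.hu]; exact P.hx1) (by
    rw [show 2 ^ (1+1) = 2 * 2 from rfl, pow_mul, P.hu, P.hx2])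
  simpa using this

theorem mpos (P : Pk m x u O) : 0 < m := P.hm.pos

theorem odd_iff (P : Pk m x u O) (g : G) : Odd (orderOf g) ↔ g ^ m = 1 := by
  rw [← orderOf_dvd_iff_pow_eq_one]
  constructor
  · intro h
    have h1 : orderOf g ∣ 8 * m := by rw [← P.card]; exact orderOf_dvd_card
    refine Nat.Coprime.dvd_of_dvd_mul_left ?_ h1
    have : Nat.Coprime (orderOf g) (2^3) := Nat.Coprime.pow_right 3 (Nat.coprime_two_right.2 h)
    exact this
  · intro h; exact P.hm.of_dvd_nat h

theorem cop (P : Pk m x u O) : Nat.Coprime m 8 := by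
  have : Nat.Coprime m (2^3) := Nat.Coprime.pow_right 3 (Nat.coprime_two_right.2 P.hm)
  exact this

theorem card4 (P : Pk m x u O) : #{s : G | orderOf s = 4} * (4 * Nat.card O) = 8 * m := by
  rw [← P.cO, ← P.card, ← class_card u]
  congr 2
  ext s
  simp only [mem_filter, mem_univ, true_and]
  refine ⟨fun h => P.four s h, fun h => ?_⟩
  obtain ⟨t, rfl⟩ := isConj_iff.1 h
  rw [orderOf_cj, P.ou]

theorem Opos (P : Pk m x u O) : 0 < Nat.card O := Nat.card_pos

theorem sumE4 (P : Pk m x u O) {k : Type*} [Field k] [CharZero k] [IsAlgClosed k] (f : G → k) (hf : ∀ g t, f (t * g * t⁻¹) = f g) :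
    (Nat.card O : k) * ∑ g ∈ E4 G, f g = 2 * m * ∑ o : O, f (u * o) := by
  have hd := decomp (k := k) P.cop P.mpos (by norm_num : 0 < 8) (E4 G) (by
    intro g _; rw [mul_comm, ← P.card, pow_card_eq_one]) f
  have key : ∀ s : G, s ^ 8 = 1 → ∀ z : G, z ^ m = 1 → Commute s z → (s * z ∈ E4 G ↔ orderOf s = 4) := by
    intro s hs z hz hc
    have h8 : orderOf s ∣ 2 ^ 3 := orderOf_dvd_of_pow_eq_one hs
    have hzo := (P.odd_iff z).2 hz
    have hcop : Nat.Coprime (orderOf s) (orderOf z) :=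
      Nat.Coprime.coprime_dvd_left h8 (Nat.Coprime.pow_left 3 (Nat.coprime_two_left.2 hzo))
    simp only [E4, mem_filter, mem_univ, true_and]
    rw [hc.orderOf_mul_eq_mul_orderOf_of_coprime hcop]
    have h3 : 4 ∣ orderOf s * orderOf z ↔ 4 ∣ orderOf s := by
      have : Nat.Coprime 4 (orderOf z) := by
        have : Nat.Coprime (2^2) (orderOf z) := Nat.Coprime.pow_left 2 (Nat.coprime_two_left.2 hzo)
        exact this
      exact this.dvd_mul_right
    rw [h3]
    have h9 := P.no8 s
    obtain ⟨j, hj, hj'⟩ := (Nat.dvd_prime_pow Nat.prime_two).1 h8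
    rw [hj'] at h9 ⊢
    interval_cases j <;> revert h9 <;> decide
  have h1 : ∑ g ∈ E4 G, f g = ∑ s : G with orderOf s = 4, ∑ z : G with z ^ m = 1 ∧ Commute s z, f (s * z) := by
    rw [hd]
    symm
    rw [← Finset.sum_filter_add_sum_filter_not (s := ({s : G | s ^ 8 = 1} : Finset G)) (p := fun s => orderOf s = 4)]
    rw [Finset.sum_eq_zero (s := Finset.filter (fun s => ¬ orderOf s = 4) _)]
    · rw [add_zero]
      refine Finset.sum_congr ?_ ?_
      · ext s
        simp only [mem_filter, mem_univ, true_and]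
        refine ⟨fun h => ⟨?_, h⟩, fun h => h.2⟩
        rw [← orderOf_dvd_iff_pow_eq_one, h]; decide
      · intro s hs
        simp only [mem_filter, mem_univ, true_and] at hs
        refine Finset.sum_congr ?_ fun _ _ => rfl
        ext z
        simp only [mem_filter, mem_univ, true_and]
        have h8 := hs.1
        refine ⟨fun h => ⟨h.1, h.2, (key s h8 z h.1 h.2).2 hs.2⟩, fun h => ⟨h.1, h.2.1⟩⟩
    · intro s hs
      simp only [mem_filter, mem_univ, true_and] at hs
      refine Finset.sum_eq_zero fun z hz => ?_
      simp only [mem_filter, mem_univ, true_and] at hz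
      exact absurd ((key s hs.1 z hz.1 hz.2.1).1 hz.2.2) hs.2
  have h2 : ∀ s ∈ ({s : G | orderOf s = 4} : Finset G), ∑ z : G with z ^ m = 1 ∧ Commute s z, f (s * z) = ∑ o : O, f (u * o) := by
    intro s hs
    simp only [mem_filter, mem_univ, true_and] at hs
    rw [← psi_conj (fun s z => f (s * z)) (by
      intro t s z; rw [← hf (s * z) t]; congr 1; group) (fun z => z ^ m = 1) (by
      intro t z; simp [conj_pow]) u s (P.four s hs)]
    symm
    refine Finset.sum_bij (fun o _ => (o : G)) ?_ ?_ ?_ ?_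
    · rintro ⟨o, ho⟩ _
      simp only [mem_filter, mem_univ, true_and]
      have := (P.hO o).1 ho
      exact ⟨(P.odd_iff o).1 this.2, this.1⟩
    · rintro ⟨o, ho⟩ _ ⟨o', ho'⟩ _ h; simpa using h
    · intro z hz
      simp only [mem_filter, mem_univ, true_and] at hz
      exact ⟨⟨z, (P.hO z).2 ⟨hz.2, (P.odd_iff z).2 hz.1⟩⟩, mem_univ _, rfl⟩
    · intros; rfl
  rw [h1, Finset.sum_congr rfl h2, Finset.sum_const, nsmul_eq_mul, ← mul_assoc]
  congr 1
  have := P.card4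
  have : (#{s : G | orderOf s = 4} : k) * (4 * Nat.card O) = 8 * m := by exact_mod_cast this
  linear_combination (1/4) * this

theorem cE4 (P : Pk m x u O) : #(E4 G) = 2 * m := by
  have := P.sumE4 (k := K2) (fun _ => 1) (by simp)
  simp only [sum_const, card_univ, nsmul_eq_mul, mul_one] at this
  have h : Nat.card O * #(E4 G) = 2 * m * Fintype.card O := by exact_mod_cast this
  rw [← Nat.card_eq_fintype_card, mul_comm] at h
  exact Nat.eq_of_mul_eq_mul_right P.Opos h

theorem isConj_iff2 (P : Pk m x u O) (y : G) : IsConj x y ↔ orderOf y = 2 := by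
  refine ⟨fun h => ?_, P.inv y⟩
  obtain ⟨t, rfl⟩ := isConj_iff.1 h
  rw [orderOf_cj, P.ox]

theorem comm_eq (P : Pk m x u O) (y z : G) (hy : orderOf y = 2) (hz : orderOf z = 2) (h : Commute y z) : y = z := by
  have hc := (P.inv y hy)
  obtain ⟨t, rfl⟩ := isConj_iff.1 hc
  have h1 : Odd (orderOf (x * (t⁻¹ * z * t⁻¹⁻¹))) := P.odd _ (by rw [P.isConj_iff2, orderOf_cj, hz])
  have h2 : orderOf ((t * x * t⁻¹) * z) = orderOf (x * (t⁻¹ * z * t⁻¹⁻¹)) := by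
    rw [← orderOf_cj (x * (t⁻¹ * z * t⁻¹⁻¹)) t]; congr 1; group
  rw [← h2] at h1
  have h3 : ((t * x * t⁻¹) * z) ^ 2 = 1 := by
    rw [h.mul_pow, ← hz, pow_orderOf_eq_one, hz, ← hy, pow_orderOf_eq_one, one_mul]
  have h4 := orderOf_dvd_of_pow_eq_one h3
  have h5 : orderOf ((t * x * t⁻¹) * z) = 1 := by
    rcases (Nat.dvd_prime Nat.prime_two).1 h4 with h | h
    · exact h
    · rw [h] at h1; exact absurd h1 (by decide)
  rw [orderOf_eq_one_iff] at h5
  have hz2 : z * z = 1 := by rw [← pow_two, ← hz, pow_orderOf_eq_one]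
  rw [mul_eq_one_iff_eq_inv.1 h5]
  exact (eq_inv_of_mul_eq_one_left hz2).symm

theorem fib (P : Pk m x u O) (E : Finset G) (hE : ∀ g t, t * g * t⁻¹ ∈ E ↔ g ∈ E) (hev : ∀ g ∈ E, Even (orderOf g)) :
    #E = #{y : G | IsConj x y} * #{g ∈ E | Commute x g} := by
  have h1 : #E = ∑ y ∈ ({y : G | IsConj x y} : Finset G), #{g ∈ E | Commute y g} := by
    have : ∀ g ∈ E, #{y : G | IsConj x y ∧ Commute y g} = 1 := by
      intro g hg
      rw [Finset.card_eq_one]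
      have h0 : 0 < orderOf g := orderOf_pos g
      obtain ⟨r, hr⟩ := hev g hg
      refine ⟨g ^ r, ?_⟩
      have hgr : orderOf (g ^ r) = 2 := by
        rw [orderOf_pow, hr, ← two_mul, Nat.gcd_mul_left_left, Nat.mul_div_cancel _ (by omega)]
      ext y
      simp only [mem_filter, mem_univ, true_and, mem_singleton, P.isConj_iff2]
      constructor
      · rintro ⟨h, h'⟩
        exact P.comm_eq _ _ h hgr (h'.pow_right r)
      · rintro rfl
        exact ⟨hgr, (Commute.refl g).pow_left r⟩
    calc #E = ∑ g ∈ E, #{y : G | IsConj x y ∧ Commute y g} := by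
            rw [Finset.sum_congr rfl this]; simp
      _ = ∑ g ∈ E, ∑ y ∈ ({y : G | IsConj x y} : Finset G), if Commute y g then 1 else 0 := by
            refine Finset.sum_congr rfl fun g _ => ?_
            rw [← Finset.card_filter, Finset.filter_filter]
      _ = _ := by
            rw [Finset.sum_comm]
            refine Finset.sum_congr rfl fun g _ => ?_
            rw [← Finset.card_filter]
  rw [h1]
  rw [Finset.sum_const_nat]
  intro y hy
  simp only [mem_filter, mem_univ, true_and] at hy
  obtain ⟨t, rfl⟩ := isConj_iff.1 hy
  symm
  refine Finset.card_bij' (fun g _ => t * g * t⁻¹) (fun g _ => t⁻¹ * g * t⁻¹⁻¹) ?_ ?_ ?_ ?_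
  · intro g hg
    simp only [mem_filter, hE] at hg ⊢
    exact ⟨hg.1, by rw [Commute.conj_iff]; exact hg.2⟩
  · intro g hg
    simp only [mem_filter, hE] at hg ⊢
    refine ⟨hg.1, ?_⟩
    rw [← Commute.conj_iff t]; convert hg.2 using 1; group
  · intro g _; group
  · intro g _; group

theorem cE1 (P : Pk m x u O) : #(E1 G) = 3 * m := by
  have h4 := P.fib (E4 G) E4_conj (by
    intro g hg; simp only [E4, mem_filter, mem_univ, true_and] at hg
    exact even_iff_two_dvd.2 (dvd_trans (by decide) hg))
  have h2 := P.fib (E2 G) E2_conj (by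
    intro g hg; simp only [E2, mem_filter, mem_univ, true_and, Nat.not_odd_iff_even] at hg
    exact hg.1)
  rw [P.cE4] at h4
  have hE := E_card (G := G)
  rw [P.card, P.cE4] at hE
  have hk := class_card x
  rw [P.card] at hk
  have hcc : cc x = #{g ∈ E1 G | Commute x g} + #{g ∈ E2 G | Commute x g} + #{g ∈ E4 G | Commute x g} := by
    have h1 : cc x = #{g : G | Commute x g} := by
      rw [cc, Nat.card_eq_fintype_card, ← Fintype.card_subtype]
      refine Fintype.card_congr (Equiv.subtypeEquivRight fun g => ?_)
      rw [Subgroup.mem_centralizer_singleton_iff]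
      exact ⟨fun h => h.symm, fun h => h.symm⟩
    rw [h1]
    have := E_sum (k := ℚ) (fun g : G => if Commute x g then 1 else 0)
    simp only [Finset.sum_boole] at this
    exact_mod_cast this
  have h12 : #{g ∈ E1 G | Commute x g} = #{g ∈ E2 G | Commute x g} := by
    have hxx : x * x = 1 := by rw [← pow_two, P.hx2]
    refine Finset.card_bij' (fun g _ => x * g) (fun g _ => x * g) ?_ ?_ ?_ ?_
    · intro g hg
      simp only [E1, E2, mem_filter, mem_univ, true_and] at hg ⊢
      have : orderOf (x * g) = 2 * orderOf g := by
        rw [hg.2.orderOf_mul_eq_mul_orderOf_of_coprime (by rw [P.ox, Nat.coprime_two_left]; exact hg.1), P.ox]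
      refine ⟨⟨by rw [this]; simp, ?_⟩, (Commute.refl x).mul_right hg.2⟩
      rw [this]
      have := hg.1
      rw [Nat.odd_iff] at this
      omega
    · intro g hg
      simp only [E1, E2, mem_filter, mem_univ, true_and, Nat.not_odd_iff_even] at hg ⊢
      refine ⟨?_, (Commute.refl x).mul_right hg.2⟩
      obtain ⟨r, hr⟩ := hg.1.1
      have h0 : 0 < orderOf g := orderOf_pos g
      have hgr : orderOf (g ^ r) = 2 := by
        rw [orderOf_pow, hr, ← two_mul, Nat.gcd_mul_left_left, Nat.mul_div_cancel _ (by omega)]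
      have hx : x = g ^ r := P.comm_eq _ _ P.ox hgr (hg.2.pow_right r)
      have hro : Odd r := by
        rw [← Nat.not_even_iff_odd]; rintro ⟨q, rfl⟩; apply hg.1.2; omega
      have : (x * g) ^ r = 1 := by
        rw [hg.2.mul_pow, ← hx]
        obtain ⟨q, rfl⟩ := hro
        rw [pow_succ, pow_mul, P.hx2, one_pow, one_mul, hxx]
      exact hro.of_dvd_nat (orderOf_dvd_of_pow_eq_one this)
    · intro g _; simp only [← mul_assoc, hxx, one_mul]
    · intro g _; simp only [← mul_assoc, hxx, one_mul]
  rw [hcc, h12] at hk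
  have : #{y : G | IsConj x y} * (#{g ∈ E2 G | Commute x g} + #{g ∈ E2 G | Commute x g} + #{g ∈ E4 G | Commute x g}) = #(E2 G) + #(E2 G) + 2 * m := by
    rw [h4, h2]; ring
  rw [this] at hk
  omega

end Pk
end P7
end Sq

open Pointwise
set_option linter.unusedSectionVars false

namespace Sq
open Finset
open scoped Classical
noncomputable section P8
universe u

theorem four_avg {k : Type*} [Field k] [CharZero k] [IsAlgClosed k] {L : Type u} [Group L] [Fintype L] {f : L → k} (hf : IsRT k f)
    (u : L) (O : Subgroup L) (hu : u ^ 4 = 1) (hc : ∀ o ∈ O, Commute u o) :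
    IsIntegral ℤ ((∑ o : O, f (u * o)) / Fintype.card O) := by
  obtain ⟨m, i1, i2, ρ, h⟩ := hf
  set e := (Fintype.card O : k)⁻¹ • ∑ g : O, (ρ.comp O.subtype) g with he
  have h1 : e * e = e := avg_idem (ρ.comp O.subtype)
  have h2 : Commute (ρ u) e := by
    rw [he, commute_iff_eq, mul_smul_comm, smul_mul_assoc, Finset.mul_sum, Finset.sum_mul]
    congr 1
    refine Finset.sum_congr rfl fun o _ => ?_
    exact (hc o o.2).map ρ
  have h3 : (ρ u * e) ^ 1 = (ρ u * e) ^ 5 := by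
    have h5 : e ^ 5 = e := by
      rw [show e ^ 5 = e * e * (e * e) * e by simp only [pow_succ, pow_zero, one_mul, mul_assoc], h1, h1, h1]
    rw [h2.mul_pow 5, h5, pow_succ (ρ u), ← map_pow, hu, map_one, one_mul, pow_one]
  have := trace_integral _ 1 5 (by norm_num) h3
  refine (congrArg (IsIntegral ℤ) ?_).mp this
  rw [he, mul_smul_comm, Matrix.trace_smul, Finset.mul_sum, Matrix.trace_sum, smul_eq_mul, div_eq_inv_mul]
  congr 1
  refine Finset.sum_congr rfl fun o _ => ?_
  rw [h, map_mul]; rfl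

theorem pair_sum {G : Type u} (E : Finset G) (σ : G → G) (hσ : ∀ g ∈ E, σ g ∈ E ∧ σ (σ g) = g) (f : G → K2)
    (hf : ∀ g ∈ E, f (σ g) = f g) (hn : ∀ g ∈ E, ‖f g‖ ≤ 1) : Cg (∑ g ∈ E, f g) (∑ g ∈ E with σ g = g, f g) := by
  induction hN : #E using Nat.strong_induction_on generalizing E with
  | _ N ih =>
  by_cases h : ∀ g ∈ E, σ g = g
  · rw [Finset.filter_true_of_mem h]; exact Cg.refl _
  · push Not at h
    obtain ⟨g, hg, hne⟩ := h
    obtain ⟨h1, h2⟩ := hσ g hg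
    have hE : E = insert g (insert (σ g) ((E.erase g).erase (σ g))) := by
      rw [Finset.insert_erase (by simp [h1, hne]), Finset.insert_erase hg]
    set E' := (E.erase g).erase (σ g) with hE'
    have ha : g ∉ insert (σ g) E' := by simp [hE', hne.symm]
    have hb : σ g ∉ E' := by simp [hE']
    have hsub : ∀ a ∈ E', a ∈ E := fun a ha => by
      rw [hE] ; exact mem_insert_of_mem (mem_insert_of_mem ha)
    have hc := ih #E' (by
      rw [← hN, hE, Finset.card_insert_of_notMem ha, Finset.card_insert_of_notMem hb]; omega) E' (by
      intro a ha
      have haE := hsub a ha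
      obtain ⟨h3, h4⟩ := hσ a haE
      refine ⟨?_, h4⟩
      simp only [hE', mem_erase] at ha ⊢
      refine ⟨?_, ?_, h3⟩
      · intro hh; apply ha.2.1; rw [← h4, hh, h2]
      · intro hh; apply ha.1; rw [← h4, hh]) (fun a ha => hf a (hsub a ha)) (fun a ha => hn a (hsub a ha)) rfl
    have h5 : ∑ g ∈ E with σ g = g, f g = ∑ g ∈ E' with σ g = g, f g := by
      rw [hE, Finset.filter_insert, if_neg hne, Finset.filter_insert, if_neg (by rw [h2]; exact hne.symm)]
    rw [h5]
    rw [hE, Finset.sum_insert ha, Finset.sum_insert hb, hf g hg]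
    refine Cg.trans ?_ hc
    rw [Cg, show f g + (f g + ∑ x ∈ E', f x) - ∑ x ∈ E', f x = 2 * f g by ring, norm_mul, n_two]
    have := hn g hg
    linarith

variable {G : Type u} [Group G] [Fintype G] {m : ℕ} {x u : G} {O : Subgroup G}

structure Dt (T : CT K2 G) (m : ℕ) (U V W : Fin T.N → Fin T.N → ℤ) : Prop where
  hm : Odd m
  card : Fintype.card G = 8 * m
  hU : ∀ i j, T.S (E1 G) i j = m * U i j
  hV : ∀ i j, T.S (E2 G) i j = m * V i j
  hW : ∀ i j, T.S (E4 G) i j = 2 * m * W i j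
  sum : ∀ i j, U i j + V i j + 2 * W i j = if i = j then 8 else 0

theorem Pk.dt (P : Pk m x u O) (T : CT K2 G) : ∃ U V W, Dt T m U V W := by
  have hm0 : (m : K2) ≠ 0 := by have := P.mpos; exact_mod_cast this.ne'
  have h1 : ∀ i j, ∃ n : ℤ, T.S (E1 G) i j = m * n := fun i j =>
    odd_sum ((T.isRT i).mul_inv (T.isRT j)) 3 m P.hm P.card
  have h4 : ∀ i j, ∃ n : ℤ, T.S (E4 G) i j = 2 * m * n := by
    intro i j
    have hf := (T.isRT i).mul_inv (T.isRT j)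
    have hs := P.sumE4 (fun g => T.chi i g * T.chi j g⁻¹) hf.conj
    have hO : (Nat.card O : K2) ≠ 0 := by have := P.Opos; exact_mod_cast this.ne'
    have hi := four_avg hf u O (by rw [← P.ou, pow_orderOf_eq_one]) (fun o ho => ((P.hO o).1 ho).1)
    rw [← Nat.card_eq_fintype_card] at hi
    have hq : IsQ (T.S (E4 G) i j / (2 * m : ℕ)) := div_mem (rat_sum hf (E4 G) (by
      intro g hg h hgh
      simp only [E4, mem_filter, mem_univ, true_and] at hg ⊢
      rwa [← Nat.card_zpowers, ← hgh, Nat.card_zpowers])) (IsQ.nat _)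
    obtain ⟨n, hn⟩ := hq.int (by
      refine (congrArg (IsIntegral ℤ) ?_).mp hi
      rw [CT.S]
      push_cast
      field_simp
      linear_combination -hs)
    exact ⟨n, by rw [← hn]; push_cast; field_simp⟩
  choose U hU using h1
  choose W hW using h4
  refine ⟨U, fun i j => (if i = j then 8 else 0) - U i j - 2 * W i j, W, P.hm, P.card, hU, ?_, hW, ?_⟩
  · intro i j
    have := T.orth i j
    rw [E_sum] at this
    change T.S (E1 G) i j + T.S (E2 G) i j + T.S (E4 G) i j = _ at this
    rw [hU, hW, P.card] at this
    push_cast at this ⊢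
    split_ifs at this ⊢ <;> linear_combination this
  · intro i j; ring

namespace Dt
variable {T : CT K2 G} {U V W : Fin T.N → Fin T.N → ℤ}


theorem m0 (D : Dt T m U V W) : (m : K2) ≠ 0 := by have := D.hm.pos; exact_mod_cast this.ne'

theorem cK (D : Dt T m U V W) : (Fintype.card G : K2) = 8 * m := by rw [D.card]; push_cast; ring

theorem Us (D : Dt T m U V W) (i j) : U i j = U j i := by
  have := T.S_symm (E1 G) E1_inv i j
  rw [D.hU, D.hU] at this
  exact_mod_cast mul_left_cancel₀ D.m0 this
theorem Vs (D : Dt T m U V W) (i j) : V i j = V j i := by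
  have := T.S_symm (E2 G) E2_inv i j
  rw [D.hV, D.hV] at this
  exact_mod_cast mul_left_cancel₀ D.m0 this
theorem Ws (D : Dt T m U V W) (i j) : W i j = W j i := by
  have h1 := D.sum i j
  have h2 := D.sum j i
  rw [D.Us j i, D.Vs j i] at h2
  simp only [eq_comm (a := j)] at h2
  omega

theorem UU (D : Dt T m U V W) (i l) : ∑ j, U i j * U j l = 8 * U i l := by
  have := T.S_mul (E1 G) (E1 G) E1_conj i l
  simp only [inter_self, D.hU, D.cK] at this
  have h2 : (m * m : K2) * ((∑ j, U i j * U j l : ℤ) : K2) = (m * m) * ((8 * U i l : ℤ) : K2) := by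
    push_cast
    rw [Finset.mul_sum]
    calc _ = ∑ j, (m * U i j : K2) * (m * U j l) := Finset.sum_congr rfl fun _ _ => by ring
      _ = _ := by rw [this]; ring
  exact_mod_cast mul_left_cancel₀ (mul_ne_zero D.m0 D.m0) h2

theorem VV (D : Dt T m U V W) (i l) : ∑ j, V i j * V j l = 8 * V i l := by
  have := T.S_mul (E2 G) (E2 G) E2_conj i l
  simp only [inter_self, D.hV, D.cK] at this
  have h2 : (m * m : K2) * ((∑ j, V i j * V j l : ℤ) : K2) = (m * m) * ((8 * V i l : ℤ) : K2) := by
    push_cast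
    rw [Finset.mul_sum]
    calc _ = ∑ j, (m * V i j : K2) * (m * V j l) := Finset.sum_congr rfl fun _ _ => by ring
      _ = _ := by rw [this]; ring
  exact_mod_cast mul_left_cancel₀ (mul_ne_zero D.m0 D.m0) h2

theorem UW (D : Dt T m U V W) (i l) : ∑ j, U i j * W j l = 0 := by
  have := T.S_mul (E1 G) (E4 G) E1_conj i l
  simp only [E41, D.hU, D.hW, D.cK] at this
  have h2 : (2 * m * m : K2) * ((∑ j, U i j * W j l : ℤ) : K2) = (2 * m * m) * ((0 : ℤ) : K2) := by
    push_cast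
    rw [Finset.mul_sum]
    calc _ = ∑ j, (m * U i j : K2) * (2 * m * W j l) := Finset.sum_congr rfl fun _ _ => by ring
      _ = _ := by rw [this]; simp [CT.S]
  exact_mod_cast mul_left_cancel₀ (mul_ne_zero (mul_ne_zero two_ne_zero D.m0) D.m0) h2

theorem WW (D : Dt T m U V W) (i l) : ∑ j, W i j * W j l = 4 * W i l := by
  have := T.S_mul (E4 G) (E4 G) E4_conj i l
  simp only [inter_self, D.hW, D.cK] at this
  have h2 : (4 * m * m : K2) * ((∑ j, W i j * W j l : ℤ) : K2) = (4 * m * m) * ((4 * W i l : ℤ) : K2) := by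
    push_cast
    rw [Finset.mul_sum]
    calc _ = ∑ j, (2 * m * W i j : K2) * (2 * m * W j l) := Finset.sum_congr rfl fun _ _ => by ring
      _ = _ := by rw [this]; ring
  exact_mod_cast mul_left_cancel₀ (mul_ne_zero (mul_ne_zero (by norm_num) D.m0) D.m0) h2

/-- the matrix U fixes the values on odd elements -/
theorem Uv (D : Dt T m U V W) (i) (z : G) (hz : z ∈ E1 G) : ∑ j, (U i j : K2) * T.chi j z = 8 * T.chi i z := by
  have := T.S_vec (E1 G) E1_conj i z
  rw [if_pos hz, D.cK] at this
  simp only [D.hU] at this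
  apply mul_left_cancel₀ D.m0
  rw [Finset.mul_sum]
  calc _ = ∑ j, (m * U i j : K2) * T.chi j z := Finset.sum_congr rfl fun _ _ => by ring
    _ = _ := by rw [this]; ring

theorem Vv (D : Dt T m U V W) (i) (z : G) (hz : z ∈ E2 G) : ∑ j, (V i j : K2) * T.chi j z = 8 * T.chi i z := by
  have := T.S_vec (E2 G) E2_conj i z
  rw [if_pos hz, D.cK] at this
  simp only [D.hV] at this
  apply mul_left_cancel₀ D.m0
  rw [Finset.mul_sum]
  calc _ = ∑ j, (m * V i j : K2) * T.chi j z := Finset.sum_congr rfl fun _ _ => by ring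
    _ = _ := by rw [this]; ring
end Dt
end P8
end Sq

open Pointwise
set_option linter.unusedSectionVars false

namespace Sq
open Finset
open scoped Classical
noncomputable section P9
universe u
variable {G : Type u} [Group G] [Fintype G] {m : ℕ} {x u : G} {O : Subgroup G}

/-- central character at a class -/
def CT.oc (T : CT K2 G) (i : Fin T.N) (c : ConjClasses G) : K2 := (∑ g : G with ConjClasses.mk g = c, T.chi i g) / T.n i

theorem CT.oc_n (T : CT K2 G) (i : Fin T.N) (c : ConjClasses G) : ‖T.oc i c‖ ≤ 1 :=
  n_integral (T.om_integral i _ (class_conj c))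

/-- the principal block -/
def CT.B (T : CT K2 G) (i0 : Fin T.N) : Finset (Fin T.N) := {i | ∀ c, Cg (T.oc i c) (T.oc i0 c)}

theorem CT.om_n (T : CT K2 G) (i : Fin T.N) (a : G → K2) (ha : ∀ g t, a (t * g * t⁻¹) = a g) (hn : ∀ g, ‖a g‖ ≤ 1) :
    ‖T.om i a‖ ≤ 1 := by
  rw [T.om_class i a ha]
  exact n_sum_le _ _ (by norm_num) fun c _ => n_mul_le (hn _) (T.oc_n i c)

theorem CT.B_om (T : CT K2 G) (i0 c : Fin T.N) (hc : c ∈ T.B i0) (a : G → K2) (ha : ∀ g t, a (t * g * t⁻¹) = a g)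
    (hn : ∀ g, ‖a g‖ ≤ 1) : Cg (T.om c a) (T.om i0 a) := by
  rw [T.om_class c a ha, T.om_class i0 a ha]
  refine Cg.sum _ _ _ fun d _ => Cg.mul (Cg.refl _) ?_ (hn _) (T.oc_n c d)
  simp only [CT.B, mem_filter, mem_univ, true_and] at hc
  exact hc d

theorem CT.chi_n (T : CT K2 G) (i) (g : G) : ‖T.chi i g‖ ≤ 1 := n_integral ((T.isRT i).integral g)

theorem CT.S_eq_om (T : CT K2 G) (E : Finset G) (i j) : T.S E i j = T.n i * T.om i (fun g => if g ∈ E then T.chi j g⁻¹ else 0) := by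
  rw [CT.om, mul_div_cancel₀ _ (T.n_ne i), CT.S]
  simp only [ite_mul, zero_mul]
  rw [← Finset.sum_filter, Finset.filter_mem_eq_inter, Finset.univ_inter]
  exact Finset.sum_congr rfl fun g _ => mul_comm _ _

theorem CT.cl1 (T : CT K2 G) (E : Finset G) (hE : ∀ g t, t * g * t⁻¹ ∈ E ↔ g ∈ E) (j) (g t : G) :
    (if t * g * t⁻¹ ∈ E then T.chi j (t * g * t⁻¹)⁻¹ else 0) = if g ∈ E then T.chi j g⁻¹ else 0 := by
  rw [show (t * g * t⁻¹)⁻¹ = t * g⁻¹ * t⁻¹ by group, T.chi_conj]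
  simp only [hE]

theorem CT.D5a (T : CT K2 G) (i0 c : Fin T.N) (hc : c ∈ T.B i0) (h0 : T.n i0 = 1) (hm : Odd m) (E : Finset G)
    (hE : ∀ g t, t * g * t⁻¹ ∈ E ↔ g ∈ E) (η) (a p : ℤ) (h1 : T.S E c η = m * a) (h2 : T.S E i0 η = m * p)
    (o : ℕ) (ho : Odd o) (hn : T.n c = 2 * o) : ∃ b : ℤ, a = 2 * b ∧ (Even b ↔ Even p) := by
  rw [T.S_eq_om] at h1 h2
  set f : G → K2 := fun g => if g ∈ E then T.chi η g⁻¹ else 0 with hf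
  have hcl : ∀ g t, f (t * g * t⁻¹) = f g := T.cl1 E hE η
  have hfn : ∀ g, ‖f g‖ ≤ 1 := by
    intro g; simp only [hf]; split_ifs
    · exact T.chi_n _ _
    · simp
  have hB := T.B_om i0 c hc f hcl hfn
  have hon := T.om_n c f hcl hfn
  rw [h0, Nat.cast_one, one_mul] at h2
  rw [h2] at hB
  rw [hn] at h1
  push_cast at h1
  have h3 : ‖(a : K2)‖ < 1 := by
    have := congrArg norm h1
    rw [norm_mul, norm_mul, norm_mul, n_two, n_oddN m hm, n_oddN o ho, one_mul] at this
    rw [← this]; linarith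
  obtain ⟨b, hb⟩ := (n_even a).1 h3
  refine ⟨b, by omega, ?_⟩
  have h4 : (m : K2) * b = o * T.om c f := by
    rw [hb] at h1; push_cast at h1
    apply mul_left_cancel₀ (two_ne_zero (α := K2)); linear_combination -h1
  have h5 : Cg ((m : K2) * b) b := by
    have := Cg.odd_mul (n := (m:ℤ)) (by exact_mod_cast hm) (n_int b); simpa using this
  have h6 : Cg ((m : K2) * p) p := by
    have := Cg.odd_mul (n := (m:ℤ)) (by exact_mod_cast hm) (n_int p); simpa using this
  have h7 : Cg ((o : K2) * T.om c f) (T.om c f) := by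
    have := Cg.odd_mul (n := (o:ℤ)) (by exact_mod_cast ho) hon; simpa using this
  rw [← h4] at h7
  exact Cg.int.1 ((h5.symm.trans h7).trans (hB.trans h6))

namespace Dt
variable {T : CT K2 G} {U V W : Fin T.N → Fin T.N → ℤ}

theorem chi0 {i0 : Fin T.N} (h0 : ∀ g, T.rho i0 g = 1) (h0n : T.n i0 = 1) (g : G) : T.chi i0 g = 1 := by
  rw [CT.chi, h0, Matrix.trace_one, Fintype.card_fin, h0n, Nat.cast_one]

variable {i0 : Fin T.N}


theorem U00 (D : Dt T m U V W) (h0 : ∀ g, T.rho i0 g = 1) (h0n : T.n i0 = 1) (P : Pk m x u O) : U i0 i0 = 3 := by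
  have := D.hU i0 i0
  simp only [CT.S, chi0 h0 h0n, mul_one, sum_const, nsmul_eq_mul, P.cE1] at this
  push_cast at this
  have h : (m : K2) * (U i0 i0 : K2) = m * ((3 : ℤ) : K2) := by rw [← this]; push_cast; ring
  exact_mod_cast mul_left_cancel₀ D.m0 h

theorem W00 (D : Dt T m U V W) (h0 : ∀ g, T.rho i0 g = 1) (h0n : T.n i0 = 1) (P : Pk m x u O) : W i0 i0 = 1 := by
  have := D.hW i0 i0
  simp only [CT.S, chi0 h0 h0n, mul_one, sum_const, nsmul_eq_mul, P.cE4] at this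
  push_cast at this
  have h : (2 * m : K2) * (W i0 i0 : K2) = 2 * m * ((1 : ℤ) : K2) := by rw [← this]; push_cast; ring
  exact_mod_cast mul_left_cancel₀ (mul_ne_zero two_ne_zero D.m0) h

theorem par (D : Dt T m U V W) (h0 : ∀ g, T.rho i0 g = 1) (h0n : T.n i0 = 1) (P : Pk m x u O) (j) : Even (U i0 j) ↔ Even (W i0 j) := by
  set f : G → K2 := fun g => T.chi i0 g * T.chi j g⁻¹ with hf
  have hR : IsRT K2 f := (T.isRT i0).mul_inv (T.isRT j)
  have hfn : ∀ g, ‖f g‖ ≤ 1 := fun g => n_integral (hR.integral g)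
  have hU : ∑ g ∈ E1 G, f g = m * U i0 j := D.hU i0 j
  have hW : ∑ g ∈ E4 G, f g = 2 * m * W i0 j := D.hW i0 j
  have hs := P.sumE4 f hR.conj
  rw [hW] at hs
  have hs' : (Nat.card O : K2) * W i0 j = ∑ o : O, f (u * o) := by
    apply mul_left_cancel₀ (mul_ne_zero two_ne_zero D.m0); linear_combination hs
  have hodd : Odd (Nat.card O) := by
    refine P.hm.of_dvd_nat ?_
    have hc : Nat.Coprime (Nat.card O) 8 := by
      by_contra h
      have h2 : 2 ∣ Nat.card O := by
        by_contra h2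
        apply h
        have : Nat.Coprime (Nat.card O) (2^3) := Nat.Coprime.pow_right 3 (Nat.coprime_two_right.2 (Nat.not_even_iff_odd.1 (fun he => h2 he.two_dvd)))
        exact this
      have : Fact (Nat.Prime 2) := ⟨Nat.prime_two⟩
      obtain ⟨g, hg⟩ := exists_prime_orderOf_dvd_card' 2 h2
      have := ((P.hO g).1 g.2).2
      rw [Subgroup.orderOf_coe, hg] at this
      exact absurd this (by decide)
    have : Nat.card O ∣ 8 * m := by rw [← P.card, ← Nat.card_eq_fintype_card]; exact Subgroup.card_subgroup_dvd_card O
    exact hc.dvd_of_dvd_mul_left this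
  have ha := pair_sum (E1 G) (fun g => x * g * x⁻¹) (by
    intro g hg
    refine ⟨(E1_conj g x).2 hg, ?_⟩
    have : x * x = 1 := by rw [← pow_two, P.hx2]
    have h' : x⁻¹ = x := inv_eq_of_mul_eq_one_left this
    simp only [h']
    calc x * (x * g * x) * x = (x * x) * g * (x * x) := by group
      _ = g := by rw [this]; group) f (fun g _ => hR.conj g x) (fun g _ => hfn g)
  set F := ({g ∈ E1 G | x * g * x⁻¹ = g} : Finset G) with hF
  have hux : u * x * u⁻¹ = x := by rw [← P.hu]; group
  have hb := pair_sum F (fun g => u * g * u⁻¹) (by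
    intro g hg
    simp only [hF, mem_filter] at hg
    constructor
    · simp only [hF, mem_filter]
      refine ⟨(E1_conj g u).2 hg.1, ?_⟩
      conv_rhs => rw [← hg.2]
      conv_lhs => rw [← hux]
      group
    · conv_rhs => rw [← hg.2]
      rw [← P.hu, pow_two, mul_inv_rev]; simp only [mul_assoc]) f (fun g _ => hR.conj g u) (fun g _ => hfn g)
  have hc : ∑ g ∈ F with u * g * u⁻¹ = g, f g = ∑ o : O, f o := by
    symm
    refine Finset.sum_bij (fun o _ => (o : G)) ?_ ?_ ?_ ?_
    · rintro ⟨o, ho⟩ _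
      have := (P.hO o).1 ho
      simp only [hF, mem_filter, E1, mem_univ, true_and]
      have h1 : u * o * u⁻¹ = o := by rw [this.1.eq]; group
      refine ⟨⟨this.2, ?_⟩, h1⟩
      have h2 : Commute x o := by rw [← P.hu]; exact this.1.pow_left 2
      rw [h2.eq]; group
    · rintro ⟨o, ho⟩ _ ⟨o', ho'⟩ _ h; simpa using h
    · intro z hz
      simp only [hF, mem_filter, E1, mem_univ, true_and] at hz
      refine ⟨⟨z, (P.hO z).2 ⟨?_, hz.1.1⟩⟩, mem_univ _, rfl⟩
      exact mul_inv_eq_iff_eq_mul.1 hz.2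
    · intros; rfl
  have hd : Cg (∑ o : O, f o) (∑ o : O, f (u * o)) := Cg.sum _ _ _ fun o _ =>
    rt_congr hR u o (by rw [← P.ou, pow_orderOf_eq_one]) ((P.hO o).1 o.2).1
  rw [hc] at hb
  have he := (ha.trans hb).trans hd
  rw [hU, ← hs'] at he
  have h5 : Cg ((m : K2) * U i0 j) (U i0 j) := by
    have := Cg.odd_mul (n := (m:ℤ)) (by exact_mod_cast D.hm) (n_int (U i0 j)); simpa using this
  have h6 : Cg ((Nat.card O : K2) * W i0 j) (W i0 j) := by
    have := Cg.odd_mul (n := (Nat.card O:ℤ)) (by exact_mod_cast hodd) (n_int (W i0 j)); simpa using this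
  exact Cg.int.1 ((h5.symm.trans he).trans h6)

theorem D3 (D : Dt T m U V W) (h0 : ∀ g, T.rho i0 g = 1) (h0n : T.n i0 = 1) (P : Pk m x u O) (j) : ∃ t : ℤ, (m : ℤ) * U i0 j = T.n j * t ∧ T.om j (fun g => if g ∈ E1 G then 1 else 0) = t := by
  have h1 : T.om j (fun g => if g ∈ E1 G then 1 else 0) = (∑ g ∈ E1 G, T.chi j g) / T.n j := by
    simp only [CT.om, ite_mul, one_mul, zero_mul]
    rw [← Finset.sum_filter, Finset.filter_mem_eq_inter, Finset.univ_inter]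
  have hi := T.om_integral j (E1 G) E1_conj
  have h2 : T.S (E1 G) j i0 = ∑ g ∈ E1 G, T.chi j g := by simp [CT.S, chi0 h0 h0n]
  rw [D.hU, D.Us] at h2
  have hq : IsQ ((∑ g ∈ E1 G, T.chi j g) / (T.n j : K2)) := by
    rw [← h2]
    exact div_mem (mul_mem (IsQ.nat m) (intCast_mem _ _)) (IsQ.nat _)
  obtain ⟨t, ht⟩ := hq.int hi
  refine ⟨t, ?_, by rw [h1, ht]⟩
  have := T.n_ne j
  rw [← h2] at ht
  field_simp at ht
  exact_mod_cast ht
end Dt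
end P9
end Sq

open Pointwise
set_option linter.unusedSectionVars false

namespace Sq
open Finset
open scoped Classical
noncomputable section P10
universe u
variable {G : Type u} [Group G] [Fintype G] {m : ℕ} {x u : G} {O : Subgroup G}

/-- vectors of central characters of integral central elements -/
def CT.IsL (T : CT K2 G) (l : Fin T.N → K2) : Prop :=
  ∃ a : G → K2, (∀ g t, a (t * g * t⁻¹) = a g) ∧ (∀ g, ‖a g‖ ≤ 1) ∧ ∀ i, l i = T.om i a

section
variable (T : CT K2 G)

theorem CT.IsL_one : T.IsL (fun _ => 1) := by
  refine ⟨fun g => if g = 1 then 1 else 0, ?_, ?_, ?_⟩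
  · intro g t
    have : t * g * t⁻¹ = 1 ↔ g = 1 := by rw [mul_inv_eq_one, mul_eq_left]
    simp only [this]
  · intro g; dsimp only; split_ifs <;> simp
  · intro i
    simp only [CT.om, ite_mul, one_mul, zero_mul, Finset.sum_ite_eq', mem_univ, if_true, T.chi_one]
    rw [div_self (T.n_ne i)]

theorem CT.IsL.mul {T : CT K2 G} {l l' : Fin T.N → K2} (h : T.IsL l) (h' : T.IsL l') : T.IsL (fun i => l i * l' i) := by
  obtain ⟨a, ha, han, hal⟩ := h
  obtain ⟨b, hb, hbn, hbl⟩ := h'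
  refine ⟨fun g => ∑ h, a h * b (h⁻¹ * g), ?_, ?_, ?_⟩
  · intro g t
    refine (Fintype.sum_equiv (MulAut.conj t).toEquiv _ _ fun h => ?_).symm
    change a h * b (h⁻¹ * g) = a (t * h * t⁻¹) * b ((t * h * t⁻¹)⁻¹ * (t * g * t⁻¹))
    rw [ha, ← hb (h⁻¹ * g) t]
    congr 2; group
  · intro g
    exact n_sum_le _ _ (by norm_num) fun h _ => n_mul_le (han _) (hbn _)
  · intro i; dsimp only; rw [T.om_conv i a b ha hb, hal, hbl]

theorem CT.IsL.pow {T : CT K2 G} {l : Fin T.N → K2} (h : T.IsL l) (n : ℕ) : T.IsL (fun i => l i ^ n) := by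
  induction n with
  | zero => simpa using T.IsL_one
  | succ n ih => simp only [pow_succ]; exact ih.mul h

theorem CT.IsL.lin {T : CT K2 G} {l l' : Fin T.N → K2} (h : T.IsL l) (h' : T.IsL l') (c c' : K2) (hc : ‖c‖ ≤ 1) (hc' : ‖c'‖ ≤ 1) :
    T.IsL (fun i => c * l i + c' * l' i) := by
  obtain ⟨a, ha, han, hal⟩ := h
  obtain ⟨b, hb, hbn, hbl⟩ := h'
  refine ⟨fun g => c * a g + c' * b g, ?_, ?_, ?_⟩
  · intro g t; simp only [ha, hb]
  · intro g; exact n_add_le (n_mul_le hc (han g)) (n_mul_le hc' (hbn g))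
  · intro i
    dsimp only
    rw [hal, hbl, CT.om, CT.om, CT.om]
    simp only [add_mul, Finset.sum_add_distrib, mul_assoc, ← Finset.mul_sum]
    ring

theorem CT.IsL_prod {T : CT K2 G} {ι : Type*} (s : Finset ι) (l : ι → Fin T.N → K2) (h : ∀ a ∈ s, T.IsL (l a)) :
    T.IsL (fun i => ∏ a ∈ s, l a i) := by
  induction s using Finset.induction_on with
  | empty => simpa using T.IsL_one
  | insert a s ha ih =>
    simp only [Finset.prod_insert ha]
    exact (h a (mem_insert_self a s)).mul (ih fun b hb => h b (mem_insert_of_mem hb))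

theorem CT.IsL_oc (c : ConjClasses G) : T.IsL (fun i => T.oc i c) := by
  refine ⟨fun g => if ConjClasses.mk g = c then 1 else 0, ?_, ?_, ?_⟩
  · intro g t
    have := class_conj c g t
    simp only [mem_filter, mem_univ, true_and] at this
    simp only [this]
  · intro g; dsimp only; split_ifs <;> simp
  · intro i
    simp only [CT.om, CT.oc, ite_mul, one_mul, zero_mul]
    rw [← Finset.sum_filter]

theorem CT.IsL.eight {T : CT K2 G} {l : Fin T.N → K2} (h : T.IsL l) (hc : Fintype.card G = 8 * m) :
    ‖∑ i, (T.n i : K2) ^ 2 * l i‖ ≤ 1 / 8 := by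
  obtain ⟨a, ha, han, hal⟩ := h
  simp only [hal, T.coeff_one, hc]
  push_cast
  rw [norm_mul, norm_mul, show (8 : K2) = 2 ^ 3 by norm_num, norm_pow, n_two]
  have h1 := han 1
  have h2 := n_int (m : ℤ)
  rw [Int.cast_natCast] at h2
  have h3 := norm_nonneg (a 1)
  have h4 := norm_nonneg (m : K2)
  nlinarith

/-- the projector to the block -/
theorem CT.proj (i0 : Fin T.N) : ∃ l : Fin T.N → K2, T.IsL l ∧ (∀ i ∉ T.B i0, l i = 0) ∧ ∀ i ∈ T.B i0, Cg (l i) 1 := by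
  have h1 : ∀ i, ∃ c, i ∉ T.B i0 → ¬ Cg (T.oc i c) (T.oc i0 c) := by
    intro i
    by_cases hi : i ∈ T.B i0
    · exact ⟨ConjClasses.mk 1, fun h => absurd hi h⟩
    · have := hi
      simp only [CT.B, mem_filter, mem_univ, true_and, not_forall] at this
      obtain ⟨c, hc⟩ := this
      exact ⟨c, fun _ => hc⟩
  choose c hc using h1
  have hne : ∀ i ∉ T.B i0, ‖T.oc i0 (c i) - T.oc i (c i)‖ = 1 := by
    intro i hi
    refine le_antisymm (n_sub_le (T.oc_n _ _) (T.oc_n _ _)) ?_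
    have := hc i hi
    rw [Cg, norm_sub_rev] at this
    exact not_lt.1 this
  refine ⟨fun j => ∏ i ∈ (T.B i0)ᶜ, ((T.oc i0 (c i) - T.oc i (c i))⁻¹ * T.oc j (c i) + (-(T.oc i0 (c i) - T.oc i (c i))⁻¹ * T.oc i (c i)) * 1), ?_, ?_, ?_⟩
  · refine CT.IsL_prod _ (fun i j => ((T.oc i0 (c i) - T.oc i (c i))⁻¹ * T.oc j (c i) + (-(T.oc i0 (c i) - T.oc i (c i))⁻¹ * T.oc i (c i)) * 1)) fun i hi => ?_
    have hi' : i ∉ T.B i0 := by simpa using hi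
    have hn : ‖(T.oc i0 (c i) - T.oc i (c i))⁻¹‖ ≤ 1 := by rw [norm_inv, hne i hi']; norm_num
    refine (T.IsL_oc (c i)).lin T.IsL_one _ _ hn (n_mul_le (by rwa [norm_neg]) (T.oc_n _ _))
  · intro i hi
    refine Finset.prod_eq_zero (i := i) (by simpa using hi) ?_
    ring
  · intro j hj
    have : ∀ s ⊆ (T.B i0)ᶜ, Cg (∏ i ∈ s, ((T.oc i0 (c i) - T.oc i (c i))⁻¹ * T.oc j (c i) + (-(T.oc i0 (c i) - T.oc i (c i))⁻¹ * T.oc i (c i)) * 1)) 1 := by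
      intro s
      induction s using Finset.induction_on with
      | empty => intro _; simp [Cg]
      | insert i s hi ih =>
        intro hs
        have hi' : i ∉ T.B i0 := by simpa using hs (mem_insert_self i s)
        rw [Finset.prod_insert hi, ← one_mul (1 : K2)]
        have hn := hne i hi'
        have h0 : T.oc i0 (c i) - T.oc i (c i) ≠ 0 := by rw [← norm_pos_iff, hn]; norm_num
        have ih' := ih ((Finset.subset_insert i s).trans hs)
        simp only [one_mul]
        rw [← one_mul (1 : K2)]
        refine Cg.mul ?_ ?_ (by simp) ?_
        · rw [Cg]
          rw [show ((T.oc i0 (c i) - T.oc i (c i))⁻¹ * T.oc j (c i) + (-(T.oc i0 (c i) - T.oc i (c i))⁻¹ * T.oc i (c i)) * (1 * 1)) - 1 = (T.oc i0 (c i) - T.oc i (c i))⁻¹ * (T.oc j (c i) - T.oc i0 (c i)) by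
            field_simp; ring]
          rw [norm_mul, norm_inv, hn, inv_one, one_mul]
          simp only [CT.B, mem_filter, mem_univ, true_and] at hj
          exact hj (c i)
        · simpa using ih'
        · simp only [one_mul]
          have := n_add_le ih'.le (by simp : ‖(1 : K2)‖ ≤ 1)
          rw [sub_add_cancel] at this
          exact this
    exact this _ subset_rfl
end

theorem pow_close (a : K2) (ha : Cg a 1) : ∀ᶠ M : ℕ in Filter.atTop, ‖a ^ 2 ^ M - 1‖ ≤ 1 / 8 := by
  rw [Cg] at ha
  set q := max ‖a - 1‖ (1/2) with hq
  have hq1 : q < 1 := max_lt ha (by norm_num)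
  have hq0 : 0 ≤ q := le_trans (by norm_num) (le_max_right _ _)
  have h : ∀ M : ℕ, ‖a ^ 2 ^ M - 1‖ ≤ q ^ (M + 1) := by
    intro M
    induction M with
    | zero => rw [pow_zero, pow_one, zero_add, pow_one]; exact le_max_left _ _
    | succ M ih =>
      set b := a ^ 2 ^ M with hb
      have h1 : a ^ 2 ^ (M + 1) - 1 = (b - 1) * ((b - 1) + 2) := by rw [pow_succ, pow_mul, ← hb]; ring
      have h2 : ‖(b - 1) + 2‖ ≤ q := by
        refine n_add_le (ih.trans ?_) (by rw [n_two]; exact le_max_right _ _)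
        exact pow_le_of_le_one hq0 hq1.le (by omega)
      rw [h1, norm_mul, pow_succ q (M + 1)]
      exact mul_le_mul ih h2 (norm_nonneg _) (pow_nonneg hq0 _)
  have h2 := (tendsto_pow_atTop_nhds_zero_of_lt_one hq0 hq1)
  have h3 := (h2.comp (Filter.tendsto_add_atTop_nat 1)).eventually_le_const (show (0:ℝ) < 1/8 by norm_num)
  filter_upwards [h3] with M hM
  exact (h M).trans hM

namespace Dt
variable {T : CT K2 G} {U V W : Fin T.N → Fin T.N → ℤ}
variable {i0 : Fin T.N}


theorem D4a (D : Dt T m U V W) (h0 : ∀ g, T.rho i0 g = 1) (h0n : T.n i0 = 1) (P : Pk m x u O) (t : Fin T.N → ℤ) (ht : ∀ j, T.om j (fun g => if g ∈ E1 G then 1 else 0) = t j) :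
    (8 : ℤ) ∣ ∑ i ∈ T.B i0, (T.n i : ℤ) ^ 2 * t i ^ 4 := by
  obtain ⟨l, hl, hl0, hl1⟩ := T.proj i0
  have hL1 : T.IsL (fun i => (t i : K2)) := by
    refine ⟨fun g => if g ∈ E1 G then 1 else 0, ?_, ?_, fun i => (ht i).symm⟩
    · intro g s; simp only [E1_conj]
    · intro g; dsimp only; split_ifs <;> simp
  have hM : ∀ᶠ M : ℕ in Filter.atTop, ∀ i ∈ T.B i0, ‖l i ^ 2 ^ M - 1‖ ≤ 1 / 8 := by
    rw [Filter.eventually_all_finset]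
    exact fun i hi => pow_close _ (hl1 i hi)
  obtain ⟨M, hM⟩ := hM.exists
  have h8 := ((hl.pow (2 ^ M)).mul (hL1.pow 4)).eight D.card
  have h9 : ‖∑ i ∈ T.B i0, (T.n i : K2) ^ 2 * (t i : K2) ^ 4‖ ≤ 1 / 8 := by
    have e : ∑ i ∈ T.B i0, (T.n i : K2) ^ 2 * (t i : K2) ^ 4 = ∑ i, (T.n i : K2) ^ 2 * (l i ^ 2 ^ M * (t i : K2) ^ 4)
       - ∑ i ∈ T.B i0, (T.n i : K2) ^ 2 * ((l i ^ 2 ^ M - 1) * (t i : K2) ^ 4) := by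
      rw [← Finset.sum_subset (Finset.subset_univ (T.B i0)), ← Finset.sum_sub_distrib]
      · exact Finset.sum_congr rfl fun i _ => by ring
      · intro i _ hi; rw [hl0 i hi, zero_pow (by positivity)]; ring
    rw [e]
    refine n_sub_le h8 (n_sum_le _ _ (by norm_num) fun i hi => ?_)
    rw [norm_mul, norm_mul, norm_pow, norm_pow]
    have h1 := hM i hi
    have h2 : ‖(T.n i : K2)‖ ≤ 1 := by simpa using n_int (T.n i : ℤ)
    have h3 := n_int (t i)
    have h4 : ‖(T.n i : K2)‖ ^ 2 ≤ 1 := pow_le_one₀ (norm_nonneg _) h2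
    have h5 : ‖(t i : K2)‖ ^ 4 ≤ 1 := pow_le_one₀ (norm_nonneg _) h3
    have h6 : ‖l i ^ 2 ^ M - 1‖ * ‖(t i : K2)‖ ^ 4 ≤ 1 / 8 := by
      calc _ ≤ (1/8 : ℝ) * 1 := mul_le_mul h1 h5 (by positivity) (by norm_num)
        _ = _ := by norm_num
    calc _ ≤ (1 : ℝ) * (1/8) := mul_le_mul h4 h6 (by positivity) (by norm_num)
      _ = _ := by norm_num
  have := (n_pow8 (∑ i ∈ T.B i0, (T.n i : ℤ) ^ 2 * t i ^ 4) 3).1 (by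
    push_cast
    refine h9.trans (by norm_num))
  simpa using this

theorem sumw (D : Dt T m U V W) (h0 : ∀ g, T.rho i0 g = 1) (h0n : T.n i0 = 1) (P : Pk m x u O) : ∑ j, W i0 j ^ 2 = 4 := by
  have := D.WW i0 i0
  rw [D.W00 h0 h0n P] at this
  rw [← mul_one (4:ℤ), ← this]
  exact Finset.sum_congr rfl fun j _ => by rw [D.Ws j i0, pow_two]

theorem sump (D : Dt T m U V W) (h0 : ∀ g, T.rho i0 g = 1) (h0n : T.n i0 = 1) (P : Pk m x u O) : ∑ j, U i0 j ^ 2 = 24 := by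
  have := D.UU i0 i0
  rw [D.U00 h0 h0n P] at this
  rw [show (24:ℤ) = 8 * 3 by norm_num, ← this]
  exact Finset.sum_congr rfl fun j _ => by rw [D.Us j i0, pow_two]

theorem w01 (D : Dt T m U V W) (h0 : ∀ g, T.rho i0 g = 1) (h0n : T.n i0 = 1) (P : Pk m x u O) (j) : W i0 j = 0 ∨ W i0 j = 1 ∨ W i0 j = -1 := by
  by_cases hj : j = i0
  · rw [hj]; exact Or.inr (Or.inl (D.W00 h0 h0n P))
  · have h := D.sumw h0 h0n P
    have h2 : W i0 j ^ 2 + W i0 i0 ^ 2 ≤ ∑ j, W i0 j ^ 2 := by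
      rw [← Finset.sum_pair hj (f := fun j => W i0 j ^ 2)]
      exact Finset.sum_le_sum_of_subset_of_nonneg (subset_univ _) fun _ _ _ => sq_nonneg _
    rw [h, D.W00 h0 h0n P] at h2
    have h3 : -2 < W i0 j := by nlinarith
    have h4 : W i0 j < 2 := by nlinarith
    omega

theorem wle (D : Dt T m U V W) (h0 : ∀ g, T.rho i0 g = 1) (h0n : T.n i0 = 1) (P : Pk m x u O) (j) : W i0 j ^ 2 ≤ U i0 j ^ 2 := by
  rcases D.w01 h0 h0n P j with h | h | h
  · rw [h]; positivity
  all_goals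
    have h2 := D.par h0 h0n P j
    rw [h] at h2
    have h3 : ¬ Even (U i0 j) := by rw [h2]; decide
    have h4 : U i0 j ≠ 0 := by intro h; rw [h] at h3; exact h3 (by decide)
    rw [h]
    have := Int.one_le_abs h4
    rw [← sq_abs (U i0 j)]
    nlinarith

theorem p02 (D : Dt T m U V W) (h0 : ∀ g, T.rho i0 g = 1) (h0n : T.n i0 = 1) (P : Pk m x u O) (j) (hw : W i0 j = 0) : U i0 j = 0 ∨ U i0 j = 2 ∨ U i0 j = -2 := by
  have hj : j ≠ i0 := by rintro rfl; rw [D.W00 h0 h0n P] at hw; norm_num at hw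
  have hp : Even (U i0 j) := by rw [D.par h0 h0n P j, hw]; decide
  have h1 := D.sump h0 h0n P
  have h2 := D.sumw h0 h0n P
  have h3 : (U i0 j ^ 2 - W i0 j ^ 2) + (U i0 i0 ^ 2 - W i0 i0 ^ 2) ≤ ∑ j, (U i0 j ^ 2 - W i0 j ^ 2) := by
    rw [← Finset.sum_pair hj (f := fun j => U i0 j ^ 2 - W i0 j ^ 2)]
    exact Finset.sum_le_sum_of_subset_of_nonneg (subset_univ _) fun i _ _ => sub_nonneg.2 (D.wle h0 h0n P i)
  rw [Finset.sum_sub_distrib, h1, h2, hw, D.U00 h0 h0n P, D.W00 h0 h0n P] at h3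
  obtain ⟨r, hr⟩ := hp
  rw [hr] at h3 ⊢
  have h4 : -2 < r := by nlinarith
  have h5 : r < 2 := by nlinarith
  omega

theorem D4 (D : Dt T m U V W) (h0 : ∀ g, T.rho i0 g = 1) (h0n : T.n i0 = 1) (P : Pk m x u O) : ∃ c ∈ T.B i0, W i0 c = 0 ∧ (U i0 c = 2 ∨ U i0 c = -2) ∧ ∃ o, Odd o ∧ T.n c = 2 * o := by
  by_contra hcon
  push Not at hcon
  choose t ht ht' using D.D3 h0 h0n P
  have h8 := D.D4a h0 h0n P t ht'
  have hmod : ∀ i ∈ T.B i0, (8 : ℤ) ∣ (T.n i : ℤ) ^ 2 * t i ^ 4 - W i0 i ^ 2 := by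
    intro i hi
    by_cases hw : W i0 i = 0
    · rw [hw]
      have hmn := ht i
      have : Even (t i) := by
        by_contra hne
        rw [Int.not_even_iff_odd] at hne
        have hU := D.p02 h0 h0n P i hw
        have hc := hcon i hi hw
        rcases hU with h | h
        · rw [h, mul_zero] at hmn
          rcases mul_eq_zero.1 hmn.symm with h' | h'
          · exact T.hn i (by exact_mod_cast h')
          · rw [h'] at hne; exact absurd hne (by decide)
        · have hc' := hc h
          -- n t = ± 2 m with t odd
          have hm := D.hm
          have hev : Even ((T.n i : ℤ) * t i) := by
            rw [← hmn]; rcases h with h | h <;> rw [h] <;> exact Even.mul_left (by decide) _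
          rw [Int.even_mul] at hev
          have hne' : ¬ Even (t i) := Int.not_even_iff_odd.2 hne
          have hnev : Even (T.n i) := by
            rcases hev with h | h
            · exact_mod_cast h
            · exact absurd h hne'
          obtain ⟨o, ho⟩ := hnev
          refine hc' o ?_ (by omega)
          by_contra hoe
          rw [Nat.not_odd_iff_even] at hoe
          obtain ⟨q, hq⟩ := hoe
          have hm' : Odd (m : ℤ) := by exact_mod_cast hm
          obtain ⟨r, hr⟩ := hm'
          have e1 : (T.n i : ℤ) * t i = 4 * (q * t i) := by rw [ho, hq]; push_cast; ring
          rw [e1] at hmn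
          rcases h with h | h <;> rw [h, hr] at hmn <;> omega
      obtain ⟨r, hr⟩ := this
      rw [hr]
      exact ⟨2 * (T.n i : ℤ) ^ 2 * r ^ 4, by ring⟩
    · have hw2 : W i0 i ^ 2 = 1 := by
        rcases D.w01 h0 h0n P i with h | h | h
        · exact absurd h hw
        all_goals rw [h]; norm_num
      have hWo : ¬ Even (W i0 i) := by
        rcases D.w01 h0 h0n P i with h | h | h
        · exact absurd h hw
        all_goals rw [h]; decide
      rw [← D.par h0 h0n P, Int.not_even_iff_odd] at hWo
      have hm' : Odd (m : ℤ) := by exact_mod_cast D.hm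
      have := hm'.mul hWo
      rw [ht i, Int.odd_mul] at this
      obtain ⟨h1, h2⟩ := this
      rw [hw2]
      have h3 : (8 : ℤ) ∣ (T.n i : ℤ) ^ 2 - 1 := Int.eight_dvd_sq_sub_one_of_odd h1
      have h4 : (8 : ℤ) ∣ (t i : ℤ) ^ 2 - 1 := Int.eight_dvd_sq_sub_one_of_odd h2
      have : (T.n i : ℤ) ^ 2 * t i ^ 4 - 1 = ((T.n i : ℤ) ^ 2 - 1) * t i ^ 4 + (t i ^ 2 - 1) * (t i ^ 2 + 1) := by ring
      rw [this]
      exact dvd_add (h3.mul_right _) (h4.mul_right _)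
  have h9 := Finset.dvd_sum hmod
  rw [Finset.sum_sub_distrib] at h9
  have h10 : (8 : ℤ) ∣ ∑ i ∈ T.B i0, W i0 i ^ 2 := by
    have := dvd_sub h8 h9
    rwa [sub_sub_cancel] at this
  have h11 : ∑ i ∈ T.B i0, W i0 i ^ 2 ≤ 4 := by
    rw [← D.sumw h0 h0n P]
    exact Finset.sum_le_sum_of_subset_of_nonneg (subset_univ _) fun _ _ _ => sq_nonneg _
  have h12 : 1 ≤ ∑ i ∈ T.B i0, W i0 i ^ 2 := by
    have : W i0 i0 ^ 2 ≤ ∑ i ∈ T.B i0, W i0 i ^ 2 :=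
      Finset.single_le_sum (f := fun i => W i0 i ^ 2) (fun _ _ => sq_nonneg _) (by
        simp only [CT.B, mem_filter, mem_univ, true_and]; exact fun c => Cg.refl _)
    rwa [D.W00 h0 h0n P, one_pow] at this
  omega
end Dt
end P10
end Sq

open Pointwise
set_option linter.unusedSectionVars false

namespace Sq
open Finset
open scoped Classical
noncomputable section P11
universe u
variable {G : Type u} [Group G] [Fintype G] {m : ℕ} {x u : G} {O : Subgroup G}

theorem D5b {N : ℕ} (p w a : Fin N → ℤ) (c : Fin N) (ha : ∑ i, a i ^ 2 = 8 * a c)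
    (hb : ∀ i, ∃ b, a i = 2 * b ∧ (Even b ↔ Even (p i))) (hw : ∑ i, w i ^ 2 = 4)
    (hw1 : ∀ i, w i = 0 ∨ w i = 1 ∨ w i = -1) (hp : ∀ i, Even (p i) ↔ Even (w i)) (hc : w c = 0) :
    a c = 4 ∧ ∀ i, i ≠ c → a i ^ 2 = 4 * w i ^ 2 := by
  choose b hb1 hb2 using hb
  have hle : ∀ i, w i ^ 2 ≤ b i ^ 2 := by
    intro i
    rcases hw1 i with h | h | h
    · rw [h]; positivity
    all_goals
      have h3 : ¬ Even (b i) := by rw [hb2, hp, h]; decide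
      have h4 : b i ≠ 0 := by intro h; rw [h] at h3; exact h3 (by decide)
      rw [h]
      have := Int.one_le_abs h4
      rw [← sq_abs (b i)]
      nlinarith
  have hs : ∑ i, b i ^ 2 = 4 * b c := by
    simp only [hb1, mul_pow] at ha
    rw [← Finset.mul_sum] at ha
    omega
  have h1 : ∑ i ∈ univ.erase c, (b i ^ 2 - w i ^ 2) = 4 * b c - b c ^ 2 - 4 := by
    have e1 := Finset.add_sum_erase univ (fun i => b i ^ 2 - w i ^ 2) (mem_univ c)
    have e2 : ∑ i, (b i ^ 2 - w i ^ 2) = 4 * b c - 4 := by rw [Finset.sum_sub_distrib, hs, hw]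
    rw [e2] at e1
    simp only [hc] at e1
    linarith
  have h2 : 0 ≤ ∑ i ∈ univ.erase c, (b i ^ 2 - w i ^ 2) := Finset.sum_nonneg fun i _ => sub_nonneg.2 (hle i)
  have h3 : b c = 2 := by
    have : (b c - 2) ^ 2 ≤ 0 := by nlinarith
    have := pow_eq_zero_iff (two_ne_zero) |>.1 (le_antisymm this (sq_nonneg _))
    omega
  refine ⟨by rw [hb1, h3]; norm_num, ?_⟩
  intro i hi
  rw [h3] at h1
  rw [show (4 * 2 - 2 ^ 2 - 4 : ℤ) = 0 by norm_num] at h1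
  rw [Finset.sum_eq_zero_iff_of_nonneg (fun i _ => sub_nonneg.2 (hle i))] at h1
  have := h1 i (by simp [hi])
  rw [hb1]; linarith

theorem quad {N : ℕ} (M : Fin N → Fin N → ℤ) (κ : ℤ) (hs : ∀ i j, M i j = M j i) (hM : ∀ i l, ∑ j, M i j * M j l = κ * M i l)
    (i j c : Fin N) (α β : ℤ) :
    ∑ l, (M i l + α * M j l + β * M c l) ^ 2 = κ * (M i i + α ^ 2 * M j j + β ^ 2 * M c c + 2 * α * M i j + 2 * β * M i c + 2 * α * β * M j c) := by
  have h : ∀ a b, ∑ l, M a l * M b l = κ * M a b := by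
    intro a b; rw [← hM]; exact Finset.sum_congr rfl fun l _ => by rw [hs b l]
  have e : ∀ l, (M i l + α * M j l + β * M c l) ^ 2 = M i l * M i l + α ^ 2 * (M j l * M j l) + β ^ 2 * (M c l * M c l)
     + 2 * α * (M i l * M j l) + 2 * β * (M i l * M c l) + 2 * α * β * (M j l * M c l) := fun l => by ring
  simp only [e, Finset.sum_add_distrib, ← Finset.mul_sum, h]
  ring

theorem pick {ι : Type*} (J : Finset ι) (hJ : #J = 3) (y π : ι → ℤ) (hy : ∀ i ∈ J, y i = 1 ∨ y i = -1)
    (h1 : ∑ i ∈ J, y i = -1) (h2 : ∑ i ∈ J, π i = -3) (h3 : ∑ i ∈ J, y i * π i = 1) :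
    ∃ j ∈ J, y j = 1 ∧ π j = -1 := by
  obtain ⟨a, b, c, hab, hac, hbc, rfl⟩ := Finset.card_eq_three.1 hJ
  have e : ∀ f : ι → ℤ, ∑ i ∈ {a, b, c}, f i = f a + (f b + f c) := by
    intro f
    rw [Finset.sum_insert (by simp [hab, hac]), Finset.sum_pair hbc]
  rw [e] at h1 h2 h3
  have ha := hy a (by simp)
  have hb := hy b (by simp)
  have hc := hy c (by simp)
  rcases ha with ha | ha <;> rcases hb with hb | hb <;> rcases hc with hc | hc <;> rw [ha, hb, hc] at h1 h3 <;>
    first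
    | (exfalso; omega)
    | exact ⟨a, by simp, ha, by omega⟩
    | exact ⟨b, by simp, hb, by omega⟩
    | exact ⟨c, by simp, hc, by omega⟩

theorem Dt.comb {T : CT K2 G} {U V W : Fin T.N → Fin T.N → ℤ} (D : Dt T m U V W) {i0 : Fin T.N}
    (h0 : ∀ g, T.rho i0 g = 1) (h0n : T.n i0 = 1) (P : Pk m x u O) :
    ∃ j c : Fin T.N, ∃ ε σ : ℤ, j ≠ i0 ∧ (ε = 1 ∨ ε = -1) ∧ (σ = 1 ∨ σ = -1) ∧ (∃ o, T.n c = 2 * o) ∧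
      (∀ l, U i0 l + ε * U j l + (-σ) * U c l = 0) ∧ (∀ l, V i0 l + ε * V j l + σ * V c l = 0) := by
  obtain ⟨c, hcB, hwc, hpc, o, ho, hno⟩ := D.D4 h0 h0n P
  obtain ⟨σ, hσ, hpσ⟩ : ∃ σ : ℤ, (σ = 1 ∨ σ = -1) ∧ U i0 c = 2 * σ := by
    rcases hpc with h | h
    · exact ⟨1, Or.inl rfl, by rw [h]; norm_num⟩
    · exact ⟨-1, Or.inr rfl, by rw [h]; norm_num⟩
  have hσ2 : σ * σ = 1 := by rcases hσ with h | h <;> rw [h] <;> norm_num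
  have hw := D.sumw h0 h0n P
  have hU00 := D.U00 h0 h0n P
  have hW00 := D.W00 h0 h0n P
  have hci : c ≠ i0 := by rintro rfl; rw [hW00] at hwc; norm_num at hwc
  have hsum := D.sum
  have hV00 : V i0 i0 = 3 := by have := hsum i0 i0; rw [if_pos rfl] at this; omega
  have hV0 : ∀ i, i ≠ i0 → V i0 i = - U i0 i - 2 * W i0 i := by
    intro i hi; have := hsum i0 i; rw [if_neg hi.symm] at this; omega
  have hUc := D5b (fun i => U i0 i) (fun i => W i0 i) (fun i => U c i) c (by
      rw [← D.UU]; exact Finset.sum_congr rfl fun i _ => by rw [D.Us i c, pow_two])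
    (fun i => T.D5a i0 c hcB h0n D.hm (E1 G) E1_conj i _ _ (D.hU c i) (D.hU i0 i) o ho hno) hw (D.w01 h0 h0n P) (D.par h0 h0n P) hwc
  have hVc := D5b (fun i => V i0 i) (fun i => W i0 i) (fun i => V c i) c (by
      rw [← D.VV]; exact Finset.sum_congr rfl fun i _ => by rw [D.Vs i c, pow_two])
    (fun i => T.D5a i0 c hcB h0n D.hm (E2 G) E2_conj i _ _ (D.hV c i) (D.hV i0 i) o ho hno) hw (D.w01 h0 h0n P) (by
      intro i
      rw [← D.par h0 h0n P]
      have h8 := hsum i0 i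
      have h9 : ∃ r, V i0 i = U i0 i + 2 * r := by
        split_ifs at h8
        · exact ⟨4 - U i0 i - W i0 i, by omega⟩
        · exact ⟨- U i0 i - W i0 i, by omega⟩
      obtain ⟨r, hr⟩ := h9
      simp only [hr, Int.even_iff]
      omega) hwc
  obtain ⟨hUcc, hUci⟩ := hUc
  obtain ⟨hVcc, hVci⟩ := hVc
  have hWcc : W c c = 0 := by have := hsum c c; rw [if_pos rfl] at this; omega
  have hWc : ∀ i, W c i = 0 := by
    have h1 := D.WW c c
    rw [hWcc, mul_zero] at h1
    have h2 : ∑ i, W c i ^ 2 = 0 := by rw [← h1]; exact Finset.sum_congr rfl fun i _ => by rw [D.Ws i c, pow_two]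
    rw [Finset.sum_eq_zero_iff_of_nonneg (fun i _ => sq_nonneg _)] at h2
    intro i
    have := h2 i (mem_univ i)
    exact pow_eq_zero_iff two_ne_zero |>.1 this
  have hVcU : ∀ i, i ≠ c → V c i = - U c i := by
    intro i hi; have := hsum c i; rw [if_neg hi.symm, hWc] at this; omega
  -- the set J
  set J : Finset (Fin T.N) := {i | i ≠ i0 ∧ W i0 i ≠ 0} with hJ
  have hJm : ∀ i, i ∈ J ↔ i ≠ i0 ∧ W i0 i ≠ 0 := by intro i; simp [hJ]
  have hsplit : ∀ f : Fin T.N → ℤ, (∀ i, W i0 i = 0 → f i = 0) → ∑ i, f i = f i0 + ∑ i ∈ J, f i := by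
    intro f hf
    rw [← Finset.add_sum_erase univ f (mem_univ i0)]
    congr 1
    symm
    refine Finset.sum_subset ?_ ?_
    · intro i hi; rw [hJm] at hi; simp [hi.1]
    · intro i hi hi'
      simp only [mem_erase, mem_univ, and_true] at hi
      rw [hJm, not_and_not_right] at hi'
      exact hf i (hi' hi)
  have hwJ : ∀ i ∈ J, W i0 i = 1 ∨ W i0 i = -1 := by
    intro i hi
    rcases D.w01 h0 h0n P i with h | h
    · exact absurd h ((hJm i).1 hi).2
    · exact h
  have hww : ∀ i ∈ J, W i0 i * W i0 i = 1 := by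
    intro i hi; rcases hwJ i hi with h | h <;> rw [h] <;> norm_num
  have hJ3 : #J = 3 := by
    have h1 := hsplit (fun i => W i0 i ^ 2) (by intro i h; rw [h]; norm_num)
    rw [hw, Finset.sum_congr rfl (fun i hi => by rw [pow_two, hww i hi] : ∀ i ∈ J, W i0 i ^ 2 = 1)] at h1
    simp only [hW00, sum_const, nsmul_eq_mul, mul_one] at h1
    have : (#J : ℤ) = 3 := by omega
    exact_mod_cast this
  have hcJ : c ∉ J := by rw [hJm]; exact fun h => h.2 hwc
  have hJc : ∀ i ∈ J, i ≠ c := by rintro i hi rfl; exact hcJ hi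
  -- b i = U c i / 2
  have hb : ∀ i ∈ J, ∃ y : ℤ, (y = 1 ∨ y = -1) ∧ U c i = 2 * σ * y * W i0 i := by
    intro i hi
    have h1 := hUci i (hJc i hi)
    have h2 : (σ * W i0 i) * (σ * W i0 i) = 1 := by
      calc _ = (σ * σ) * (W i0 i * W i0 i) := by ring
        _ = 1 := by rw [hσ2, hww i hi]; norm_num
    have h3 : (U c i - 2 * (σ * W i0 i)) * (U c i + 2 * (σ * W i0 i)) = 0 := by
      calc _ = U c i ^ 2 - 4 * ((σ * W i0 i) * (σ * W i0 i)) := by ring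
        _ = 0 := by rw [h2, h1, pow_two, hww i hi]; norm_num
    rcases mul_eq_zero.1 h3 with h | h
    · exact ⟨1, Or.inl rfl, by linarith⟩
    · exact ⟨-1, Or.inr rfl, by linarith⟩
  choose! y hy1 hy2 using hb
  have hUc0 : U c i0 = 2 * σ := by rw [D.Us, hpσ]
  have s1 : ∑ i ∈ J, y i = -1 := by
    have h1 := D.UW c i0
    rw [hsplit _ (by intro i h; rw [D.Ws i i0, h, mul_zero])] at h1
    rw [hUc0, hW00, Finset.sum_congr rfl (fun i hi => by
      rw [hy2 i hi, D.Ws i i0]; linear_combination (2 * σ * y i) * hww i hi : ∀ i ∈ J, U c i * W i i0 = 2 * σ * y i), ← Finset.mul_sum] at h1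
    have : σ * (∑ i ∈ J, y i + 1) = 0 := by linarith
    have := congrArg (σ * ·) this
    simp only [← mul_assoc, hσ2] at this
    linarith
  have s2 : ∑ i ∈ J, U i0 i * W i0 i = -3 := by
    have h1 := D.UW i0 i0
    rw [hsplit _ (by intro i h; rw [D.Ws i i0, h, mul_zero]), hU00, hW00] at h1
    rw [Finset.sum_congr rfl (fun i _ => by rw [D.Ws i i0] : ∀ i ∈ J, U i0 i * W i0 i = U i0 i * W i i0)]
    linarith
  have s3 : ∑ i ∈ J, y i * (U i0 i * W i0 i) = 1 := by
    have h1 := D.UU c i0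
    rw [← Finset.add_sum_erase univ _ (mem_univ c)] at h1
    rw [← Finset.add_sum_erase (univ.erase c) _ (show i0 ∈ univ.erase c by simp [hci.symm])] at h1
    have h2 : ∑ i ∈ (univ.erase c).erase i0, U c i * U i i0 = ∑ i ∈ J, U c i * U i i0 := by
      symm
      refine Finset.sum_subset ?_ ?_
      · intro i hi; simp [hJc i hi, ((hJm i).1 hi).1]
      · intro i hi hi'
        simp only [mem_erase, mem_univ, and_true] at hi
        rw [hJm, not_and_not_right] at hi'
        have h4 := hUci i hi.2
        rw [hi' hi.1] at h4
        have h5 : U c i = 0 := pow_eq_zero_iff two_ne_zero |>.1 (by rw [h4]; norm_num)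
        rw [h5, zero_mul]
    rw [h2, hUcc, D.Us c i0, hpσ, hU00, Finset.sum_congr rfl (fun i hi => by
      rw [hy2 i hi, D.Us i i0]; ring : ∀ i ∈ J, U c i * U i i0 = 2 * σ * (y i * (U i0 i * W i0 i))), ← Finset.mul_sum] at h1
    have : σ * (∑ i ∈ J, y i * (U i0 i * W i0 i) - 1) = 0 := by linarith
    have := congrArg (σ * ·) this
    simp only [← mul_assoc, hσ2] at this
    simp only [mul_assoc] at this
    linarith
  obtain ⟨j, hjJ, hyj, hpj⟩ := pick J hJ3 y (fun i => U i0 i * W i0 i) hy1 s1 s2 s3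
  have hj0 : j ≠ i0 := ((hJm j).1 hjJ).1
  have hjc := hJc j hjJ
  have hε := hwJ j hjJ
  have hε2 := hww j hjJ
  set ε := W i0 j with hεd
  have hp : U i0 j = -ε := by
    have : U i0 j * ε * ε = -1 * ε := by rw [hpj]
    rw [mul_assoc, hε2] at this; linarith
  have hUcj : U c j = 2 * σ * ε := by rw [hy2 j hjJ, hyj]; ring
  have hUjc : U j c = 2 * σ * ε := by rw [D.Us, hUcj]
  have hVjc : V j c = -(2 * σ * ε) := by rw [D.Vs, hVcU j hjc, hUcj]
  have hV0j : V i0 j = -ε := by rw [hV0 j hj0, hp]; ring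
  have hV0c : V i0 c = -(2 * σ) := by rw [hV0 c hci, hpσ, hwc]; ring
  have qU := quad U 8 D.Us D.UU i0 j c ε (-σ)
  have qV := quad V 8 D.Vs D.VV i0 j c ε σ
  have qW := quad W 4 D.Ws D.WW i0 j c (-ε) 0
  have eU : U i0 i0 + ε ^ 2 * U j j + (-σ) ^ 2 * U c c + 2 * ε * U i0 j + 2 * (-σ) * U i0 c + 2 * ε * (-σ) * U j c = U j j - 3 := by
    rw [hU00, hUcc, hp, hpσ, hUjc]
    linear_combination (U j j - 2) * hε2 + (4 - 4 - 4 * ε * ε) * hσ2 - 4 * hε2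
  have eV : V i0 i0 + ε ^ 2 * V j j + σ ^ 2 * V c c + 2 * ε * V i0 j + 2 * σ * V i0 c + 2 * ε * σ * V j c = V j j - 3 := by
    rw [hV00, hVcc, hV0j, hV0c, hVjc]
    linear_combination (V j j - 2) * hε2 + (4 - 4 - 4 * ε * ε) * hσ2 - 4 * hε2
  have eW : W i0 i0 + (-ε) ^ 2 * W j j + 0 ^ 2 * W c c + 2 * (-ε) * W i0 j + 2 * 0 * W i0 c + 2 * (-ε) * 0 * W j c = W j j - 1 := by
    rw [hW00, ← hεd]
    linear_combination (W j j - 2) * hε2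
  rw [eU] at qU
  rw [eV] at qV
  rw [eW] at qW
  have nU : 0 ≤ ∑ l, (U i0 l + ε * U j l + (-σ) * U c l) ^ 2 := Finset.sum_nonneg fun _ _ => sq_nonneg _
  have nV : 0 ≤ ∑ l, (V i0 l + ε * V j l + σ * V c l) ^ 2 := Finset.sum_nonneg fun _ _ => sq_nonneg _
  have nW : 0 ≤ ∑ l, (W i0 l + (-ε) * W j l + 0 * W c l) ^ 2 := Finset.sum_nonneg fun _ _ => sq_nonneg _
  have hsj := hsum j j
  rw [if_pos rfl] at hsj
  have zU : ∑ l, (U i0 l + ε * U j l + (-σ) * U c l) ^ 2 = 0 := by omega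
  have zV : ∑ l, (V i0 l + ε * V j l + σ * V c l) ^ 2 = 0 := by omega
  rw [Finset.sum_eq_zero_iff_of_nonneg (fun i _ => sq_nonneg _)] at zU zV
  refine ⟨j, c, ε, σ, hj0, hε, hσ, ⟨o, hno⟩, fun l => ?_, fun l => ?_⟩
  · exact pow_eq_zero_iff two_ne_zero |>.1 (zU l (mem_univ l))
  · exact pow_eq_zero_iff two_ne_zero |>.1 (zV l (mem_univ l))

theorem Pk.false (P : Pk m x u O) : False := by
  obtain ⟨T⟩ := CT.exists K2 G
  obtain ⟨i0, h0, h0n, huniq⟩ := T.exists_triv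
  obtain ⟨U, V, W, D⟩ := P.dt T
  obtain ⟨j, c, ε, σ, hj0, hε, hσ, ⟨o, hno⟩, hU, hV⟩ := D.comb h0 h0n P
  have c0 := Dt.chi0 h0 h0n
  have rU : ∀ z ∈ E1 G, 1 + ε * T.chi j z - σ * T.chi c z = 0 := by
    intro z hz
    have e : ∑ l, ((U i0 l + ε * U j l + (-σ) * U c l : ℤ) : K2) * T.chi l z = 0 :=
      Finset.sum_eq_zero fun l _ => by rw [hU l, Int.cast_zero, zero_mul]
    push_cast at e
    simp only [add_mul, Finset.sum_add_distrib, mul_assoc, ← Finset.mul_sum, D.Uv _ z hz, c0] at e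
    apply mul_left_cancel₀ (show (8 : K2) ≠ 0 by norm_num)
    linear_combination e
  have hx2 : x ∈ E2 G := by
    simp only [E2, mem_filter, mem_univ, true_and, P.ox]; decide
  have rV : 1 + ε * T.chi j x + σ * T.chi c x = 0 := by
    have e : ∑ l, ((V i0 l + ε * V j l + σ * V c l : ℤ) : K2) * T.chi l x = 0 :=
      Finset.sum_eq_zero fun l _ => by rw [hV l, Int.cast_zero, zero_mul]
    push_cast at e
    simp only [add_mul, Finset.sum_add_distrib, mul_assoc, ← Finset.mul_sum, D.Vv _ x hx2, c0] at e
    apply mul_left_cancel₀ (show (8 : K2) ≠ 0 by norm_num)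
    linear_combination e
  have r1 := rU 1 (by simp [E1])
  rw [T.chi_one, T.chi_one] at r1
  set K : Finset G := {y | IsConj x y} with hK
  have hKc : ∀ g t, t * g * t⁻¹ ∈ K ↔ g ∈ K := by
    intro g t
    simp only [hK, mem_filter, mem_univ, true_and, P.isConj_iff2, orderOf_cj]
  have hKx : ∀ y ∈ K, IsConj x y := by intro y hy; simpa [hK] using hy
  have rQ : 1 + ε * (T.chi j x ^ 2 / T.n j) - σ * (T.chi c x ^ 2 / T.n c) = 0 := by
    have h1 := T.Q_id j x K hKc hKx
    have h2 := T.Q_id c x K hKc hKx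
    have h3 : ∑ y ∈ K, (1 + ε * T.chi j (x * y) - σ * T.chi c (x * y)) = 0 :=
      Finset.sum_eq_zero fun y hy => rU _ (by
        simp only [E1, mem_filter, mem_univ, true_and]; exact P.odd y (hKx y hy))
    rw [Finset.sum_sub_distrib, Finset.sum_add_distrib, ← Finset.mul_sum, ← Finset.mul_sum, h1, h2] at h3
    simp only [sum_const, nsmul_eq_mul, mul_one] at h3
    have hKn : (#K : K2) ≠ 0 := by
      have : K.Nonempty := ⟨x, by simp only [hK, mem_filter, mem_univ, true_and]; exact IsConj.refl x⟩
      exact_mod_cast this.card_pos.ne'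
    apply mul_left_cancel₀ hKn
    linear_combination h3
  obtain ⟨s, hs, hs1, -⟩ := T.s_int j x P.hx2
  obtain ⟨s', hs', -, hs2⟩ := T.s_int c x P.hx2
  rw [hs, hs'] at rV rQ
  have nj := T.n_ne j
  have nc := T.n_ne c
  have pj : 0 < T.n j := Nat.pos_of_ne_zero (T.hn j)
  have pc : 0 < T.n c := Nat.pos_of_ne_zero (T.hn c)
  have iV : 1 + ε * s + σ * s' = 0 := by exact_mod_cast rV
  have i1 : 1 + ε * T.n j - σ * T.n c = 0 := by exact_mod_cast r1
  have iQ : (T.n j : ℤ) * T.n c + ε * s ^ 2 * T.n c - σ * s' ^ 2 * T.n j = 0 := by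
    have : (T.n j : K2) * T.n c + ε * s ^ 2 * T.n c - σ * s' ^ 2 * T.n j = 0 := by
      field_simp at rQ
      linear_combination rQ
    exact_mod_cast this
  generalize hnj : (T.n j : ℤ) = n at *
  generalize hnc : (T.n c : ℤ) = n' at *
  have pn : 0 < n := by rw [← hnj]; exact_mod_cast pj
  have pn' : 0 < n' := by rw [← hnc]; exact_mod_cast pc
  rcases hε with rfl | rfl <;> rcases hσ with rfl | rfl
  · have e1 : n' = 1 + n := by linarith
    have e2 : s' = -(1 + s) := by linarith
    rw [e1, e2] at iQ
    have : (s - n) ^ 2 = 0 := by linear_combination iQ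
    have := pow_eq_zero_iff two_ne_zero |>.1 this
    exact hj0 (huniq j (T.triv_of_gen x P.gen j (hs1 (by omega))))
  · omega
  · omega
  · have e1 : n = 1 + n' := by linarith
    have e2 : s = 1 - s' := by linarith
    rw [e1, e2] at iQ
    have : (s' + n') ^ 2 = 0 := by linear_combination iQ
    have := pow_eq_zero_iff two_ne_zero |>.1 this
    have h1 := T.n_one_of_neg x P.gen c (hs2 (by omega))
    omega
end P11
end Sq

open Pointwise
set_option linter.unusedSectionVars false
namespace Sq
open Finset
open scoped Classical
noncomputable section P12
universe u

variable {k : Type*} [Field k] [CharZero k] [IsAlgClosed k] {G : Type u} [Group G] [Fintype G] (T : CT k G)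

/-- multiplicity of an irreducible character in the induced virtual character -/
def ee (C : Subgroup G) (μ : C →* k) (i : Fin T.N) : k :=
  (Fintype.card C : k)⁻¹ * ∑ c : C, (1 - μ c) * T.chi i (c : G)⁻¹

theorem ee_int (C : Subgroup G) (μ : C →* k) (i) : ∃ r : ℤ, ee T C μ i = r := by
  have h3 : (Fintype.card C : k) ≠ 0 := by simp
  have key : ∀ ν : C →* k, ∃ r : ℕ, ∑ c : C, ν c * T.chi i (c : G)⁻¹ = Fintype.card C * r := by
    intro ν
    have h1 : IsRT k (fun c : C => ν c) := by
      refine ⟨Unit, inferInstance, inferInstance, (Matrix.scalar Unit : k →+* _).toMonoidHom.comp ν, fun g => ?_⟩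
      simp [Matrix.trace]
    have h2 := (T.isRT i).comp C.subtype
    exact (h1.mul_inv h2).avg
  obtain ⟨r1, hr1⟩ := key 1
  obtain ⟨r2, hr2⟩ := key μ
  refine ⟨(r1 : ℤ) - r2, ?_⟩
  rw [ee]
  simp only [sub_mul, Finset.sum_sub_distrib]
  rw [hr2]
  simp only [MonoidHom.one_apply] at hr1
  rw [hr1]
  field_simp
  push_cast
  ring

theorem ee_van (C : Subgroup G) (μ : C →* k) (z : G) (hz : ∀ (c : C) (g : G), g * c * g⁻¹ = z → μ c = 1) :
    ∑ i, ee T C μ i * T.chi i z = 0 := by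
  simp only [ee, mul_assoc, Finset.sum_mul, ← Finset.mul_sum]
  rw [Finset.sum_comm]
  simp only [← Finset.mul_sum, T.F3]
  rw [Finset.sum_eq_zero, mul_zero]
  intro c _
  by_cases h : μ c = 1
  · rw [h]; simp
  · rw [Finset.sum_eq_zero, mul_zero]
    intro g _
    rw [if_neg]
    intro h'
    apply h
    apply hz c g
    have := congrArg (·⁻¹) h'
    simpa [mul_assoc] using this

theorem ee_sq (C : Subgroup G) (μ : C →* k) (t : G) (htC : t ∉ C)
    (ht : ∀ c : C, ∃ c' : C, (c' : G) = t⁻¹ * c * t ∧ μ c' = μ c⁻¹)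
    (hti : ∀ (c c' : C) (g : G), (c : G) = g * c' * g⁻¹ → μ c ≠ 1 → μ c' ≠ 1 → g ∈ C ∨ t⁻¹ * g ∈ C)
    (hμ : μ ^ 2 ≠ 1) :
    ∑ i, ee T C μ i ^ 2 = 3 := by
  have h3 : (Fintype.card C : k) ≠ 0 := by simp
  have inv1 : ∀ c : C, μ c * μ c⁻¹ = 1 := fun c => by rw [← map_mul]; simp
  have hcj : ∀ c s : C, μ (s⁻¹ * c * s) = μ c := by
    intro c s; rw [map_mul, map_mul, mul_right_comm, mul_comm (μ s⁻¹), inv1, one_mul]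
  have key : ∀ c : C, (1 - μ c) * ∑ i, ee T C μ i * T.chi i (c : G)⁻¹ = (1 - μ c) * ((1 - μ c⁻¹) + (1 - μ c)) := by
    intro c
    by_cases hc : μ c = 1
    · rw [hc]; simp
    congr 1
    have hc' : μ c⁻¹ ≠ 1 := by
      intro h; have := inv1 c; rw [h, mul_one] at this; exact hc this
    simp only [ee, mul_assoc, Finset.sum_mul, ← Finset.mul_sum]
    rw [Finset.sum_comm]
    simp only [← Finset.mul_sum, T.F3]
    simp only [Finset.mul_sum]
    rw [Finset.sum_comm]
    have e : ∀ g : G, ∑ d : C, (Fintype.card C : k)⁻¹ * ((1 - μ d) * if g * (d : G)⁻¹ * g⁻¹ = ((c : G)⁻¹)⁻¹ then 1 else 0) =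
        (Fintype.card C : k)⁻¹ * ((if g ∈ C then (1 - μ c⁻¹) else 0) + if t⁻¹ * g ∈ C then (1 - μ c) else 0) := by
      intro g
      have hd0 : ∀ d d' : C, (d' : G) = g⁻¹ * (c : G)⁻¹ * g → ((g * (d : G)⁻¹ * g⁻¹ = ((c : G)⁻¹)⁻¹) ↔ d = d') := by
        intro d d' hd'
        rw [Subtype.ext_iff, hd', inv_inv]
        constructor
        · intro h; rw [← h]; group
        · intro h; rw [h]; group
      have one : ∀ d' : C, (d' : G) = g⁻¹ * (c : G)⁻¹ * g → ∑ d : C, (Fintype.card C : k)⁻¹ * ((1 - μ d) * if g * (d : G)⁻¹ * g⁻¹ = ((c : G)⁻¹)⁻¹ then 1 else 0) = (Fintype.card C : k)⁻¹ * (1 - μ d') := by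
        intro d' hd'
        simp only [hd0 _ d' hd', mul_ite, mul_one, mul_zero]
        simp
      by_cases h1 : g ∈ C
      · have h2 : t⁻¹ * g ∉ C := by
          intro h
          apply htC
          have := C.mul_mem h1 (C.inv_mem h)
          simpa using this
        rw [if_pos h1, if_neg h2, add_zero, one (⟨g, h1⟩⁻¹ * c⁻¹ * ⟨g, h1⟩) (by simp), hcj]
      · rw [if_neg h1, zero_add]
        split_ifs with h2
        · obtain ⟨c', hc1, hc2⟩ := ht c⁻¹
          rw [one (⟨t⁻¹ * g, h2⟩⁻¹ * c' * ⟨t⁻¹ * g, h2⟩) (by simp [hc1, mul_assoc]), hcj, hc2, inv_inv]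
        · rw [mul_zero]
          refine Finset.sum_eq_zero fun d _ => ?_
          split_ifs with h4
          · by_cases hd : μ d⁻¹ = 1
            · have := inv1 d; rw [hd, mul_one] at this; rw [this]; simp
            · have := hti c d⁻¹ g (by rw [inv_inv] at h4; simp [← h4]) hc hd
              tauto
          · simp
    simp only [e]
    rw [← Finset.mul_sum, Finset.sum_add_distrib, ← Finset.sum_filter, ← Finset.sum_filter, sum_const, sum_const]
    have c1 : #{g : G | g ∈ C} = Fintype.card C := by
      rw [Fintype.card_subtype]
    have c2 : #{g : G | t⁻¹ * g ∈ C} = Fintype.card C := by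
      rw [← c1]
      refine Finset.card_bij' (fun g _ => t⁻¹ * g) (fun g _ => t * g) ?_ ?_ ?_ ?_ <;> simp
    rw [c1, c2]
    simp only [nsmul_eq_mul]
    field_simp
  have s1 : ∑ i, ee T C μ i ^ 2 = (Fintype.card C : k)⁻¹ * ∑ c : C, (1 - μ c) * ∑ i, ee T C μ i * T.chi i (c : G)⁻¹ := by
    simp only [Finset.mul_sum]
    rw [Finset.sum_comm]
    refine Finset.sum_congr rfl fun i _ => ?_
    have : ∀ c : C, (Fintype.card C : k)⁻¹ * ((1 - μ c) * (ee T C μ i * T.chi i (c : G)⁻¹)) =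
        ee T C μ i * ((Fintype.card C : k)⁻¹ * ((1 - μ c) * T.chi i (c : G)⁻¹)) := fun c => by ring
    simp only [this]
    rw [← Finset.mul_sum, ← Finset.mul_sum, pow_two]
    rfl
  rw [s1]
  simp only [key]
  have e2 : ∀ c : C, (1 - μ c) * ((1 - μ c⁻¹) + (1 - μ c)) = 3 - 3 * μ c - μ c⁻¹ + (μ ^ 2) c := by
    intro c
    rw [MonoidHom.pow_apply]
    linear_combination inv1 c
  simp only [e2, Finset.sum_sub_distrib, Finset.sum_add_distrib, ← Finset.mul_sum]
  have hμ1 : μ ≠ 1 := by rintro rfl; exact hμ (one_pow 2)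
  have z1 := sum_hom_units_eq_zero μ hμ1
  have z2 := sum_hom_units_eq_zero (μ ^ 2) hμ
  have z3 : ∑ c : C, μ c⁻¹ = 0 := by
    rw [← z1]; exact Fintype.sum_equiv (Equiv.inv C) _ _ (fun c => rfl)
  rw [z1, z2, z3]
  simp only [sum_const, card_univ, nsmul_eq_mul]
  field_simp
  ring

theorem part3 (k : Type*) [Field k] [CharZero k] [IsAlgClosed k] (C : Subgroup G) (μ : C →* k) (t x : G) (hx2 : x ^ 2 = 1) (htC : t ∉ C)
    (ht : ∀ c : C, ∃ c' : C, (c' : G) = t⁻¹ * c * t ∧ μ c' = μ c⁻¹)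
    (hti : ∀ (c c' : C) (g : G), (c : G) = g * c' * g⁻¹ → μ c ≠ 1 → μ c' ≠ 1 → g ∈ C ∨ t⁻¹ * g ∈ C)
    (hμ : μ ^ 2 ≠ 1) (hodd : ∀ c : C, Odd (orderOf c) → μ c = 1) (hxc : ∀ c : C, IsConj x c → μ c = 1)
    (gen : Subgroup.closure {y | IsConj x y} = ⊤) (odd : ∀ y, IsConj x y → Odd (orderOf (x * y))) : False := by
  obtain ⟨T⟩ := CT.exists k G
  obtain ⟨i0, h0, h0n, huniq⟩ := T.exists_triv
  have c0 : ∀ g, T.chi i0 g = 1 := by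
    intro g; rw [CT.chi, h0 g, Matrix.trace_one]; simp [h0n]
  have h3 : (Fintype.card C : k) ≠ 0 := by simp
  choose e he using ee_int T C μ
  have hμ1 : μ ≠ 1 := by rintro rfl; exact hμ (one_pow 2)
  have e0 : e i0 = 1 := by
    have := he i0
    rw [ee] at this
    simp only [c0, mul_one, Finset.sum_sub_distrib, sum_hom_units_eq_zero μ hμ1, sum_const, card_univ, nsmul_eq_mul, sub_zero] at this
    rw [inv_mul_cancel₀ h3] at this
    exact_mod_cast this.symm
  have sq : ∑ i, e i ^ 2 = 3 := by
    have := ee_sq T C μ t htC ht hti hμ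
    simp only [he] at this
    exact_mod_cast this
  have sq' : ∑ i ∈ univ.erase i0, e i ^ 2 = 2 := by
    have := Finset.add_sum_erase univ (fun i => e i ^ 2) (mem_univ i0)
    simp only [e0] at this
    linarith
  have vO : ∀ z : G, Odd (orderOf z) → ∑ i, (e i : k) * T.chi i z = 0 := by
    intro z hz
    have := ee_van T C μ z (by
      rintro c g rfl
      rw [orderOf_cj] at hz
      exact hodd c (by rwa [Subgroup.orderOf_coe] at hz))
    simpa only [he] using this
  have vx : ∑ i, (e i : k) * T.chi i x = 0 := by
    have := ee_van T C μ x (by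
      rintro c g hg
      exact hxc c (by rw [← hg]; exact (isConj_iff.2 ⟨g, rfl⟩ : IsConj (c : G) _).symm))
    simpa only [he] using this
  -- the two remaining constituents
  obtain ⟨j, c, hj0, hc0, hjc, hej, hec, hz⟩ : ∃ j c, j ≠ i0 ∧ c ≠ i0 ∧ j ≠ c ∧ (e j = 1 ∨ e j = -1) ∧
      (e c = 1 ∨ e c = -1) ∧ ∀ l, l ≠ i0 → l ≠ j → l ≠ c → e l = 0 := by
    have cl : ∀ a : ℤ, a ^ 2 ≤ 2 → a = 0 ∨ a = 1 ∨ a = -1 := by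
      intro a ha
      have : a < 2 := by nlinarith
      have : -2 < a := by nlinarith
      omega
    have le : ∀ i ∈ univ.erase i0, e i ^ 2 ≤ 2 := by
      intro i hi
      rw [← sq']
      exact Finset.single_le_sum (f := fun i => e i ^ 2) (fun i _ => sq_nonneg _) hi
    have : ∃ j ∈ univ.erase i0, e j ≠ 0 := by
      by_contra! h
      rw [Finset.sum_eq_zero (fun i hi => by rw [h i hi]; norm_num)] at sq'
      norm_num at sq'
    obtain ⟨j, hj, hej⟩ := this
    have hej' : e j = 1 ∨ e j = -1 := (cl _ (le j hj)).resolve_left hej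
    have sj : e j ^ 2 = 1 := by rcases hej' with h | h <;> rw [h] <;> norm_num
    have sq2 : ∑ i ∈ (univ.erase i0).erase j, e i ^ 2 = 1 := by
      have := Finset.add_sum_erase (univ.erase i0) (fun i => e i ^ 2) hj
      simp only [sj] at this
      linarith
    have : ∃ c ∈ (univ.erase i0).erase j, e c ≠ 0 := by
      by_contra! h
      rw [Finset.sum_eq_zero (fun i hi => by rw [h i hi]; norm_num)] at sq2
      norm_num at sq2
    obtain ⟨c, hc, hec⟩ := this
    have hec' : e c = 1 ∨ e c = -1 := (cl _ (le c (mem_of_mem_erase hc))).resolve_left hec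
    have sc : e c ^ 2 = 1 := by rcases hec' with h | h <;> rw [h] <;> norm_num
    have sq3 : ∑ i ∈ ((univ.erase i0).erase j).erase c, e i ^ 2 = 0 := by
      have := Finset.add_sum_erase ((univ.erase i0).erase j) (fun i => e i ^ 2) hc
      simp only [sc] at this
      linarith
    rw [Finset.sum_eq_zero_iff_of_nonneg (fun i _ => sq_nonneg _)] at sq3
    refine ⟨j, c, ne_of_mem_erase hj, ne_of_mem_erase (mem_of_mem_erase hc), (ne_of_mem_erase hc).symm, hej', hec', ?_⟩
    intro l h1 h2 h3
    exact pow_eq_zero_iff two_ne_zero |>.1 (sq3 l (by simp [h1, h2, h3]))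
  have red : ∀ f : Fin T.N → k, ∑ i, (e i : k) * f i = f i0 + e j * f j + e c * f c := by
    intro f
    rw [← Finset.add_sum_erase univ _ (mem_univ i0), ← Finset.add_sum_erase (univ.erase i0) _ (show j ∈ _ by simp [hj0]),
      ← Finset.add_sum_erase ((univ.erase i0).erase j) _ (show c ∈ _ by simp [hc0, hjc.symm])]
    rw [Finset.sum_eq_zero]
    · rw [e0]; push_cast; ring
    · intro l hl
      simp only [mem_erase, mem_univ, and_true] at hl
      rw [hz l hl.2.2 hl.2.1 hl.1]; simp
  simp only [red, c0] at vO vx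
  have r1 := vO 1 (by simp)
  rw [T.chi_one, T.chi_one] at r1
  set K : Finset G := {y | IsConj x y} with hK
  have hKc : ∀ g t, t * g * t⁻¹ ∈ K ↔ g ∈ K := by
    intro g t
    have : IsConj g (t * g * t⁻¹) := isConj_iff.2 ⟨t, rfl⟩
    simp only [hK, mem_filter, mem_univ, true_and]
    exact ⟨fun h => h.trans this.symm, fun h => h.trans this⟩
  have hKx : ∀ y ∈ K, IsConj x y := by intro y hy; simpa [hK] using hy
  have rQ : 1 + e j * (T.chi j x ^ 2 / T.n j) + e c * (T.chi c x ^ 2 / T.n c) = 0 := by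
    have h1 := T.Q_id j x K hKc hKx
    have h2 := T.Q_id c x K hKc hKx
    have h3 : ∑ y ∈ K, (1 + e j * T.chi j (x * y) + e c * T.chi c (x * y)) = 0 :=
      Finset.sum_eq_zero fun y hy => vO _ (odd y (hKx y hy))
    rw [Finset.sum_add_distrib, Finset.sum_add_distrib, ← Finset.mul_sum, ← Finset.mul_sum, h1, h2] at h3
    simp only [sum_const, nsmul_eq_mul, mul_one] at h3
    have hKn : (#K : k) ≠ 0 := by
      have : K.Nonempty := ⟨x, by simp only [hK, mem_filter, mem_univ, true_and]; exact IsConj.refl x⟩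
      exact_mod_cast this.card_pos.ne'
    apply mul_left_cancel₀ hKn
    linear_combination h3
  obtain ⟨s, hs, hs1, -⟩ := T.s_int j x hx2
  obtain ⟨s', hs', hs1', -⟩ := T.s_int c x hx2
  rw [hs, hs'] at vx rQ
  have nj := T.n_ne j
  have nc := T.n_ne c
  have pj : 0 < T.n j := Nat.pos_of_ne_zero (T.hn j)
  have pc : 0 < T.n c := Nat.pos_of_ne_zero (T.hn c)
  have iV : 1 + e j * s + e c * s' = 0 := by exact_mod_cast vx
  have i1 : 1 + e j * T.n j + e c * T.n c = 0 := by exact_mod_cast r1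
  have iQ : (T.n j : ℤ) * T.n c + e j * s ^ 2 * T.n c + e c * s' ^ 2 * T.n j = 0 := by
    have : (T.n j : k) * T.n c + e j * s ^ 2 * T.n c + e c * s' ^ 2 * T.n j = 0 := by
      field_simp at rQ
      linear_combination rQ
    exact_mod_cast this
  have nontriv_j : s ≠ T.n j := fun h => hj0 (huniq j (T.triv_of_gen x gen j (hs1 h)))
  have nontriv_c : s' ≠ T.n c := fun h => hc0 (huniq c (T.triv_of_gen x gen c (hs1' h)))
  have pn : (0 : ℤ) < T.n j := by exact_mod_cast pj
  have pn' : (0 : ℤ) < T.n c := by exact_mod_cast pc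
  generalize (T.n j : ℤ) = n at *
  generalize (T.n c : ℤ) = n' at *
  rcases hej with h | h <;> rcases hec with h' | h' <;> rw [h, h'] at i1 iV iQ
  · linarith
  · have e1 : n' = 1 + n := by linarith
    have e2 : s' = 1 + s := by linarith
    rw [e1, e2] at iQ
    have : (s - n) ^ 2 = 0 := by linear_combination iQ
    have := pow_eq_zero_iff two_ne_zero |>.1 this
    exact nontriv_j (by omega)
  · have e1 : n = 1 + n' := by linarith
    have e2 : s = 1 + s' := by linarith
    rw [e1, e2] at iQ
    have : (s' - n') ^ 2 = 0 := by linear_combination iQ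
    have := pow_eq_zero_iff two_ne_zero |>.1 this
    exact nontriv_c (by omega)
  · linarith
end P12
end Sq

open Pointwise
set_option linter.unusedSectionVars false
namespace Sq
open Finset
open scoped Classical
noncomputable section P13
universe u

variable {G : Type u} [Group G] {p : ℕ} {x : G}

/-- the hypothesis on an involution (or identity) `x` -/
structure Hy (p : ℕ) (x : G) : Prop where
  x2 : x * x = 1
  pp : ∀ y, IsConj x y → (x * y) ^ p = 1

theorem cj_iff {a b : G} : IsConj a b ↔ ∃ c, c * a * c⁻¹ = b := isConj_iff

theorem cj (a c : G) : IsConj a (c * a * c⁻¹) := isConj_iff.2 ⟨c, rfl⟩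

theorem cj' {a b : G} (h : IsConj a b) (c : G) : IsConj a (c * b * c⁻¹) := h.trans (cj b c)

theorem Hy.sq (H : Hy p x) {y : G} (hy : IsConj x y) : y * y = 1 := by
  obtain ⟨c, rfl⟩ := isConj_iff.1 hy
  have := H.x2
  calc c * x * c⁻¹ * (c * x * c⁻¹) = c * (x * x) * c⁻¹ := by group
    _ = 1 := by rw [this]; group

theorem Hy.inv (H : Hy p x) {y : G} (hy : IsConj x y) : y⁻¹ = y :=
  inv_eq_of_mul_eq_one_left (H.sq hy)

theorem Hy.mp (H : Hy p x) {y z : G} (hy : IsConj x y) (hz : IsConj x z) : (y * z) ^ p = 1 := by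
  obtain ⟨c, rfl⟩ := isConj_iff.1 hy
  have h := H.pp (c⁻¹ * z * c) (by simpa using cj' hz c⁻¹)
  have : c * x * c⁻¹ * z = c * (x * (c⁻¹ * z * c)) * c⁻¹ := by group
  rw [this, conj_pow, h]; group

theorem Hy.of (H : Hy p x) {y : G} (hy : IsConj x y) : Hy p y :=
  ⟨H.sq hy, fun _ hz => H.mp hy (hy.trans hz)⟩

/-- inversion of powers -/
theorem inv_conj_pow {y z : G} (hy : y * y = 1) (hz : z * z = 1) (n : ℕ) :
    y * (y * z) ^ n * y = ((y * z) ^ n)⁻¹ := by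
  have hy' : y⁻¹ = y := inv_eq_of_mul_eq_one_left hy
  have hz' : z⁻¹ = z := inv_eq_of_mul_eq_one_left hz
  have : y * (y * z) * y⁻¹ = (y * z)⁻¹ := by rw [mul_inv_rev, hy', hz', ← mul_assoc, hy, one_mul]
  have h2 := conj_pow (i := n) (a := y) (b := y * z)
  rw [this, inv_pow] at h2
  rw [h2, hy']

/-- explicit midpoint -/
theorem mid_aux {y z : G} (hy : y * y = 1) (hz : z * z = 1) (n : ℕ) (h : (y * z) ^ (2 * n + 1) = 1) :
    (y * z) ^ n * y * ((y * z) ^ n)⁻¹ = z := by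
  have h1 := inv_conj_pow hy hz n
  rw [← h1]
  have : (y * z) ^ n * y * (y * (y * z) ^ n * y) = (y * z) ^ n * (y * y) * (y * z) ^ n * y := by group
  rw [this, hy, mul_one, ← pow_add, ← two_mul]
  have h3 : (y * z) ^ (2 * n) = (y * z)⁻¹ := by
    rw [pow_succ] at h; exact eq_inv_of_mul_eq_one_left h
  have hy' : y⁻¹ = y := inv_eq_of_mul_eq_one_left hy
  have hz' : z⁻¹ = z := inv_eq_of_mul_eq_one_left hz
  rw [h3, mul_inv_rev, hy', hz', mul_assoc, hy, mul_one]

theorem Hy.odd (hp : Odd p) (H : Hy p x) {y z : G} (hy : IsConj x y) (hz : IsConj x z) : Odd (orderOf (y * z)) :=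
  hp.of_dvd_nat (orderOf_dvd_of_pow_eq_one (H.mp hy hz))

/-- conjugation inside a subgroup containing the product -/
theorem Hy.conj_in (hp : Odd p) (H : Hy p x) {y z : G} (hy : IsConj x y) (hz : IsConj x z) :
    ∃ n : ℕ, (y * z) ^ n * y * ((y * z) ^ n)⁻¹ = z := by
  obtain ⟨n, hn⟩ := hp
  exact ⟨n, mid_aux (H.sq hy) (H.sq hz) n (by rw [← hn]; exact H.mp hy hz)⟩

theorem Hy.mid (hp : Odd p) (H : Hy p x) {y z : G} (hy : IsConj x y) (hz : IsConj x z) :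
    ∃ m, IsConj x m ∧ m * y * m = z := by
  obtain ⟨n, hn⟩ := Hy.conj_in hp H hy hz
  have h1 := inv_conj_pow (H.sq hy) (H.sq hz) n
  refine ⟨(y * z) ^ n * y, ?_, ?_⟩
  · -- it is conjugate to y by a square root of (yz)^n
    obtain ⟨q, hq⟩ := hp
    have hw : ((y * z) ^ n) ^ (2 * q + 1) = 1 := by
      rw [← pow_mul, mul_comm, pow_mul, ← hq, H.mp hy hz, one_pow]
    set w := (y * z) ^ n with hw0
    have hyw : y * w * y = w⁻¹ := h1
    have hyy := H.sq hy
    have e : w ^ (q + 1) * y * (w ^ (q + 1))⁻¹ = w * y := by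
      have h2 := inv_conj_pow (H.sq hy) (H.sq hz) (n * (q + 1))
      rw [pow_mul, ← hw0] at h2
      rw [← h2]
      have : w ^ (q + 1) * y * (y * w ^ (q + 1) * y) = w ^ (q + 1) * (y * y) * w ^ (q + 1) * y := by group
      rw [this, hyy, mul_one, ← pow_add]
      rw [show q + 1 + (q + 1) = (2 * q + 1) + 1 by ring, pow_succ, hw, one_mul]
    rw [← e]; exact cj' hy _
  · generalize (y * z) ^ n = w at hn h1
    rw [← h1] at hn
    rw [← hn]; simp only [mul_assoc]

theorem Hy.uniq (hp : Odd p) (H : Hy p x) {y m m' : G} (hy : IsConj x y) (hm : IsConj x m) (hm' : IsConj x m')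
    (h : m * y * m = m' * y * m') : m = m' := by
  have hyy := H.sq hy
  have hmm := H.sq hm
  have hmm' := H.sq hm'
  set d := m' * m with hd
  have hdy : d * y * d⁻¹ = y := by
    rw [hd, mul_inv_rev, H.inv hm, H.inv hm']
    calc m' * m * y * (m * m') = m' * (m * y * m) * m' := by group
      _ = (m' * m') * y * (m' * m') := by rw [h]; group
      _ = y := by rw [hmm']; group
  have hc : Commute d y := by rw [commute_iff_eq]; exact mul_inv_eq_iff_eq_mul.1 hdy
  have hmd : m * d * m⁻¹ = d⁻¹ := by
    rw [hd, mul_inv_rev, H.inv hm, H.inv hm', mul_assoc, mul_assoc, hmm, mul_one]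
  have hwd : (y * m) * d * (y * m)⁻¹ = d⁻¹ := by
    have : (y * m) * d * (y * m)⁻¹ = y * (m * d * m⁻¹) * y⁻¹ := by group
    rw [this, hmd, hc.symm.inv_right.eq]; group
  have hwd2 : Commute ((y * m) ^ 2) d := by
    rw [commute_iff_eq, ← mul_inv_eq_iff_eq_mul]
    have : (y * m) ^ 2 * d * ((y * m) ^ 2)⁻¹ = (y * m) * ((y * m) * d * (y * m)⁻¹) * (y * m)⁻¹ := by
      simp only [pow_two, mul_inv_rev, mul_assoc]
    rw [this, hwd]
    have := congrArg (·⁻¹) hwd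
    simpa [mul_assoc] using this
  obtain ⟨q, hq⟩ := id hp
  have hpw := H.mp hy hm
  have hw1 : y * m = ((y * m) ^ 2) ^ (q + 1) := by
    rw [← pow_mul, show 2 * (q + 1) = p + 1 by omega, pow_succ, hpw, one_mul]
  have hwc : Commute (y * m) d := by rw [hw1]; exact hwd2.pow_left _
  have hdd : d = d⁻¹ := by
    rw [← hwd, hwc.eq]; group
  have hd2 : d ^ 2 = 1 := by rw [pow_two]; nth_rewrite 2 [hdd]; simp
  have hdp : d ^ p = 1 := H.mp hm' hm
  have hd1 : d = 1 := by
    rw [hq, pow_succ, pow_mul, hd2, one_pow, one_mul] at hdp; exact hdp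
  have : m' = m⁻¹ := eq_inv_of_mul_eq_one_left hd1
  rw [this, H.inv hm]

/-- a conjugate commuting with `y` is equal to `y` -/
theorem Hy.comm (hp : Odd p) (H : Hy p x) {y z : G} (hy : IsConj x y) (hz : IsConj x z) (h : Commute y z) : z = y := by
  refine Hy.uniq hp H hy hz hy ?_
  rw [← h.eq, mul_assoc, H.sq hz, H.sq hy, one_mul, mul_one]

theorem Hy.map {L : Type*} [Group L] (H : Hy p x) (f : G →* L) (hf : Function.Surjective f) : Hy p (f x) := by
  refine ⟨by rw [← map_mul, H.x2, map_one], fun y hy => ?_⟩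
  obtain ⟨c, rfl⟩ := isConj_iff.1 hy
  obtain ⟨c, rfl⟩ := hf c
  rw [← map_inv, ← map_mul, ← map_mul, ← map_mul, ← map_pow, H.pp _ (cj x c), map_one]

theorem Hy.sub (H : Hy p x) (M : Subgroup G) (hx : x ∈ M) : Hy p (⟨x, hx⟩ : M) := by
  refine ⟨Subtype.ext H.x2, fun y hy => ?_⟩
  apply Subtype.ext
  have : IsConj x (y : G) := M.subtype.map_isConj hy
  simpa using H.pp _ this

/-- the conclusion -/
def Gd (p : ℕ) (x : G) : Prop :=
  ∃ N : Subgroup G, N.Normal ∧ IsPGroup p N ∧ ∀ y, IsConj x y → x * y ∈ N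

/-- intersection of the Sylow subgroups -/
def Op (p : ℕ) (G : Type*) [Group G] : Subgroup G := ⨅ P : Sylow p G, (P : Subgroup G)

theorem Op_p : IsPGroup p (Op p G) := by
  obtain ⟨P⟩ : Nonempty (Sylow p G) := inferInstance
  exact P.2.to_le (iInf_le _ P)

theorem mem_Op {g : G} : g ∈ Op p G ↔ ∀ P : Sylow p G, g ∈ P := by
  rw [Op, Subgroup.mem_iInf]; rfl

instance Op_char : (Op p G).Characteristic := by
  rw [Subgroup.characteristic_iff_le_comap]
  intro φ g hg
  rw [Subgroup.mem_comap, mem_Op]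
  rw [mem_Op] at hg
  intro P
  have := hg ((φ : MulAut G)⁻¹ • P)
  have h2 : g ∈ (φ : MulAut G)⁻¹ • (P : Subgroup G) := this
  rw [Subgroup.mem_pointwise_smul_iff_inv_smul_mem, inv_inv] at h2
  exact h2

theorem le_Op (N : Subgroup G) [N.Normal] (h : IsPGroup p N) : N ≤ Op p G :=
  le_iInf fun P => h.le_sylow_of_normal P

end P13
end Sq

open Pointwise
set_option linter.unusedSectionVars false
namespace Sq
open Finset
open scoped Classical
noncomputable section P14
universe u

variable {G : Type u} [Group G] [Finite G] {p : ℕ} {x : G}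

def IH (p n : ℕ) : Prop := ∀ (L : Type u) [Group L] [Finite L] (y : L), Nat.card L < n → Hy p y → Gd p y

theorem card_lt_of_ne_top (M : Subgroup G) (hM : M ≠ ⊤) : Nat.card M < Nat.card G := by
  have := M.card_mul_index
  have h1 : M.index ≠ 1 := fun h => hM (Subgroup.index_eq_one.1 h)
  have h2 : M.index ≠ 0 := Subgroup.FiniteIndex.index_ne_zero
  have h3 : 0 < Nat.card M := Nat.card_pos
  have : 2 ≤ M.index := by omega
  nlinarith

theorem mem_of_sq_mem (hp : Odd p) {N : Subgroup G} {g : G} (h : g ^ 2 ∈ N) (hg : g ^ p = 1) : g ∈ N := by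
  obtain ⟨q, hq⟩ := hp
  have : g = (g ^ 2) ^ (q + 1) := by
    rw [← pow_mul, show 2 * (q + 1) = p + 1 by omega, pow_succ, hg, one_mul]
  rw [this]; exact N.pow_mem h _

/-- lift a characteristic p-subgroup of a normal subgroup -/
theorem gd_of_Op (M : Subgroup G) [M.Normal] (h : ∀ y, IsConj x y → ∃ hm : x * y ∈ M, (⟨x * y, hm⟩ : M) ∈ Op p M) : Gd p x := by
  refine ⟨(Op p M).map M.subtype, inferInstance, Op_p.map _, fun y hy => ?_⟩
  obtain ⟨hm, h'⟩ := h y hy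
  exact ⟨_, h', rfl⟩

theorem stepA (hp : Odd p) (H : Hy p x) (ih : IH.{u} p (Nat.card G)) (hM : Subgroup.closure {y | IsConj x y} ≠ ⊤) : Gd p x := by
  set M := Subgroup.closure {y | IsConj x y} with hMd
  have hK : ∀ y, IsConj x y → y ∈ M := fun y hy => Subgroup.subset_closure hy
  have hn : M.Normal := by
    constructor
    intro n hn g
    have : M ≤ M.comap (MulAut.conj g).toMonoidHom := by
      rw [hMd, Subgroup.closure_le]
      intro y hy
      exact hK _ (cj' hy g)
    exact this hn
  have hx : x ∈ M := hK x (IsConj.refl x)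
  obtain ⟨N, hN, hNp, hNx⟩ := ih M ⟨x, hx⟩ (card_lt_of_ne_top M hM) (H.sub M hx)
  have hle := le_Op N hNp
  refine gd_of_Op M fun y hy => ⟨M.mul_mem hx (hK y hy), hle ?_⟩
  refine mem_of_sq_mem hp ?_ (Subtype.ext (by simpa using H.pp y hy))
  have := hNx (⟨y, hK y hy⟩ * ⟨x, hx⟩ * ⟨y, hK y hy⟩⁻¹) (cj _ _)
  convert this using 1
  apply Subtype.ext
  simp [pow_two, mul_assoc, H.inv hy]

theorem stepB (H : Hy p x) (ih : IH.{u} p (Nat.card G)) (N : Subgroup G) [N.Normal] (hN : IsPGroup p N) (hb : N ≠ ⊥) : Gd p x := by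
  have hlt : Nat.card (G ⧸ N) < Nat.card G := by
    have h1 := N.card_eq_card_quotient_mul_card_subgroup
    have h2 : 1 < Nat.card N := by rwa [Subgroup.one_lt_card_iff_ne_bot]
    have h3 : 0 < Nat.card (G ⧸ N) := Nat.card_pos
    nlinarith
  obtain ⟨Q, hQ, hQp, hQx⟩ := ih (G ⧸ N) (QuotientGroup.mk' N x) hlt (H.map _ (QuotientGroup.mk'_surjective N))
  refine ⟨Q.comap (QuotientGroup.mk' N), inferInstance, ?_, fun y hy => ?_⟩
  · apply hQp.comap_of_ker_isPGroup
    rw [QuotientGroup.ker_mk']; exact hN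
  · rw [Subgroup.mem_comap, map_mul]
    exact hQx _ ((QuotientGroup.mk' N).map_isConj hy)

theorem stepB2 [hpp : Fact p.Prime] (hp : Odd p) (H : Hy p x) (ih : IH.{u} p (Nat.card G)) (v : G) (hv1 : v ≠ 1) (hv2 : v * v = 1) (hv : ∀ g, Commute v g) : Gd p x := by
  set Z := Subgroup.zpowers v with hZ
  have hZc : Nat.card Z = 2 := by
    rw [Nat.card_zpowers]; exact orderOf_eq_prime (by rw [pow_two, hv2]) hv1
  have hZn : Z.Normal := by
    constructor
    intro n hn g
    obtain ⟨k, rfl⟩ := Subgroup.mem_zpowers_iff.1 hn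
    rw [((hv g).symm.zpow_right k).eq]
    simpa using hn
  have hlt : Nat.card (G ⧸ Z) < Nat.card G := by
    have h1 := Z.card_eq_card_quotient_mul_card_subgroup
    have h3 : 0 < Nat.card (G ⧸ Z) := Nat.card_pos
    rw [hZc] at h1
    omega
  obtain ⟨Q, hQ, hQp, hQx⟩ := ih (G ⧸ Z) (QuotientGroup.mk' Z x) hlt (H.map _ (QuotientGroup.mk'_surjective Z))
  set M := Q.comap (QuotientGroup.mk' Z) with hM
  have hMx : ∀ y, IsConj x y → x * y ∈ M := by
    intro y hy
    rw [hM, Subgroup.mem_comap, map_mul]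
    exact hQx _ ((QuotientGroup.mk' Z).map_isConj hy)
  have hMc : Nat.card M = 2 * Nat.card Q := by
    have h1 := Q.index_comap_of_surjective (QuotientGroup.mk'_surjective Z)
    have h2 := M.card_mul_index
    have h3 := Q.card_mul_index
    have h4 := Z.card_eq_card_quotient_mul_card_subgroup
    rw [← hM] at h1
    rw [h1, h4, ← h3, hZc] at h2
    have h5 : 0 < Q.index := Nat.pos_of_ne_zero Subgroup.FiniteIndex.index_ne_zero
    exact Nat.eq_of_mul_eq_mul_right h5 (by rw [h2]; ring)
  obtain ⟨a, ha⟩ := (IsPGroup.iff_card).1 hQp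
  refine gd_of_Op M fun y hy => ⟨hMx y hy, mem_Op.2 fun P => ?_⟩
  have hPi : (P : Subgroup M).index = 2 := by
    have h1 := P.card_eq_multiplicity
    have hp2 : p ≠ 2 := by rintro rfl; exact absurd hp (by decide)
    rw [hMc, ha, Nat.factorization_mul (by norm_num) (pow_ne_zero _ hpp.out.ne_zero), Finsupp.add_apply,
      Nat.Prime.factorization_pow hpp.out, Finsupp.single_eq_same,
      Nat.factorization_eq_zero_of_not_dvd (n := 2) (by rwa [Nat.prime_dvd_prime_iff_eq hpp.out Nat.prime_two]), zero_add] at h1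
    have h2 := (P : Subgroup M).card_mul_index
    rw [hMc, ha, h1, mul_comm] at h2
    exact Nat.eq_of_mul_eq_mul_right (pow_pos hpp.out.pos a) h2
  refine mem_of_sq_mem (N := (P : Subgroup M)) hp ?_ (Subtype.ext (by simpa using H.pp y hy))
  exact Subgroup.sq_mem_of_index_two hPi _
end P14
end Sq

open Pointwise
set_option linter.unusedSectionVars false
namespace Sq
open Finset
open scoped Classical
noncomputable section P15
universe u

variable {G : Type u} [Group G] [Finite G] {p : ℕ} {x : G}

theorem norm_of_inv (hx : x * x = 1) (P : Subgroup G) (h : ∀ g ∈ P, x * g * x⁻¹ ∈ P) :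
    x ∈ Subgroup.normalizer (P : Set G) := by
  rw [Subgroup.mem_normalizer_iff]
  intro g
  refine ⟨h g, fun hg => ?_⟩
  have := h _ hg
  have e : x * (x * g * x⁻¹) * x⁻¹ = g := by
    have hx' : x⁻¹ = x := inv_eq_of_mul_eq_one_left hx
    rw [hx']
    calc x * (x * g * x) * x = (x * x) * g * (x * x) := by group
      _ = g := by rw [hx]; group
  rwa [e] at this

theorem card_cl (x : G) : Nat.card {y // IsConj x y} = (Subgroup.centralizer ({x} : Set G)).index := by
  have : Fintype G := Fintype.ofFinite G
  have h1 := class_card x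
  have h2 := (Subgroup.centralizer ({x} : Set G)).card_mul_index
  rw [← Nat.card_eq_fintype_card] at h1
  have h3 : Nat.card {y // IsConj x y} = #{t : G | IsConj x t} := by
    rw [Nat.card_eq_fintype_card, Fintype.card_subtype]
  rw [h3]
  refine Nat.eq_of_mul_eq_mul_right (Nat.pos_of_ne_zero (cc_pos x)) ?_
  rw [h1, ← h2, mul_comm]; rfl

theorem mem_cent {g : G} : g ∈ Subgroup.centralizer ({x} : Set G) ↔ Commute x g := by
  rw [Subgroup.mem_centralizer_singleton_iff]
  exact ⟨fun h => (show x * g = g * x from h.symm), fun h => h.eq.symm⟩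

theorem max_inv (x : G) (P1 : Subgroup G) (h1 : IsPGroup p P1) (h2 : x ∈ Subgroup.normalizer (P1 : Set G)) :
    ∃ P0 : Subgroup G, P1 ≤ P0 ∧ IsPGroup p P0 ∧ x ∈ Subgroup.normalizer (P0 : Set G) ∧
      ∀ R : Subgroup G, P0 ≤ R → IsPGroup p R → x ∈ Subgroup.normalizer (R : Set G) → R = P0 := by
  have hfin : ({P | IsPGroup p P ∧ x ∈ Subgroup.normalizer (P : Set G)} : Set (Subgroup G)).Finite := Set.toFinite _
  obtain ⟨P0, hle, hmax⟩ := hfin.exists_le_maximal (show P1 ∈ _ from ⟨h1, h2⟩)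
  exact ⟨P0, hle, hmax.prop.1, hmax.prop.2, fun R hR hp hx => (hmax.eq_of_le ⟨hp, hx⟩ hR).symm⟩

/-- G = Q C when the class has p-power length and Q is a Sylow p-subgroup -/
theorem sylow_trans [hpp : Fact p.Prime] (Q : Sylow p G) (r : ℕ) (C : Subgroup G) (hC : C.index = p ^ r) (g : G) :
    ∃ q ∈ Q, ∃ c ∈ C, g = q * c := by
  set b : G ⧸ C := ((1 : G) : G ⧸ C)
  have : Fintype G := Fintype.ofFinite G
  have h1 := MulAction.card_orbit_mul_card_stabilizer_eq_card_group (Q : Subgroup G) b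
  rw [← Nat.card_eq_fintype_card, ← Nat.card_eq_fintype_card, ← Nat.card_eq_fintype_card] at h1
  set st := MulAction.stabilizer (Q : Subgroup G) b with hst
  have hstC : st.map (Q : Subgroup G).subtype ≤ C := by
    rintro _ ⟨q, hq, rfl⟩
    have : (q : G) • b = b := hq
    have h2 : ((q * 1 : G) : G ⧸ C) = ((1 : G) : G ⧸ C) := this
    rw [mul_one, eq_comm, QuotientGroup.eq] at h2
    simpa using h2
  have hcard : Nat.card (st.map (Q : Subgroup G).subtype) = Nat.card st :=
    Subgroup.card_map_of_injective (Subgroup.subtype_injective _)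
  have h2 : Nat.card st ∣ Nat.card C := by
    rw [← hcard]; exact Subgroup.card_dvd_of_le hstC
  have h3 : Nat.card st * p ^ r ∣ Nat.card G := by
    rw [← C.card_mul_index, hC]; exact mul_dvd_mul_right h2 _
  obtain ⟨e, he⟩ := (IsPGroup.iff_card).1 (Q.2.to_subgroup st)
  have h4 : Nat.card st * p ^ r ∣ Nat.card Q := by
    rw [he, ← pow_add] at h3 ⊢
    exact Q.pow_dvd_card_of_pow_dvd_card h3
  have h5 : p ^ r ∣ Nat.card (MulAction.orbit (Q : Subgroup G) b) := by
    have h6 : Nat.card st * p ^ r ∣ Nat.card st * Nat.card (MulAction.orbit (Q : Subgroup G) b) := by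
      rw [mul_comm (Nat.card st) (Nat.card (MulAction.orbit _ _)), h1]; exact h4
    exact Nat.dvd_of_mul_dvd_mul_left Nat.card_pos h6
  have h6 : MulAction.orbit (Q : Subgroup G) b = Set.univ := by
    apply Set.eq_of_subset_of_ncard_le (Set.subset_univ _)
    rw [Set.ncard_univ, ← Nat.card_coe_set_eq]
    have : Nat.card (G ⧸ C) = p ^ r := hC
    rw [this]
    have : Nonempty (MulAction.orbit (Q : Subgroup G) b) := ⟨⟨b, MulAction.mem_orbit_self b⟩⟩
    exact Nat.le_of_dvd Nat.card_pos h5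
  obtain ⟨q, hq⟩ : ((g : G) : G ⧸ C) ∈ MulAction.orbit (Q : Subgroup G) b := by rw [h6]; trivial
  have hq2 : (((q : G) * 1 : G) : G ⧸ C) = (g : G ⧸ C) := hq
  rw [mul_one, QuotientGroup.eq] at hq2
  exact ⟨q, q.2, _, hq2, by group⟩

theorem stepC [hpp : Fact p.Prime] (hp : Odd p) (H : Hy p x) (ih : IH.{u} p (Nat.card G)) (r : ℕ)
    (hr : (Subgroup.centralizer ({x} : Set G)).index = p ^ r) : Gd p x := by
  by_cases hK : ∀ y, IsConj x y → y = x
  · refine ⟨⊥, inferInstance, IsPGroup.of_bot, fun y hy => ?_⟩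
    rw [hK y hy, H.x2]; exact Subgroup.one_mem _
  push Not at hK
  obtain ⟨y, hy, hyx⟩ := hK
  have hx' : x⁻¹ = x := H.inv (IsConj.refl x)
  obtain ⟨P0, hle, hP0, hxP0, hmax⟩ := max_inv (p := p) x (Subgroup.zpowers (x * y)) (by
      refine IsPGroup.of_card_dvd_pow (n := 1) ?_
      rw [Nat.card_zpowers, pow_one]; exact orderOf_dvd_of_pow_eq_one (H.pp y hy)) (by
      apply norm_of_inv H.x2
      intro g hg
      obtain ⟨k, rfl⟩ := Subgroup.mem_zpowers_iff.1 hg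
      rw [← conj_zpow]
      have : x * (x * y) * x⁻¹ = (x * y)⁻¹ := by
        rw [mul_inv_rev, hx', H.inv hy, ← mul_assoc, H.x2, one_mul]
      rw [this, inv_zpow]
      exact Subgroup.inv_mem _ hg)
  have hP0b : P0 ≠ ⊥ := by
    intro h
    rw [h, le_bot_iff, Subgroup.zpowers_eq_bot] at hle
    apply hyx
    rw [← hx']; exact eq_inv_of_mul_eq_one_right hle
  by_cases hn : P0.Normal
  · exact stepB H ih P0 hP0 hP0b
  set M := Subgroup.normalizer (P0 : Set G) with hM
  have hMt : M ≠ ⊤ := fun h => hn (Subgroup.normalizer_eq_top_iff.1 h)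
  obtain ⟨N, hN, hNp, hNx⟩ := ih M ⟨x, hxP0⟩ (card_lt_of_ne_top M hMt) (H.sub M hxP0)
  have hNP : N.map M.subtype ≤ P0 := by
    have hNM : N.map M.subtype ≤ Subgroup.normalizer (P0 : Set G) := Subgroup.map_subtype_le N
    have h1 := IsPGroup.to_sup_of_normal_right' (hNp.map M.subtype) hP0 hNM
    have h2 : x ∈ Subgroup.normalizer ((N.map M.subtype : Subgroup G) : Set G) := by
      apply norm_of_inv H.x2
      rintro _ ⟨n, hn, rfl⟩
      exact ⟨⟨x, hxP0⟩ * n * ⟨x, hxP0⟩⁻¹, hN.conj_mem n hn _, rfl⟩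
    have h3 : x ∈ Subgroup.normalizer ((N.map M.subtype ⊔ P0 : Subgroup G) : Set G) := by
      rw [Subgroup.mem_normalizer_iff_map_conj_eq] at h2 ⊢
      have h4 := Subgroup.mem_normalizer_iff_map_conj_eq.1 hxP0
      rw [Subgroup.map_sup, h2, h4]
    rw [← hmax _ le_sup_right h1 h3]
    exact le_sup_left
  have hcomm : ∀ m ∈ M, x * (m * x * m⁻¹) ∈ P0 := by
    intro m hm
    apply hNP
    exact ⟨_, hNx (⟨m, hm⟩ * ⟨x, hxP0⟩ * ⟨m, hm⟩⁻¹) (cj _ _), rfl⟩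
  have hinv : ∀ R : Subgroup G, P0 ≤ R → R ≤ M → IsPGroup p R → R = P0 := by
    intro R h1 h2 h3
    refine hmax R h1 h3 (norm_of_inv H.x2 R fun g hg => ?_)
    have := R.mul_mem (h1 (hcomm g (h2 hg))) hg
    have e : x * (g * x * g⁻¹) * g = x * g * x⁻¹ := by rw [hx']; group
    rwa [e] at this
  obtain ⟨Q, hPQ⟩ := hP0.exists_le_sylow
  have hQP : (Q : Subgroup G) = P0 := by
    by_contra hne
    have hnil : Group.IsNilpotent (Q : Subgroup G) := Q.2.isNilpotent
    have hlt : P0.subgroupOf (Q : Subgroup G) < ⊤ := by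
      rw [lt_top_iff_ne_top, Ne, Subgroup.subgroupOf_eq_top]
      exact fun h => hne (le_antisymm h hPQ)
    have h1 := Group.normalizerCondition_of_isNilpotent _ hlt
    obtain ⟨q, hq, hq2⟩ := SetLike.exists_of_lt h1
    have hqM : (q : G) ∈ M := by
      rw [hM, Subgroup.mem_normalizer_iff]
      rw [Subgroup.mem_normalizer_iff] at hq
      intro h
      constructor
      · intro hh
        have := (hq ⟨h, hPQ hh⟩).1 (by rwa [Subgroup.mem_subgroupOf])
        rwa [Subgroup.mem_subgroupOf] at this
      · intro hh
        have hhQ : h ∈ (Q : Subgroup G) := by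
          have := (Q : Subgroup G).mul_mem ((Q : Subgroup G).mul_mem ((Q : Subgroup G).inv_mem q.2) (hPQ hh)) q.2
          have e : (q : G)⁻¹ * (q * h * (q : G)⁻¹) * q = h := by group
          rwa [e] at this
        have := (hq ⟨h, hhQ⟩).2 (by rwa [Subgroup.mem_subgroupOf])
        rwa [Subgroup.mem_subgroupOf] at this
    have h2 := hinv ((Q : Subgroup G) ⊓ M) (le_inf hPQ Subgroup.le_normalizer) inf_le_right (Q.2.to_le inf_le_left)
    apply hq2
    rw [Subgroup.mem_subgroupOf, ← h2]
    exact ⟨q.2, hqM⟩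
  have hall : ∀ z, IsConj x z → x * z ∈ P0 := by
    intro z hz
    obtain ⟨g, rfl⟩ := isConj_iff.1 hz
    obtain ⟨q, hq, c, hc, rfl⟩ := sylow_trans Q r _ hr g
    rw [mem_cent] at hc
    have e : q * c * x * (q * c)⁻¹ = q * x * q⁻¹ := by
      calc q * c * x * (q * c)⁻¹ = q * (c * x) * c⁻¹ * q⁻¹ := by group
        _ = q * x * q⁻¹ := by rw [← hc.eq]; group
    rw [e]
    have hq' : q ∈ P0 := by rw [← hQP]; exact hq
    exact hcomm q (Subgroup.le_normalizer hq')
  -- the subgroup generated by all products is normal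
  refine ⟨Subgroup.closure {g | ∃ z, IsConj x z ∧ g = x * z}, ?_, ?_, fun z hz => Subgroup.subset_closure ⟨z, hz, rfl⟩⟩
  · constructor
    intro n hn g
    have hle : Subgroup.closure {g | ∃ z, IsConj x z ∧ g = x * z} ≤
        (Subgroup.closure {g | ∃ z, IsConj x z ∧ g = x * z}).comap (MulAut.conj g).toMonoidHom := by
      rw [Subgroup.closure_le]
      rintro _ ⟨z, hz, rfl⟩
      have h1 : x * (g * x * g⁻¹) ∈ Subgroup.closure {g | ∃ z, IsConj x z ∧ g = x * z} :=
        Subgroup.subset_closure ⟨_, cj x g, rfl⟩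
      have h2 : x * (g * z * g⁻¹) ∈ Subgroup.closure {g | ∃ z, IsConj x z ∧ g = x * z} :=
        Subgroup.subset_closure ⟨_, cj' hz g, rfl⟩
      have h3 := Subgroup.mul_mem _ (Subgroup.inv_mem _ h1) h2
      have e : (x * (g * x * g⁻¹))⁻¹ * (x * (g * z * g⁻¹)) = g * (x * z) * g⁻¹ := by
        rw [mul_inv_rev, H.inv (cj x g)]; group
      rw [e] at h3
      exact h3
    exact hle hn
  · refine hP0.to_le ?_
    rw [Subgroup.closure_le]
    rintro _ ⟨z, hz, rfl⟩
    exact hall z hz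
end P15
end Sq

open Pointwise
set_option linter.unusedSectionVars false
namespace Sq
open Finset
open scoped Classical
noncomputable section P16
universe u

variable {G : Type u} [Group G] [Finite G] {p : ℕ} {x : G}

theorem orb_card [Fact p.Prime] (N : Subgroup G) (hN : IsPGroup p N) (x : G) (P : G → Prop)
    (hP : ∀ y, P y ↔ ∃ n ∈ N, n * x * n⁻¹ = y) : ∃ r, Nat.card {y // P y} = p ^ r := by
  have h1 : IsPGroup p (N.map (ConjAct.toConjAct (G := G)).toMonoidHom) := hN.map _
  obtain ⟨r, hr⟩ := h1.card_orbit x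
  refine ⟨r, hr ▸ ?_⟩
  apply Nat.card_congr
  apply Equiv.subtypeEquivRight
  intro y
  rw [hP]
  constructor
  · rintro ⟨n, hn, h⟩
    exact ⟨⟨ConjAct.toConjAct n, ⟨n, hn, rfl⟩⟩, h⟩
  · rintro ⟨⟨_, ⟨n, hn, rfl⟩⟩, h⟩
    exact ⟨n, hn, h⟩

theorem Fv_trans (hp : Odd p) (H : Hy p x) {v y : G} (hv2 : v * v = 1) (hvx : Commute v x) (hy : IsConj x y) (hvy : Commute v y) :
    ∃ m, IsConj x m ∧ Commute v m ∧ m * x * m = y := by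
  have hv' : v⁻¹ = v := inv_eq_of_mul_eq_one_left hv2
  obtain ⟨m, hm, h⟩ := H.mid hp (IsConj.refl x) hy
  have e : (v * m * v) * x * (v * m * v) = y := by
    calc (v * m * v) * x * (v * m * v) = v * m * (v * x) * v * m * v := by group
      _ = v * m * x * (v * v) * m * v := by rw [hvx.eq]; group
      _ = v * (m * x * m) * v := by rw [hv2]; group
      _ = y * (v * v) := by rw [h, hvy.eq]; group
      _ = y := by rw [hv2, mul_one]
  refine ⟨m, hm, ?_, h⟩
  have := H.uniq hp (IsConj.refl x) hm (show IsConj x (v * m * v) by simpa [hv'] using cj' hm v) (by rw [h, e])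
  show v * m = m * v
  calc v * m = v * (v * m * v) := by rw [← this]
    _ = (v * v) * m * v := by group
    _ = m * v := by rw [hv2, one_mul]

theorem Fv_card [Fact p.Prime] (hp : Odd p) (H : Hy p x) (ih : IH.{u} p (Nat.card G)) {v : G} (hv2 : v * v = 1)
    (hvx : Commute v x) (hnc : ¬ ∀ g, Commute v g) :
    ∃ r, Nat.card {y // IsConj x y ∧ Commute v y} = p ^ r := by
  set M := Subgroup.centralizer ({v} : Set G) with hM
  have hMt : M ≠ ⊤ := fun h => hnc fun g => mem_cent.1 (show g ∈ M by rw [h]; trivial)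
  have hxM : x ∈ M := mem_cent.2 hvx
  obtain ⟨N, hN, hNp, hNx⟩ := ih M ⟨x, hxM⟩ (card_lt_of_ne_top M hMt) (H.sub M hxM)
  refine orb_card (N.map M.subtype) (hNp.map _) x _ fun y => ⟨?_, ?_⟩
  · rintro ⟨hy, hvy⟩
    obtain ⟨m, hm, hvm, h⟩ := Fv_trans hp H hv2 hvx hy hvy
    have hmM : m ∈ M := mem_cent.2 hvm
    obtain ⟨n, hn⟩ := H.conj_in hp (IsConj.refl x) hy
    refine ⟨(x * y) ^ n, Subgroup.pow_mem _ ?_ _, hn⟩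
    refine ⟨_, hNx (⟨m, hmM⟩ * ⟨x, hxM⟩ * ⟨m, hmM⟩⁻¹) (cj _ _), ?_⟩
    show x * (m * x * m⁻¹) = x * y
    rw [H.inv hm, h]
  · rintro ⟨_, ⟨n, hn, rfl⟩, rfl⟩
    refine ⟨cj _ _, ?_⟩
    have : Commute v (n : G) := mem_cent.1 n.2
    exact (this.mul_right hvx).mul_right this.inv_right

theorem stepD [hpp : Fact p.Prime] (hp : Odd p) (H : Hy p x) (ih : IH.{u} p (Nat.card G)) (v : G) (hv1 : v ≠ 1) (hvx1 : v ≠ x)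
    (hv2 : v * v = 1) (hvx : Commute v x) : Gd p x := by
  by_cases hc1 : ∀ g, Commute v g
  · exact stepB2 hp H ih v hv1 hv2 hc1
  have hxv2 : (x * v) * (x * v) = 1 := by
    calc (x * v) * (x * v) = x * (v * x) * v := by group
      _ = (x * x) * (v * v) := by rw [hvx.eq]; group
      _ = 1 := by rw [hv2, H.x2, one_mul]
  by_cases hc2 : ∀ g, Commute (x * v) g
  · refine stepB2 hp H ih (x * v) ?_ hxv2 hc2
    intro h
    apply hvx1
    rw [eq_comm, ← H.inv (IsConj.refl x)]; exact (eq_inv_of_mul_eq_one_right h).symm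
  have hv' : v⁻¹ = v := inv_eq_of_mul_eq_one_left hv2
  obtain ⟨r, hr⟩ := Fv_card hp H ih hv2 hvx hc1
  obtain ⟨s, hs⟩ := Fv_card hp H ih hxv2 ((Commute.refl x).mul_left hvx) hc2
  have hf : ∀ y : {y // IsConj x y}, ∃ m : {m // IsConj x m ∧ Commute v m}, m.1 * y.1 * m.1 = v * y.1 * v := by
    rintro ⟨y, hy⟩
    obtain ⟨m, hm, h⟩ := H.mid hp hy (show IsConj x (v * y * v) by simpa [hv'] using cj' hy v)
    have e : (v * m * v) * y * (v * m * v) = v * y * v := by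
      calc (v * m * v) * y * (v * m * v) = v * m * (v * y * v) * m * v := by group
        _ = v * ((m * m) * y * (m * m)) * v := by rw [← h]; group
        _ = v * y * v := by rw [H.sq hm, one_mul, mul_one]
    refine ⟨⟨m, hm, ?_⟩, h⟩
    have := H.uniq hp hy hm (show IsConj x (v * m * v) by simpa [hv'] using cj' hm v) (by rw [h, e])
    show v * m = m * v
    calc v * m = v * (v * m * v) := by rw [← this]
      _ = (v * v) * m * v := by group
      _ = m * v := by rw [hv2, one_mul]
  choose f hf using hf
  have hfib : ∀ m : {m // IsConj x m ∧ Commute v m}, Nat.card {y // f y = m} = p ^ s := by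
    rintro ⟨m, hm, hvm⟩
    rw [← hs]
    obtain ⟨c, hc, hvc, hcm⟩ := Fv_trans hp H hv2 hvx hm hvm
    have hcc := H.sq hc
    have hmm := H.sq hm
    have hmv2 : (m * v) * (m * v) = 1 := by
      calc (m * v) * (m * v) = m * (v * m) * v := by group
        _ = (m * m) * (v * v) := by rw [hvm.eq]; group
        _ = 1 := by rw [hv2, hmm, one_mul]
    have key : ∀ y : {y // IsConj x y}, f y = ⟨m, hm, hvm⟩ ↔ Commute (m * v) y.1 := by
      intro y
      have h0 : f y = ⟨m, hm, hvm⟩ ↔ m * y.1 * m = v * y.1 * v := by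
        constructor
        · intro h; have := hf y; rw [h] at this; exact this
        · intro h
          apply Subtype.ext
          exact H.uniq hp y.2 (f y).2.1 hm (by rw [hf y, h])
      rw [h0]
      constructor
      · intro h
        show m * v * y.1 = y.1 * (m * v)
        have h1 : v * y.1 = m * y.1 * m * v := by rw [h, mul_assoc _ v v, hv2, mul_one]
        calc m * v * y.1 = m * (v * y.1) := by group
          _ = (m * m) * y.1 * m * v := by rw [h1]; group
          _ = _ := by rw [hmm]; group
      · intro h
        have h1 : v * y.1 = m * y.1 * m * v := by
          calc v * y.1 = m * m * (v * y.1) := by rw [hmm, one_mul]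
            _ = m * (m * v * y.1) := by group
            _ = _ := by rw [h.eq]; group
        rw [h1, mul_assoc _ v v, hv2, mul_one]
    have hconj : ∀ z, Commute (m * v) (c * z * c) ↔ Commute (x * v) z := by
      intro z
      have hc' : c⁻¹ = c := H.inv hc
      have e1 : c * (x * v) * c⁻¹ = m * v := by
        rw [← hcm, hc', mul_assoc c (x*v) c, mul_assoc x v c, hvc.eq]; group
      have e2 : c * z * c = c * z * c⁻¹ := by rw [hc']
      rw [← e1, e2, Commute.conj_iff]
    refine Nat.card_congr
      { toFun := fun y => ⟨c * y.1.1 * c, ?_, ?_⟩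
        invFun := fun z => ⟨⟨c * z.1 * c, ?_⟩, ?_⟩
        left_inv := ?_
        right_inv := ?_ }
    · have := cj' y.1.2 c; rwa [H.inv hc] at this
    · rw [← hconj]
      have := (key y.1).1 y.2
      have e : c * (c * y.1.1 * c) * c = y.1.1 := by
        calc c * (c * y.1.1 * c) * c = (c * c) * y.1.1 * (c * c) := by group
          _ = _ := by rw [hcc, one_mul, mul_one]
      rwa [e]
    · have := cj' z.2.1 c; rwa [H.inv hc] at this
    · rw [key]; exact (hconj _).2 z.2.2
    · intro y
      apply Subtype.ext; apply Subtype.ext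
      show c * (c * y.1.1 * c) * c = y.1.1
      calc c * (c * y.1.1 * c) * c = (c * c) * y.1.1 * (c * c) := by group
        _ = _ := by rw [hcc, one_mul, mul_one]
    · intro y
      apply Subtype.ext
      show c * (c * y.1 * c) * c = y.1
      calc c * (c * y.1 * c) * c = (c * c) * y.1 * (c * c) := by group
        _ = _ := by rw [hcc, one_mul, mul_one]
  refine stepC hp H ih (r + s) ?_
  rw [← card_cl, ← Nat.card_congr (Equiv.sigmaFiberEquiv f)]
  have : Fintype {m // IsConj x m ∧ Commute v m} := Fintype.ofFinite _
  rw [Nat.card_sigma, Finset.sum_congr rfl (fun m _ => hfib m), Finset.sum_const, Finset.card_univ, ← Nat.card_eq_fintype_card, hr, pow_add, smul_eq_mul]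
end P16
end Sq

open Pointwise
set_option linter.unusedSectionVars false
namespace Sq
open Finset
open scoped Classical
noncomputable section P17
universe u

variable {S : Type u} [Group S] [Finite S]

theorem meet_center {p : ℕ} [Fact p.Prime] (hS : IsPGroup p S) (C : Subgroup S) [C.Normal] (hC : C ≠ ⊥) :
    ∃ z ∈ C, z ≠ 1 ∧ ∀ g, g * z * g⁻¹ = z := by
  have h1 : IsPGroup p (ConjAct S) := hS
  have h2 : p ∣ Nat.card C := by
    rcases (hS.to_subgroup C).card_eq_or_dvd with h | h
    · exact absurd (Subgroup.card_eq_one.1 h) hC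
    · exact h
  obtain ⟨b, hb, hb1⟩ := h1.exists_fixed_point_of_prime_dvd_card_of_fixed_point C h2 (a := 1) (by
    intro g; exact smul_one g)
  refine ⟨b, b.2, fun h => hb1 (Subtype.ext h.symm), fun g => ?_⟩
  exact congrArg Subtype.val (hb (ConjAct.toConjAct g))

theorem max_ab {p : ℕ} [Fact p.Prime] (hS : IsPGroup p S) : ∃ A : Subgroup S, A.Normal ∧ (∀ a ∈ A, ∀ b ∈ A, a * b = b * a) ∧
    ∀ g, (∀ a ∈ A, g * a = a * g) → g ∈ A := by
  have hfin : ({A | A.Normal ∧ (∀ a ∈ A, ∀ b ∈ A, a * b = b * a)} : Set (Subgroup S)).Finite := Set.toFinite _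
  obtain ⟨A, -, hmax⟩ := hfin.exists_le_maximal (a := ⊥) ⟨inferInstance, by
    intro a ha b hb; rw [Subgroup.mem_bot.1 ha, Subgroup.mem_bot.1 hb]⟩
  obtain ⟨hn, hab⟩ := hmax.prop
  refine ⟨A, hn, hab, ?_⟩
  by_contra hcon
  push Not at hcon
  obtain ⟨g, hg, hgA⟩ := hcon
  set C := Subgroup.centralizer (A : Set S)
  have hCn : C.Normal := Subgroup.normal_centralizer
  have hgC : g ∈ C := by
    rw [Subgroup.mem_centralizer_iff]; intro a ha; exact (hg a ha).symm
  have : (C.map (QuotientGroup.mk' A)).Normal := hCn.map _ (QuotientGroup.mk'_surjective A)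
  obtain ⟨z', ⟨z, hz, rfl⟩, hz1, hzc⟩ := meet_center (hS.to_quotient A) (C.map (QuotientGroup.mk' A)) (by
    intro h
    have : QuotientGroup.mk' A g ∈ C.map (QuotientGroup.mk' A) := ⟨g, hgC, rfl⟩
    rw [h, Subgroup.mem_bot] at this
    exact hgA ((QuotientGroup.eq_one_iff g).1 this))
  have hzA : z ∉ A := fun h => hz1 ((QuotientGroup.eq_one_iff z).2 h)
  have hzn : (Subgroup.zpowers (QuotientGroup.mk' A z)).Normal := by
    constructor
    intro n hn g
    obtain ⟨k, rfl⟩ := Subgroup.mem_zpowers_iff.1 hn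
    rw [← conj_zpow, hzc]; exact hn
  set B := (Subgroup.zpowers (QuotientGroup.mk' A z)).comap (QuotientGroup.mk' A) with hB
  have hBmem : ∀ b ∈ B, ∃ k : ℤ, ∃ a ∈ A, b = z ^ k * a := by
    intro b hb
    obtain ⟨k, hk⟩ := Subgroup.mem_zpowers_iff.1 hb
    rw [← map_zpow] at hk
    exact ⟨k, (z ^ k)⁻¹ * b, QuotientGroup.eq.1 hk, by group⟩
  have hAB : A ≤ B := by
    intro a ha
    show QuotientGroup.mk' A a ∈ Subgroup.zpowers (QuotientGroup.mk' A z)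
    have : QuotientGroup.mk' A a = 1 := (QuotientGroup.eq_one_iff a).2 ha
    rw [this]; exact Subgroup.one_mem _
  have hzB : z ∈ B := Subgroup.mem_zpowers _
  have hza : ∀ a ∈ A, ∀ k : ℤ, Commute (z ^ k) a := by
    intro a ha k
    exact Commute.zpow_left (Subgroup.mem_centralizer_iff.1 hz a ha).symm k
  have : A = B := hmax.eq_of_le ⟨hzn.comap _, ?_⟩ hAB
  · rw [this] at hzA; exact hzA hzB
  · intro b hb b' hb'
    obtain ⟨k, a, ha, rfl⟩ := hBmem b hb
    obtain ⟨k', a', ha', rfl⟩ := hBmem b' hb'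
    have h1 : Commute a a' := hab a ha a' ha'
    have h2 : Commute (z ^ k) (z ^ k') := (Commute.refl z).zpow_zpow k k'
    exact ((h2.mul_right (hza a' ha' k)).mul_left ((hza a ha k').symm.mul_right h1)).eq

theorem last_out (hS : IsPGroup 2 S) (A : Subgroup S) (g : S) (hg : g ∉ A) : ∃ j : ℕ, g ^ j ∉ A ∧ (g ^ j) * (g ^ j) ∈ A := by
  have hex : ∃ k : ℕ, g ^ 2 ^ k ∈ A := by
    obtain ⟨k, hk⟩ := (isPGroup_iff_pow_pow_eq_one.1 hS) g
    exact ⟨k, hk ▸ A.one_mem⟩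
  obtain ⟨k, hk⟩ : ∃ k, Nat.find hex = k + 1 := by
    rcases h : Nat.find hex with _ | k
    · have := Nat.find_spec hex
      rw [h] at this; simp at this; exact absurd this hg
    · exact ⟨k, rfl⟩
  refine ⟨2 ^ k, Nat.find_min hex (by omega), ?_⟩
  have := Nat.find_spec hex
  rwa [hk, pow_succ, mul_two, pow_add] at this

/-- nontrivial elements have the involution as a power -/
theorem inv_pow (hS : IsPGroup 2 S) {x : S} (hu : ∀ y : S, y * y = 1 → y = 1 ∨ y = x) {b : S} (hb : b ≠ 1) :
    ∃ j : ℕ, b ^ j = x := by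
  obtain ⟨j, h1, h2⟩ := last_out hS ⊥ b (by rwa [Subgroup.mem_bot])
  rw [Subgroup.mem_bot] at h1 h2
  exact ⟨j, (hu _ h2).resolve_left h1⟩

theorem sq_pow (hS : IsPGroup 2 S) {x : S} (hx2 : x * x = 1) (hu : ∀ y : S, y * y = 1 → y = 1 ∨ y = x) {b : S} (hb : b ≠ 1) (hbx : b ≠ x) :
    ∃ j : ℕ, b ^ j * b ^ j = x := by
  obtain ⟨j, h1, h2⟩ := last_out hS (Subgroup.zpowers x) b (by
    intro h
    obtain ⟨k, hk⟩ := Subgroup.mem_zpowers_iff.1 h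
    rcases hu b (by rw [← hk, ← zpow_add, ← two_mul, zpow_mul, zpow_ofNat, pow_two, hx2, one_zpow]) with h | h
    · exact hb h
    · exact hbx h)
  obtain ⟨k, hk⟩ := Subgroup.mem_zpowers_iff.1 h2
  refine ⟨j, (hu _ (by rw [← hk]; rw [← zpow_add, ← two_mul, zpow_mul, zpow_ofNat, pow_two, hx2, one_zpow])).resolve_left ?_⟩
  intro h
  rcases hu _ h with h | h
  · exact h1 (h ▸ Subgroup.one_mem _)
  · exact h1 (h ▸ Subgroup.mem_zpowers _)

theorem ab_cyc (hS : IsPGroup 2 S) {x : S} (hu : ∀ y : S, y * y = 1 → y = 1 ∨ y = x)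
    (A : Subgroup S) (hab : ∀ a ∈ A, ∀ b ∈ A, a * b = b * a) : ∃ a, A = Subgroup.zpowers a := by
  by_cases hA : A = ⊥
  · exact ⟨1, by rw [hA, Subgroup.zpowers_one_eq_bot]⟩
  obtain ⟨a, ha, hmax⟩ := Set.exists_max_image (A : Set S) orderOf (Set.toFinite _) ⟨1, A.one_mem⟩
  have hle : Subgroup.zpowers a ≤ A := by rwa [Subgroup.zpowers_le]
  have ha1 : a ≠ 1 := by
    rintro rfl
    apply hA
    rw [Subgroup.eq_bot_iff_forall]
    intro b hb
    have := hmax b hb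
    rw [orderOf_one] at this
    exact orderOf_eq_one_iff.1 (le_antisymm this (orderOf_pos b))
  refine ⟨a, le_antisymm (fun g hg => ?_) hle⟩
  by_contra hga
  obtain ⟨j, h1, h2⟩ := last_out hS _ g hga
  have hgA : g ^ j ∈ A := A.pow_mem hg j
  obtain ⟨i, hi⟩ := Subgroup.mem_zpowers_iff.1 h2
  set h := g ^ j
  have hcom : Commute h a := hab _ hgA _ ha
  obtain ⟨k, hk⟩ := inv_pow hS hu ha1
  rcases Int.even_or_odd' i with ⟨l, rfl | rfl⟩
  · have h3 : (h * a ^ (-l)) * (h * a ^ (-l)) = 1 := by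
      have : Commute (h) (a ^ (-l)) := hcom.zpow_right _
      calc (h * a ^ (-l)) * (h * a ^ (-l)) = h * (a ^ (-l) * h) * a ^ (-l) := by group
        _ = (h * h) * (a ^ (-l) * a ^ (-l)) := by rw [← this.eq]; group
        _ = 1 := by rw [← hi]; group
    have h4 : h * a ^ (-l) ∈ Subgroup.zpowers a := by
      rcases hu _ h3 with h | h
      · rw [h]; exact Subgroup.one_mem _
      · rw [h, ← hk]; exact Subgroup.npow_mem_zpowers a k
    apply h1
    have := Subgroup.mul_mem _ h4 (Subgroup.zpow_mem_zpowers a l)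
    simpa using this
  · obtain ⟨n, hn⟩ := (IsPGroup.iff_orderOf (p := 2)).1 hS a
    have hco : IsCoprime (2 * l + 1) ((orderOf a : ℕ) : ℤ) := by
      rw [hn]
      push_cast
      apply IsCoprime.pow_right
      exact ⟨1, -l, by ring⟩
    obtain ⟨s, t, hst⟩ := hco
    have h3 : a ∈ Subgroup.zpowers h := by
      have : a = (h * h) ^ s := by
        rw [← hi, ← zpow_mul]
        have h5 : (2 * l + 1) * s = 1 - (orderOf a : ℤ) * t := by linarith
        rw [h5, zpow_sub, zpow_mul, zpow_natCast, pow_orderOf_eq_one, zpow_one, one_zpow, inv_one, mul_one]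
      rw [this]
      exact Subgroup.zpow_mem _ (Subgroup.mul_mem _ (Subgroup.mem_zpowers h) (Subgroup.mem_zpowers h)) _
    have h4 : Subgroup.zpowers a ≤ Subgroup.zpowers h := by rwa [Subgroup.zpowers_le]
    have h5 := Subgroup.eq_of_le_of_card_ge h4 (by rw [Nat.card_zpowers, Nat.card_zpowers]; exact hmax h hgA)
    exact h1 (h5 ▸ Subgroup.mem_zpowers h)

end P17
end Sq

open Pointwise
set_option linter.unusedSectionVars false
namespace Sq
open Finset
open scoped Classical
noncomputable section P18
universe u

variable {S : Type u} [Group S] [Finite S]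

theorem Q4 (hS : IsPGroup 2 S) {x : S} (hx1 : x ≠ 1) (hx2 : x * x = 1) (hu : ∀ y : S, y * y = 1 → y = 1 ∨ y = x) :
    IsCyclic S ∨ ∃ a t u : S, (∀ s, s ∈ Subgroup.zpowers a ∨ t⁻¹ * s ∈ Subgroup.zpowers a) ∧
      t ∉ Subgroup.zpowers a ∧ t * a * t⁻¹ = a⁻¹ ∧ t * t = x ∧ u ∈ Subgroup.zpowers a ∧ u * u = x := by
  obtain ⟨A, hAn, hab, hself⟩ := max_ab hS
  obtain ⟨a, hAa⟩ := ab_cyc hS hu A hab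
  by_cases hAt : A = ⊤
  · left
    exact ⟨a, fun g => by show g ∈ Subgroup.zpowers a; rw [← hAa, hAt]; trivial⟩
  right
  have hx' : x⁻¹ = x := inv_eq_of_mul_eq_one_left hx2
  have hxc : ∀ g, g * x = x * g := by
    intro g
    have h1 : (g * x * g⁻¹) * (g * x * g⁻¹) = 1 := by
      calc (g * x * g⁻¹) * (g * x * g⁻¹) = g * (x * x) * g⁻¹ := by group
        _ = 1 := by rw [hx2]; group
    rcases hu _ h1 with h | h
    · exfalso; apply hx1
      have : x = g⁻¹ * (g * x * g⁻¹) * g := by group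
      rw [this, h]; group
    · calc g * x = (g * x * g⁻¹) * g := by group
        _ = x * g := by rw [h]
  have haA : a ∈ A := hAa ▸ Subgroup.mem_zpowers a
  have hcent : ∀ g, g * a = a * g → g ∈ A := by
    intro g hg
    apply hself
    intro b hb
    rw [hAa] at hb
    obtain ⟨k, rfl⟩ := Subgroup.mem_zpowers_iff.1 hb
    exact (Commute.zpow_right (show Commute g a from hg) k).eq
  have ha1 : a ≠ 1 := by
    rintro rfl
    exact hAt (eq_top_iff.2 fun g _ => hcent g (by simp))
  have hax : a ≠ x := by
    rintro rfl
    exact hAt (eq_top_iff.2 fun g _ => hcent g (hxc g))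
  obtain ⟨j, hj⟩ := sq_pow hS hx2 hu ha1 hax
  set u := a ^ j with hu_def
  have huA : u ∈ A := A.pow_mem haA j
  have hxA : x ∈ A := hj ▸ A.mul_mem huA huA
  have huinv : u⁻¹ ≠ u := by
    intro h
    apply hx1; rw [← hj]; nth_rw 1 [← h]; group
  have hsqx : ∀ b ∈ A, b * b = x → b = u ∨ b = u⁻¹ := by
    intro b hb hbb
    have hc : b * u = u * b := hab b hb u huA
    have h1 : (b * u) * (b * u) = 1 := by
      calc (b * u) * (b * u) = b * (u * b) * u := by group
        _ = (b * b) * (u * u) := by rw [← hc]; group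
        _ = 1 := by rw [hbb, hj, hx2]
    rcases hu _ h1 with h | h
    · right; exact eq_inv_of_mul_eq_one_left h
    · left
      rw [← hj] at h; exact mul_right_cancel h
  have hupow : ∀ b ∈ A, b ≠ 1 → b ≠ x → ∃ n : ℤ, b ^ n = u := by
    intro b hb hb1 hbx
    obtain ⟨k, hk⟩ := sq_pow hS hx2 hu hb1 hbx
    rcases hsqx _ (A.pow_mem hb k) hk with h | h
    · exact ⟨k, by rw [zpow_natCast, h]⟩
    · exact ⟨-k, by rw [zpow_neg, zpow_natCast, h, inv_inv]⟩
  have hconju : ∀ t, t * u * t⁻¹ = u ∨ t * u * t⁻¹ = u⁻¹ := by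
    intro t
    apply hsqx _ (hAn.conj_mem u huA t)
    calc t * u * t⁻¹ * (t * u * t⁻¹) = t * (u * u) * t⁻¹ := by group
      _ = x := by rw [hj, hxc]; group
  have main : ∀ t, t ∉ A → t * t ∈ A → t * a * t⁻¹ = a⁻¹ ∧ t * t = x := by
    intro t htA htt
    have hno : ∀ b ∈ A, (t * b) * (t * b) ≠ 1 := by
      intro b hb h
      have : t * b ∈ A := by
        rcases hu _ h with h | h
        · rw [h]; exact A.one_mem
        · rw [h]; exact hxA
      exact htA ((A.mul_mem_cancel_right hb).1 this)
    have hfix : t * (t * t) * t⁻¹ = t * t := by group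
    set c := t * a * t⁻¹ with hc
    have hcA : c ∈ A := hAn.conj_mem a haA t
    have hca : c * a = a * c := hab c hcA a haA
    have hc2 : t * c * t⁻¹ = a := by
      calc t * c * t⁻¹ = (t * t) * a * (t * t)⁻¹ := by rw [hc]; group
        _ = a := by rw [hab _ htt a haA]; group
    rcases hconju t with h | h
    · exfalso
      have h1 : t * (a * c⁻¹) * t⁻¹ = (a * c⁻¹)⁻¹ := by
        calc t * (a * c⁻¹) * t⁻¹ = (t * a * t⁻¹) * (t * c * t⁻¹)⁻¹ := by group
          _ = (a * c⁻¹)⁻¹ := by rw [hc2, ← hc]; group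
      have h2 : a * c⁻¹ = 1 ∨ a * c⁻¹ = x := by
        by_contra hcon
        push Not at hcon
        obtain ⟨n, hn⟩ := hupow _ (A.mul_mem haA (A.inv_mem hcA)) hcon.1 hcon.2
        apply huinv
        calc u⁻¹ = (t * (a * c⁻¹) * t⁻¹) ^ n := by rw [h1, inv_zpow, hn]
          _ = t * u * t⁻¹ := by rw [conj_zpow, hn]
          _ = u := h
      rcases h2 with h2 | h2
      · have : c = a := (mul_inv_eq_one.1 h2).symm
        apply htA; apply hcent
        rw [hc] at this
        calc t * a = (t * a * t⁻¹) * t := by group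
          _ = a * t := by rw [this]
      · have hcx : c = a * x := by
          rw [← h2, ← mul_assoc]
          have : a * a * c⁻¹ = a * (a * c⁻¹) := by group
          rw [this, h2]
          have h3 : a = x * c := by rw [← h2]; group
          rw [h3, hxc, ← mul_assoc, hxc, ← mul_assoc, hx2, one_mul]
        have hax' : Commute a x := hxc a
        have hcz : ∀ l : ℤ, t * a ^ l * t⁻¹ = a ^ l * x ^ l := by
          intro l
          rw [← conj_zpow, ← hc, hcx, hax'.mul_zpow]
        have hxe : ∀ l : ℤ, x ^ l = 1 → Even l := by
          intro l hl
          by_contra ho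
          rw [Int.not_even_iff_odd] at ho
          obtain ⟨i, rfl⟩ := ho
          apply hx1
          rw [zpow_add, zpow_mul, zpow_ofNat, pow_two, hx2, one_zpow, one_mul, zpow_one] at hl
          exact hl
        have hxe' : ∀ l : ℤ, Even l → x ^ l = 1 := by
          rintro l ⟨i, rfl⟩
          rw [← two_mul, zpow_mul, zpow_ofNat, pow_two, hx2, one_zpow]
        have hxo' : ∀ l : ℤ, Odd l → x ^ l = x := by
          rintro l ⟨i, rfl⟩
          rw [zpow_add, zpow_mul, zpow_ofNat, pow_two, hx2, one_zpow, one_mul, zpow_one]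
        have hje : Even (j : ℤ) := by
          apply hxe
          have := hcz j
          rw [zpow_natCast, ← hu_def, h] at this
          exact (left_eq_mul.1 this)
        obtain ⟨i2, hi2⟩ := Subgroup.mem_zpowers_iff.1 (hAa ▸ htt)
        have hi2e : Even i2 := by
          apply hxe
          have := hcz i2
          rw [hi2, hfix] at this
          exact (left_eq_mul.1 this)
        obtain ⟨i, rfl⟩ := hi2e
        have hsq : ∀ l : ℤ, (t * a ^ l) * (t * a ^ l) = a ^ (2 * (i + l)) * x ^ l := by
          intro l
          calc (t * a ^ l) * (t * a ^ l) = (t * a ^ l * t⁻¹) * (t * t) * a ^ l := by group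
            _ = a ^ l * (x ^ l * a ^ (i + i)) * a ^ l := by rw [hcz, ← hi2]; group
            _ = a ^ (2 * (i + l)) * x ^ l := by
              have e1 : x ^ l * a ^ (i + i) = a ^ (i + i) * x ^ l := (hax'.zpow_zpow _ _).eq.symm
              have e2 : x ^ l * a ^ l = a ^ l * x ^ l := (hax'.zpow_zpow _ _).eq.symm
              rw [e1, mul_assoc, mul_assoc (a ^ (i+i)), e2, ← mul_assoc, ← mul_assoc, ← zpow_add, ← zpow_add]
              congr 2; ring
        rcases Int.even_or_odd i with hi | hi
        · apply hno (a ^ (-i)) (A.zpow_mem haA _)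
          rw [hsq, hxe' _ hi.neg]; simp
        · apply hno (a ^ (-i + (j : ℤ))) (A.zpow_mem haA _)
          rw [hsq, hxo' _ (hi.neg.add_even hje)]
          have : 2 * (i + (-i + (j : ℤ))) = j + j := by ring
          rw [this, zpow_add, zpow_natCast, ← hu_def, hj, hx2]
    · have hfixx : ∀ b ∈ A, t * b * t⁻¹ = b → b = 1 ∨ b = x := by
        intro b hb hbt
        by_contra hcon
        push Not at hcon
        obtain ⟨n, hn⟩ := hupow b hb hcon.1 hcon.2
        apply huinv
        rw [← h, ← hn, ← conj_zpow, hbt]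
      have htx : t * t = x := by
        refine (hfixx _ htt hfix).resolve_left ?_
        intro h
        exact hno 1 A.one_mem (by rwa [mul_one])
      refine ⟨?_, htx⟩
      rcases hfixx (c * a) (A.mul_mem hcA haA) (by
        calc t * (c * a) * t⁻¹ = (t * c * t⁻¹) * (t * a * t⁻¹) := by group
          _ = c * a := by rw [hc2, ← hc, hca]) with h2 | h2
      · exact eq_inv_of_mul_eq_one_left h2
      · exfalso
        apply hno a haA
        calc (t * a) * (t * a) = (t * a * t⁻¹) * (t * t) * a := by group
          _ = c * (x * a) := by rw [htx, ← hc]; group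
          _ = 1 := by rw [← hxc, ← mul_assoc, h2, hx2]
  obtain ⟨t0, ht0⟩ : ∃ t, t ∉ A := by
    by_contra hcon; push Not at hcon
    exact hAt (eq_top_iff.2 fun g _ => hcon g)
  obtain ⟨k, hk1, hk2⟩ := last_out hS A t0 ht0
  obtain ⟨h1, h2⟩ := main _ hk1 hk2
  have hinvu : ∀ s, s ∉ A → s * u * s⁻¹ = u⁻¹ := by
    intro s hs
    refine (hconju s).resolve_left fun h => ?_
    obtain ⟨k, hk1, hk2⟩ := last_out hS A s hs
    obtain ⟨h1, h2⟩ := main _ hk1 hk2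
    have h3 : Commute (s ^ k) u := by
      apply Commute.pow_left
      show s * u = u * s
      calc s * u = (s * u * s⁻¹) * s := by group
        _ = u * s := by rw [h]
    apply huinv
    rw [hu_def, ← _root_.inv_pow, ← h1, conj_pow, ← hu_def, h3.eq]; group
  set t := t0 ^ k
  refine ⟨a, t, u, fun s => ?_, hAa ▸ hk1, h1, h2, hAa ▸ huA, hj⟩
  rw [← hAa]
  by_contra hcon
  push Not at hcon
  have e1 := hinvu _ hcon.1
  have e2 := hinvu _ hcon.2
  have e3 := hinvu _ hk1
  apply huinv
  have : s * u * s⁻¹ = t * ((t⁻¹ * s) * u * (t⁻¹ * s)⁻¹) * t⁻¹ := by group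
  rw [e1, e2] at this
  rw [this]
  calc t * u⁻¹ * t⁻¹ = (t * u * t⁻¹)⁻¹ := by group
    _ = u := by rw [e3, inv_inv]

end P18
end Sq

open Pointwise
set_option linter.unusedSectionVars false
namespace Sq
open Finset
open scoped Classical
noncomputable section P19
universe u

variable {G : Type u} [Group G] [Finite G] {x : G}

structure Cr (x : G) (S : Sylow 2 G) : Prop where
  x1 : x ≠ 1
  x2 : x * x = 1
  xS : x ∈ S
  xc : ∀ s ∈ S, Commute s x
  inv : ∀ y ∈ S, y * y = 1 → y = 1 ∨ y = x
  cinv : ∀ v, v * v = 1 → Commute v x → v = 1 ∨ v = x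
  gen : Subgroup.closure {y | IsConj x y} = ⊤
  odd : ∀ y, IsConj x y → Odd (orderOf (x * y))

theorem Cr.exists (x1 : x ≠ 1) (x2 : x * x = 1) (cinv : ∀ v, v * v = 1 → Commute v x → v = 1 ∨ v = x)
    (gen : Subgroup.closure {y | IsConj x y} = ⊤) (odd : ∀ y, IsConj x y → Odd (orderOf (x * y))) :
    ∃ S : Sylow 2 G, Cr x S := by
  have h2 : IsPGroup 2 (Subgroup.zpowers x) := by
    apply IsPGroup.of_card_dvd_pow (n := 1)
    rw [Nat.card_zpowers, pow_one]
    exact orderOf_dvd_of_pow_eq_one (by rw [pow_two, x2])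
  obtain ⟨S, hS⟩ := h2.exists_le_sylow
  have xS : x ∈ S := hS (Subgroup.mem_zpowers x)
  have xc : ∀ s ∈ S, Commute s x := by
    obtain ⟨z, -, hz1, hz⟩ := meet_center S.2 (⊤ : Subgroup S) (by
      intro h
      have : (⟨x, xS⟩ : S) ∈ (⊤ : Subgroup S) := trivial
      rw [h, Subgroup.mem_bot] at this
      exact x1 (congrArg Subtype.val this))
    obtain ⟨j, h1, h2⟩ := last_out S.2 ⊥ z (by rwa [Subgroup.mem_bot])
    rw [Subgroup.mem_bot] at h1 h2
    have hzc : ∀ s : S, Commute s (z ^ j) := by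
      intro s
      apply Commute.pow_right
      show s * z = z * s
      calc s * z = (s * z * s⁻¹) * s := by group
        _ = z * s := by rw [hz]
    have h3 : ((z ^ j : S) : G) = x := by
      refine (cinv _ (congrArg Subtype.val h2) ?_).resolve_left ?_
      · exact ((hzc ⟨x, xS⟩).map (Subgroup.subtype (S : Subgroup G))).symm
      · intro h; exact h1 (Subtype.ext h)
    intro s hs
    rw [← h3]
    exact (hzc ⟨s, hs⟩).map (Subgroup.subtype (S : Subgroup G))
  exact ⟨S, x1, x2, xS, xc, fun y hy hyy => cinv y hyy (xc y hy), cinv, gen, odd⟩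

theorem to_S (S : Sylow 2 G) (R : Subgroup G) (hR : IsPGroup 2 R) : ∃ g : G, ∀ r ∈ R, g * r * g⁻¹ ∈ S := by
  obtain ⟨Q, hQ⟩ := hR.exists_le_sylow
  obtain ⟨g, hg⟩ := MulAction.exists_smul_eq G Q S
  refine ⟨g, fun r hr => ?_⟩
  rw [← hg]
  exact ⟨r, hQ hr, rfl⟩

theorem to_S1 (S : Sylow 2 G) (v : G) (n : ℕ) (hv : v ^ 2 ^ n = 1) : ∃ g : G, g * v * g⁻¹ ∈ S := by
  obtain ⟨g, hg⟩ := to_S S (Subgroup.zpowers v) (by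
    apply IsPGroup.of_card_dvd_pow (n := n)
    rw [Nat.card_zpowers]; exact orderOf_dvd_of_pow_eq_one hv)
  exact ⟨g, hg v (Subgroup.mem_zpowers v)⟩

variable {S : Sylow 2 G}

theorem Cr.conj (K : Cr x S) {y : G} (hy1 : y ≠ 1) (hy : y * y = 1) : IsConj x y := by
  obtain ⟨g, hg⟩ := to_S1 S y 1 (by rw [pow_one, pow_two, hy])
  have h := K.inv _ hg (by
    calc g * y * g⁻¹ * (g * y * g⁻¹) = g * (y * y) * g⁻¹ := by group
      _ = 1 := by rw [hy]; group)
  rcases h with h | h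
  · exfalso; apply hy1
    calc y = g⁻¹ * (g * y * g⁻¹) * g := by group
      _ = 1 := by rw [h]; group
  · have := cj y g
    rw [h] at this; exact this.symm

/-- cyclic Sylow 2-subgroups have normal complements -/
theorem cyc_compl {L : Type u} [Group L] [Finite L] (P : Sylow 2 L) (hP : IsCyclic P) (h2 : 2 ∣ Nat.card L) :
    ∃ τ : L →* P, τ.ker.IsComplement' P ∧ Odd (Nat.card τ.ker) := by
  have hm : (Nat.card L).minFac = 2 := (Nat.minFac_eq_two_iff _).2 h2
  have h := IsCyclic.isComplement' hm hP
  refine ⟨_, h, ?_⟩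
  have h1 := h.index_eq_card
  rw [← h1]
  have := P.not_dvd_index
  rwa [← Nat.not_even_iff_odd, even_iff_two_dvd]

theorem Cr.cyc (K : Cr x S) (h : IsCyclic S) : ∃ N : Subgroup G, N.Normal ∧ Odd (Nat.card N) ∧ ∃ n, N.index = 2 ^ n := by
  obtain ⟨τ, h1, h2⟩ := cyc_compl S h (by
    have : Nat.card (Subgroup.zpowers x) = 2 := by
      rw [Nat.card_zpowers]; exact orderOf_eq_prime (by rw [pow_two, K.x2]) K.x1
    rw [← this]; exact Subgroup.card_subgroup_dvd_card _)
  refine ⟨τ.ker, inferInstance, h2, ?_⟩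
  rw [h1.symm.index_eq_card]
  exact IsPGroup.iff_card.1 S.2

structure Qt (x a t u : G) (S : Sylow 2 G) : Prop extends Cr x S where
  aS : a ∈ S
  tS : t ∈ S
  cov : ∀ s ∈ S, s ∈ Subgroup.zpowers a ∨ t⁻¹ * s ∈ Subgroup.zpowers a
  tA : t ∉ Subgroup.zpowers a
  ta : t * a * t⁻¹ = a⁻¹
  tt : t * t = x
  uA : u ∈ Subgroup.zpowers a
  uu : u * u = x

theorem Cr.cases (K : Cr x S) : IsCyclic S ∨ ∃ a t u, Qt x a t u S := by
  rcases Q4 S.2 (x := ⟨x, K.xS⟩) (fun h => K.x1 (congrArg Subtype.val h)) (Subtype.ext K.x2) (by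
    rintro ⟨y, hy⟩ h
    rcases K.inv y hy (congrArg Subtype.val h) with h | h
    · exact Or.inl (Subtype.ext h)
    · exact Or.inr (Subtype.ext h)) with h | ⟨a, t, u, h1, h2, h3, h4, h5, h6⟩
  · exact Or.inl h
  · right
    have key : ∀ s : S, s ∈ Subgroup.zpowers a ↔ (s : G) ∈ Subgroup.zpowers (a : G) := by
      intro s
      rw [Subgroup.mem_zpowers_iff, Subgroup.mem_zpowers_iff]
      constructor
      · rintro ⟨k, rfl⟩; exact ⟨k, rfl⟩
      · rintro ⟨k, hk⟩; exact ⟨k, Subtype.ext hk⟩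
    refine ⟨a, t, u, K, a.2, t.2, fun s hs => ?_, fun h => h2 ((key t).2 h), congrArg Subtype.val h3, congrArg Subtype.val h4,
      (key u).1 h5, congrArg Subtype.val h6⟩
    rcases h1 ⟨s, hs⟩ with h | h
    · exact Or.inl ((key _).1 h)
    · exact Or.inr ((key _).1 h)
end P19
end Sq

open Pointwise
set_option linter.unusedSectionVars false
namespace Sq
open Finset
open scoped Classical
noncomputable section P20
universe u

variable {G : Type u} [Group G] [Finite G] {x a t u : G} {S : Sylow 2 G}

theorem Qt.uinv (Q : Qt x a t u S) : u⁻¹ ≠ u := by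
  intro h
  apply Q.x1; rw [← Q.uu]; nth_rw 1 [← h]; group

theorem Qt.tb (Q : Qt x a t u S) {b : G} (hb : b ∈ Subgroup.zpowers a) : t * b * t⁻¹ = b⁻¹ := by
  obtain ⟨k, rfl⟩ := Subgroup.mem_zpowers_iff.1 hb
  rw [← conj_zpow, Q.ta, inv_zpow]

theorem Qt.tb' (Q : Qt x a t u S) {b : G} (hb : b ∈ Subgroup.zpowers a) : t⁻¹ * b * t = b⁻¹ := by
  have := Q.tb (Subgroup.inv_mem _ hb)
  rw [inv_inv] at this
  nth_rw 1 [← this]; group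

theorem Qt.A_le (Q : Qt x a t u S) : Subgroup.zpowers a ≤ S := by
  rw [Subgroup.zpowers_le]; exact Q.aS

theorem Qt.ua (Q : Qt x a t u S) {b : G} (hb : b ∈ Subgroup.zpowers a) : Commute u b := by
  obtain ⟨k, rfl⟩ := Subgroup.mem_zpowers_iff.1 hb
  obtain ⟨l, rfl⟩ := Subgroup.mem_zpowers_iff.1 Q.uA
  exact (Commute.refl a).zpow_zpow _ _

theorem Qt.tC (Q : Qt x a t u S) : ¬ Commute u t := by
  intro h
  apply Q.uinv
  rw [← Q.tb Q.uA, ← h.eq]; group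

theorem Qt.F1 (Q : Qt x a t u S) {c : G} (hc : Commute u c) (h : c * c = x) : c = u ∨ c = u⁻¹ := by
  have h1 : (c * u) * (c * u) = 1 := by
    calc (c * u) * (c * u) = c * (u * c) * u := by group
      _ = (c * c) * (u * u) := by rw [hc.eq]; group
      _ = 1 := by rw [h, Q.uu, Q.x2]
  have h2 : Commute (c * u) x := by
    rw [← Q.uu]
    have : Commute (c * u) u := hc.symm.mul_left (Commute.refl u)
    exact this.mul_right this
  rcases Q.cinv _ h1 h2 with h | h
  · right; exact eq_inv_of_mul_eq_one_left h
  · left; rw [← Q.uu] at h; exact mul_right_cancel h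

theorem Qt.F2 (Q : Qt x a t u S) {c : G} (hc : Commute u c) (h : c ^ 4 = 1) (h2 : c * c ≠ 1) : c = u ∨ c = u⁻¹ := by
  refine Q.F1 hc ?_
  refine (Q.cinv (c * c) ?_ ?_).resolve_left h2
  · rw [← h, pow_succ, pow_succ, pow_two]; group
  · rw [← Q.uu]
    have : Commute (c * c) u := hc.symm.mul_left hc.symm
    exact this.mul_right this

theorem Qt.u4 (Q : Qt x a t u S) : u ^ 4 = 1 := by
  calc u ^ 4 = (u * u) * (u * u) := by rw [pow_succ, pow_succ, pow_two]; group
    _ = 1 := by rw [Q.uu, Q.x2]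

theorem Qt.idx (Q : Qt x a t u S) : ((Subgroup.zpowers a).subgroupOf (S : Subgroup G)).index = 2 := by
  rw [Subgroup.index_eq_two_iff']
  refine ⟨⟨t⁻¹, S.inv_mem Q.tS⟩, fun b => ?_⟩
  rw [Subgroup.mem_subgroupOf, Subgroup.mem_subgroupOf]
  show Xor (t⁻¹ * (b : G) ∈ _) ((b : G) ∈ _)
  rcases Q.cov b b.2 with h | h
  · refine Or.inr ⟨h, fun h2 => Q.tA ?_⟩
    have := Subgroup.mul_mem _ h (Subgroup.inv_mem _ h2)
    simpa using this
  · refine Or.inl ⟨h, fun h2 => Q.tA ?_⟩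
    have := Subgroup.mul_mem _ h2 (Subgroup.inv_mem _ h)
    simpa using this

theorem Qt.cardS (Q : Qt x a t u S) : Nat.card S = 2 * orderOf a := by
  have h := ((Subgroup.zpowers a).subgroupOf (S : Subgroup G)).card_mul_index
  rw [Q.idx] at h
  have h2 := Nat.card_congr (Subgroup.subgroupOfEquivOfLe Q.A_le).toEquiv
  rw [h2, Nat.card_zpowers] at h
  rw [mul_comm, h]

theorem Qt.syl (Q : Qt x a t u S) : ∃ R : Sylow 2 (Subgroup.centralizer ({u} : Set G)),
    (R : Subgroup (Subgroup.centralizer ({u} : Set G))) = (Subgroup.zpowers a).subgroupOf (Subgroup.centralizer ({u} : Set G)) := by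
  set C := Subgroup.centralizer ({u} : Set G) with hC
  have hAC : Subgroup.zpowers a ≤ C := fun b hb => mem_cent.2 (Q.ua hb)
  have hA2 : IsPGroup 2 (Subgroup.zpowers a) := S.2.to_le Q.A_le
  have h1 : IsPGroup 2 ((Subgroup.zpowers a).subgroupOf C) := hA2.comap_subtype
  obtain ⟨R, hR⟩ := h1.exists_le_sylow
  have hcA : Nat.card ((Subgroup.zpowers a).subgroupOf C) = orderOf a := by
    rw [Nat.card_congr (Subgroup.subgroupOfEquivOfLe hAC).toEquiv, Nat.card_zpowers]
  refine ⟨R, (Subgroup.eq_of_le_of_card_ge hR ?_).symm⟩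
  rw [hcA]
  set R' : Subgroup G := (R : Subgroup C).map C.subtype with hR'
  have hR2 : IsPGroup 2 R' := R.2.map _
  have hcR : Nat.card R' = Nat.card R := Subgroup.card_map_of_injective (Subgroup.subtype_injective _)
  have hAR : Subgroup.zpowers a ≤ R' := by
    intro b hb
    exact ⟨⟨b, hAC hb⟩, hR hb, rfl⟩
  obtain ⟨g, hg⟩ := to_S S R' hR2
  set R'' := R'.map (MulAut.conj g).toMonoidHom with hR''
  have hcR'' : Nat.card R'' = Nat.card R' := Subgroup.card_map_of_injective (MulAut.conj g).injective
  have hle : R'' ≤ S := by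
    rintro _ ⟨r, hr, rfl⟩; exact hg r hr
  have hdvd : Nat.card R'' ∣ Nat.card S := Subgroup.card_dvd_of_le hle
  have hne : R'' ≠ (S : Subgroup G) := by
    intro h
    set u' := g * u * g⁻¹
    have hu'S : u' ∈ S := hg u (hAR Q.uA)
    have huc : ∀ s ∈ S, Commute u' s := by
      intro s hs
      have hs' : s ∈ R'' := by rw [h]; exact hs
      obtain ⟨r, ⟨r', hr', rfl⟩, rfl⟩ := hs'
      have : Commute u (r' : G) := mem_cent.1 r'.2
      exact Commute.conj_iff g |>.2 this
    have hu'1 : u'⁻¹ ≠ u' := by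
      intro h
      apply Q.uinv
      have e : (g * u * g⁻¹)⁻¹ = g * u⁻¹ * g⁻¹ := by group
      have h' : g * u⁻¹ * g⁻¹ = g * u * g⁻¹ := by rw [← e]; exact h
      exact mul_left_cancel (mul_right_cancel h')
    rcases Q.cov u' hu'S with h | h
    · apply hu'1
      rw [← Q.tb h, ← (huc t Q.tS).eq]; group
    · have h3 : Commute u' u := huc u (Q.A_le Q.uA)
      have h4 : Commute (t⁻¹ * u') u := (Q.ua h).symm
      apply Q.tC
      have h5 : Commute (u' * (t⁻¹ * u')⁻¹) u := h3.mul_left h4.inv_left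
      have e : u' * (t⁻¹ * u')⁻¹ = t := by group
      rw [e] at h5; exact h5.symm
  have hlt : Nat.card R'' < Nat.card S := by
    refine lt_of_le_of_ne (Nat.le_of_dvd Nat.card_pos hdvd) fun h => hne ?_
    exact Subgroup.eq_of_le_of_card_ge hle h.ge
  rw [hcR'', hcR] at hdvd hlt
  rw [Q.cardS] at hdvd hlt
  have hd2 : orderOf a ∣ Nat.card R := by
    rw [← hcA]; exact Subgroup.card_dvd_of_le hR
  obtain ⟨k, hk⟩ := hd2
  rw [hk] at hlt ⊢
  have : k < 2 := by
    by_contra hcon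
    have := Nat.mul_le_mul_left (orderOf a) (not_lt.1 hcon)
    omega
  nlinarith [orderOf_pos a]

theorem Qt.compl (Q : Qt x a t u S) : ∃ (O : Subgroup G) (B : Type u) (_ : Group B) (_ : Finite B) (τ : (Subgroup.centralizer ({u} : Set G)) →* B),
    IsCyclic B ∧ IsPGroup 2 B ∧ (∀ g, g ∈ O ↔ Commute u g ∧ Odd (orderOf g)) ∧ cc u = orderOf a * Nat.card O ∧
    (∀ c, τ c = 1 ↔ (c : G) ∈ O) ∧ ∀ c, Commute u c → ∃ o ∈ O, ∃ b ∈ Subgroup.zpowers a, c = o * b := by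
  set C := Subgroup.centralizer ({u} : Set G) with hC
  obtain ⟨R, hR⟩ : ∃ R : Sylow 2 C, (R : Subgroup C) = (Subgroup.zpowers a).subgroupOf C := Q.syl
  have hAC : Subgroup.zpowers a ≤ C := fun b hb => mem_cent.2 (Q.ua hb)
  have hcyc : IsCyclic R := by
    have h1 : IsCyclic ((Subgroup.zpowers a).subgroupOf C) :=
      isCyclic_of_injective (Subgroup.subgroupOfEquivOfLe hAC).toMonoidHom (Subgroup.subgroupOfEquivOfLe hAC).injective
    rw [← hR] at h1; exact h1
  have huC : u ∈ C := hAC Q.uA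
  obtain ⟨τ, hτ1, hτ2⟩ := cyc_compl R hcyc (by
    have : Nat.card (Subgroup.zpowers (⟨x, by rw [← Q.uu]; exact C.mul_mem huC huC⟩ : C)) = 2 := by
      rw [Nat.card_zpowers]
      refine orderOf_eq_prime (Subtype.ext ?_) fun h => Q.x1 (congrArg Subtype.val h)
      show x ^ 2 = 1
      rw [pow_two, Q.x2]
    rw [← this]; exact Subgroup.card_subgroup_dvd_card _)
  have hker : ∀ c : C, τ c = 1 ↔ Odd (orderOf (c : G)) := by
    intro c
    rw [Subgroup.orderOf_coe]
    constructor
    · intro h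
      have h1 : c ∈ τ.ker := h
      have h2 : orderOf (⟨c, h1⟩ : τ.ker) ∣ Nat.card τ.ker := orderOf_dvd_natCard _
      rw [Subgroup.orderOf_mk] at h2
      exact hτ2.of_dvd_nat h2
    · intro h
      have h1 := orderOf_map_dvd τ c
      obtain ⟨n, hn⟩ := (IsPGroup.iff_orderOf (p := 2)).1 R.2 (τ c)
      have h2 := h.of_dvd_nat h1
      rw [hn] at h2
      rcases n with _ | n
      · exact orderOf_eq_one_iff.1 hn
      · exfalso; rw [pow_succ] at h2; exact Nat.not_odd_iff_even.2 (even_two.mul_left _) h2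
  have hO : ∀ g, g ∈ τ.ker.map C.subtype ↔ Commute u g ∧ Odd (orderOf g) := by
    intro g
    constructor
    · rintro ⟨c, hc, rfl⟩
      exact ⟨mem_cent.1 c.2, (hker c).1 hc⟩
    · rintro ⟨h1, h2⟩
      exact ⟨⟨g, mem_cent.2 h1⟩, (hker _).2 h2, rfl⟩
  refine ⟨τ.ker.map C.subtype, R, inferInstance, inferInstance, τ, hcyc, R.2, hO, ?_, ?_, ?_⟩
  · have h1 := hτ1.card_mul_card
    rw [Subgroup.card_map_of_injective (Subgroup.subtype_injective _)]
    have h2 : Nat.card R = orderOf a := by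
      have : Nat.card R = Nat.card ((Subgroup.zpowers a).subgroupOf C) := by rw [← hR]
      rw [this, Nat.card_congr (Subgroup.subgroupOfEquivOfLe hAC).toEquiv, Nat.card_zpowers]
    rw [← h2, mul_comm, h1]; rfl
  · intro c
    rw [hO, hker]
    exact ⟨fun h => ⟨mem_cent.1 c.2, h⟩, fun h => h.2⟩
  · intro c hc
    obtain ⟨⟨o, b⟩, hob⟩ := hτ1.2 ⟨c, mem_cent.2 hc⟩
    refine ⟨o.1, ⟨o.1, o.2, rfl⟩, b.1, ?_, (congrArg Subtype.val hob).symm⟩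
    have : (b : C) ∈ (R : Subgroup C) := b.2
    exact hR.le this

end P20
end Sq

open Pointwise
set_option linter.unusedSectionVars false
namespace Sq
open Finset
open scoped Classical
noncomputable section P21
universe u

variable {G : Type u} [Group G] [Finite G] {x a t u : G} {S : Sylow 2 G}

theorem exists_char {B : Type u} [hB : Group B] [Finite B] [IsCyclic B] {b : B} (hb : b ≠ 1) : ∃ φ : B →* ℂˣ, φ b ≠ 1 := by
  letI : CommGroup B := IsCyclic.commGroup
  exact CommGroup.exists_apply_ne_one_of_hasEnoughRootsOfUnity B ℂ hb

theorem two_ord {B : Type u} [Group B] [Finite B] (hB : IsPGroup 2 B) {b : B} (h : b ^ 2 ≠ 1) : 4 ∣ orderOf b := by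
  obtain ⟨n, hn⟩ := (IsPGroup.iff_orderOf (p := 2)).1 hB b
  rw [hn]
  rcases n with _ | _ | n
  · exfalso; apply h
    have hb1 : b = 1 := orderOf_eq_one_iff.1 (by rw [hn, pow_zero])
    rw [hb1, one_pow]
  · exfalso; apply h
    rw [← pow_orderOf_eq_one b, hn]; rfl
  · rw [pow_add, pow_add]; exact ⟨2 ^ n, by ring⟩

theorem Qt.big (Q : Qt x a t u S) (ha : a ^ 4 ≠ 1) : False := by
  have : Fintype G := Fintype.ofFinite G
  set C := Subgroup.centralizer ({u} : Set G) with hC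
  obtain ⟨O, B, hBg, hBf, τ, hcyc, hB2, hO, hcc, hker, hprod⟩ : ∃ (O : Subgroup G) (B : Type u) (_ : Group B) (_ : Finite B) (τ : C →* B),
    IsCyclic B ∧ IsPGroup 2 B ∧ (∀ g, g ∈ O ↔ Commute u g ∧ Odd (orderOf g)) ∧ cc u = orderOf a * Nat.card O ∧
    (∀ c, τ c = 1 ↔ (c : G) ∈ O) ∧ ∀ c, Commute u c → ∃ o ∈ O, ∃ b ∈ Subgroup.zpowers a, c = o * b := Q.compl
  have hAC : Subgroup.zpowers a ≤ C := fun b hb => mem_cent.2 (Q.ua hb)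
  have haC : a ∈ C := hAC (Subgroup.mem_zpowers a)
  set a' : C := ⟨a, haC⟩
  have h4 : (τ a') ^ 4 ≠ 1 := by
    rw [← map_pow, Ne, hker]
    intro h
    have h1 := ((hO _).1 h).2
    have hA2 : IsPGroup 2 S := S.2
    obtain ⟨n, hn⟩ := (IsPGroup.iff_orderOf (p := 2)).1 hA2 ⟨a ^ 4, S.pow_mem Q.aS 4⟩
    rw [Subgroup.orderOf_mk] at hn
    change Odd (orderOf (a ^ 4)) at h1
    rw [hn] at h1
    rcases n with _ | n
    · exact ha (orderOf_eq_one_iff.1 (by rw [hn, pow_zero]))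
    · rw [pow_succ] at h1
      exact Nat.not_odd_iff_even.2 (even_two.mul_left _) h1
  obtain ⟨φ, hφ⟩ := exists_char h4
  set μ : C →* ℂ := (Units.coeHom ℂ).comp ((powMonoidHom 2).comp (φ.comp τ)) with hμd
  have hμ : ∀ c, μ c = ((φ (τ c ^ 2) : ℂˣ) : ℂ) := by
    intro c; rw [map_pow]; rfl
  have hτ1 : ∀ c, τ c ^ 2 = 1 → μ c = 1 := by
    intro c h; rw [hμ, h, map_one, Units.val_one]
  have hu4 : ∀ c : C, μ c ≠ 1 → u ∈ Subgroup.zpowers (c : G) := by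
    intro c hc
    have h1 : 4 ∣ orderOf (c : G) := by
      rw [Subgroup.orderOf_coe]
      exact (two_ord hB2 (fun h => hc (hτ1 c h))).trans (orderOf_map_dvd τ c)
    obtain ⟨k, hk⟩ := h1
    have hpos := orderOf_pos (c : G)
    have h2 : orderOf ((c : G) ^ k) = 4 := by
      have hk0 : k ≠ 0 := by rintro rfl; omega
      rw [orderOf_pow_of_dvd hk0 ⟨4, by rw [hk]; ring⟩, hk]
      exact Nat.mul_div_cancel _ (Nat.pos_of_ne_zero hk0)
    have h3 : Commute u ((c : G) ^ k) := (mem_cent.1 c.2).pow_right k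
    have hm : (c : G) ^ k ∈ Subgroup.zpowers (c : G) := Subgroup.npow_mem_zpowers _ _
    rcases Q.F2 h3 (by rw [← h2, pow_orderOf_eq_one]) (by
      rw [← pow_two]
      exact pow_ne_one_of_lt_orderOf two_ne_zero (by omega)) with h | h
    · rw [← h]; exact hm
    · have := Subgroup.inv_mem _ hm
      rwa [h, inv_inv] at this
  refine part3 ℂ C μ t x (by rw [pow_two, Q.x2]) (fun h => Q.tC (mem_cent.1 h)) ?_ ?_ ?_ ?_ ?_ Q.gen Q.odd
  · intro c
    obtain ⟨o, ho, b, hb, hc⟩ := hprod c (mem_cent.1 c.2)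
    have huo := (hO o).1 ho
    have ho' : t⁻¹ * o * t ∈ O := by
      rw [hO]
      constructor
      · have h1 : t⁻¹ * u * t = u⁻¹ := Q.tb' Q.uA
        have h2 : Commute (t⁻¹ * u * t) (t⁻¹ * o * t) := by
          have := (Commute.conj_iff t⁻¹).2 huo.1
          simpa using this
        rw [h1] at h2
        simpa using h2.inv_left
      · have := orderOf_cj o t⁻¹
        rw [inv_inv] at this
        rw [this]; exact huo.2
    have hbC := hAC hb
    have e : t⁻¹ * (c : G) * t = (t⁻¹ * o * t) * b⁻¹ := by
      rw [← Q.tb' hb, hc]; group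
    have hoC : o ∈ C := mem_cent.2 huo.1
    have hoC' : t⁻¹ * o * t ∈ C := mem_cent.2 ((hO _).1 ho').1
    refine ⟨⟨t⁻¹ * o * t, hoC'⟩ * ⟨b, hbC⟩⁻¹, e.symm, ?_⟩
    have e1 : τ ⟨t⁻¹ * o * t, hoC'⟩ = 1 := (hker _).2 ho'
    have e2 : τ ⟨o, hoC⟩ = 1 := (hker _).2 ho
    have e3 : c = ⟨o, hoC⟩ * ⟨b, hbC⟩ := Subtype.ext hc
    rw [hμ, hμ, map_mul, e1, one_mul, e3, map_inv, map_inv, map_mul, e2, one_mul]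
  · intro c c' g hcc _ hc'
    have h1 := hu4 c' hc'
    obtain ⟨k, hk⟩ := Subgroup.mem_zpowers_iff.1 h1
    have h2 : Commute u (g * u * g⁻¹) := by
      have : g * u * g⁻¹ = (c : G) ^ k := by rw [hcc, conj_zpow, hk]
      rw [this]
      exact (mem_cent.1 c.2).zpow_right k
    rcases Q.F2 h2 (by rw [conj_pow, Q.u4]; group) (by
      intro h
      apply Q.x1
      rw [← Q.uu]
      calc u * u = g⁻¹ * (g * u * g⁻¹ * (g * u * g⁻¹)) * g := by group
        _ = 1 := by rw [h]; group) with h | h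
    · left
      refine mem_cent.2 ?_
      show u * g = g * u
      nth_rw 1 [← h]; group
    · right
      refine mem_cent.2 ?_
      show u * (t⁻¹ * g) = t⁻¹ * g * u
      have h3 := Q.tb Q.uA
      rw [← h3] at h
      calc u * (t⁻¹ * g) = t⁻¹ * (t * u * t⁻¹) * g := by group
        _ = t⁻¹ * g * u := by rw [← h]; group
  · intro h
    apply hφ
    have h1 : (μ ^ 2) a' = 1 := by rw [h]; rfl
    have h2 : (μ a') ^ 2 = 1 := h1
    rw [hμ, ← Units.val_pow_eq_pow_val, ← map_pow, ← pow_mul, Units.val_eq_one] at h2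
    exact h2
  · intro c hc
    apply hτ1
    have : τ c = 1 := (hker c).2 ((hO _).2 ⟨mem_cent.1 c.2, by rwa [Subgroup.orderOf_coe]⟩)
    rw [this, one_pow]
  · intro c hc
    apply hτ1
    obtain ⟨g, hg⟩ := isConj_iff.1 hc
    rw [← map_pow]
    have : c ^ 2 = 1 := by
      apply Subtype.ext
      show (c : G) ^ 2 = 1
      rw [← hg, conj_pow, pow_two, Q.x2]; group
    rw [this, map_one]
end P21
end Sq

open Pointwise
set_option linter.unusedSectionVars false
namespace Sq
open Finset
open scoped Classical
noncomputable section P22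
universe u

variable {G : Type u} [Group G] [Finite G] {x a t u : G} {S : Sylow 2 G}

theorem Qt.xA (Q : Qt x a t u S) : x ∈ Subgroup.zpowers a := by
  rw [← Q.uu]; exact Subgroup.mul_mem _ Q.uA Q.uA

theorem Qt.A4 (Q : Qt x a t u S) {v : G} (hv : v ∈ Subgroup.zpowers a) (h : orderOf v = 4) : IsConj u v := by
  rcases Q.F2 (Q.ua hv) (by rw [← h, pow_orderOf_eq_one]) (by
      rw [← pow_two]
      exact pow_ne_one_of_lt_orderOf two_ne_zero (by omega)) with h | h
  · rw [h]
  · rw [h, ← Q.tb Q.uA]; exact isConj_iff.2 ⟨t, rfl⟩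

def Qt.phi (Q : Qt x a t u S) : S →* ℤˣ where
  toFun s := if (s : G) ∈ Subgroup.zpowers a then 1 else -1
  map_one' := by
    rw [if_pos]; exact Subgroup.one_mem _
  map_mul' s r := by
    have h := Subgroup.mul_mem_iff_of_index_two Q.idx (a := s) (b := r)
    rw [Subgroup.mem_subgroupOf, Subgroup.mem_subgroupOf, Subgroup.mem_subgroupOf] at h
    by_cases h1 : (s : G) ∈ Subgroup.zpowers a <;> by_cases h2 : (r : G) ∈ Subgroup.zpowers a <;>
      simp only [h, h1, h2, if_true, if_false] <;> simp

theorem Qt.four (Q : Qt x a t u S) {v : G} (hv : orderOf v = 4) : IsConj u v := by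
  by_contra hn
  have hv4 : v ^ 4 = 1 := by rw [← hv, pow_orderOf_eq_one]
  have : Fintype G := Fintype.ofFinite G
  have : Fintype (Quotient (MulAction.orbitRel (Subgroup.zpowers v) (G ⧸ (S : Subgroup G)))) := Fintype.ofFinite _
  have key := MonoidHom.transfer_eq_prod_quotient_orbitRel_zpowers_quot (H := (S : Subgroup G)) Q.phi v
  have hidx := Subgroup.index_eq_sum_minimalPeriod (H := (S : Subgroup G)) v
  have hodd : Odd (S : Subgroup G).index := by
    rw [← Nat.not_even_iff_odd, even_iff_two_dvd]
    exact S.not_dvd_index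
  have hf : ∀ q : Quotient (MulAction.orbitRel (Subgroup.zpowers v) (G ⧸ (S : Subgroup G))),
      Q.phi ⟨q.out.out⁻¹ * v ^ Function.minimalPeriod (v • ·) q.out * q.out.out,
            QuotientGroup.out_conj_pow_minimalPeriod_mem _ v q.out⟩ = (-1) ^ (Function.minimalPeriod (v • ·) q.out) := by
    intro q
    have hm := QuotientGroup.out_conj_pow_minimalPeriod_mem (S : Subgroup G) v q.out
    have hd : Function.minimalPeriod (v • ·) q.out ∣ 4 := by
      apply Function.IsPeriodicPt.minimalPeriod_dvd
      show ((v • ·)^[4]) q.out = q.out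
      rw [smul_iterate]
      show v ^ 4 • q.out = q.out
      rw [hv4, one_smul]
    show (if q.out.out⁻¹ * v ^ Function.minimalPeriod (v • ·) q.out * q.out.out ∈ Subgroup.zpowers a then (1 : ℤˣ) else -1) = (-1) ^ (Function.minimalPeriod (v • ·) q.out)
    generalize Function.minimalPeriod (v • ·) q.out = k at hm hd ⊢
    generalize q.out.out = y at hm ⊢
    rcases Nat.even_or_odd k with hk | hk
    · rw [hk.neg_one_pow, if_pos]
      obtain ⟨j, rfl⟩ := hk
      have hj : (v ^ (j + j)) * (v ^ (j + j)) = 1 := by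
        rw [← pow_add, show j + j + (j + j) = 4 * j by ring, pow_mul, hv4, one_pow]
      rcases Q.inv _ hm (by
        calc y⁻¹ * v ^ (j + j) * y * (y⁻¹ * v ^ (j + j) * y) = y⁻¹ * (v ^ (j + j) * v ^ (j + j)) * y := by group
          _ = 1 := by rw [hj]; group) with h | h
      · rw [h]; exact Subgroup.one_mem _
      · rw [h]; exact Q.xA
    · rw [hk.neg_one_pow, if_neg]
      have hk1 : k = 1 := by
        have := Nat.le_of_dvd (by norm_num) hd
        obtain ⟨j, rfl⟩ := hk
        have : j ≤ 1 := by omega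
        interval_cases j
        · rfl
        · omega
      subst hk1
      rw [pow_one]
      intro h
      have ho := orderOf_cj v y⁻¹
      rw [inv_inv] at ho
      refine hn ((Q.A4 h (by rw [ho, hv])).trans ?_)
      exact isConj_iff.2 ⟨y, by group⟩
  rw [Finset.prod_congr rfl (fun q _ => hf q), Finset.prod_pow_eq_pow_sum, ← hidx, hodd.neg_one_pow] at key
  have hvx : IsConj x (v * v) := by
    apply Q.toCr.conj
    · rw [← pow_two]
      exact pow_ne_one_of_lt_orderOf two_ne_zero (by omega)
    · rw [← hv4, pow_succ, pow_succ, pow_two]; group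
  have hx1 : MonoidHom.transfer Q.phi x = 1 := by
    have h1 := MonoidHom.map_isConj (MonoidHom.transfer Q.phi) hvx
    rw [isConj_iff_eq] at h1
    rw [h1, map_mul, key]; rfl
  have htop : (⊤ : Subgroup G) ≤ (MonoidHom.transfer Q.phi).ker := by
    rw [← Q.gen, Subgroup.closure_le]
    intro y hy
    have h1 := MonoidHom.map_isConj (MonoidHom.transfer Q.phi) hy
    rw [isConj_iff_eq] at h1
    show MonoidHom.transfer Q.phi y = 1
    rw [← h1, hx1]
  have hv1 : MonoidHom.transfer Q.phi v = 1 := htop (Subgroup.mem_top v)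
  rw [hv1] at key
  exact absurd key (by decide)

theorem Qt.small (Q : Qt x a t u S) (ha : a ^ 4 = 1) : False := by
  have : Fintype G := Fintype.ofFinite G
  obtain ⟨O, B, hBg, hBf, τ, hcyc, hB2, hO, hcc, hker, hprod⟩ := Q.compl
  have ha4 : orderOf a = 4 := by
    refine orderOf_eq_prime_pow (p := 2) (n := 1) ?_ ha
    intro h
    apply Q.x1
    obtain ⟨k, hk⟩ := Subgroup.mem_zpowers_iff.1 Q.uA
    rw [← Q.uu, ← hk, ← zpow_add, ← two_mul, zpow_mul]
    have : a ^ (2 : ℤ) = 1 := by exact_mod_cast h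
    rw [this, one_zpow]
  have hS4 : ∀ s ∈ S, s ^ 4 = 1 := by
    intro s hs
    rcases Q.cov s hs with h | h
    · obtain ⟨k, rfl⟩ := Subgroup.mem_zpowers_iff.1 h
      rw [← zpow_natCast, ← zpow_mul, mul_comm, zpow_mul]
      have : a ^ ((4 : ℕ) : ℤ) = 1 := by exact_mod_cast ha
      rw [this, one_zpow]
    · have h1 := Q.tb' h
      have h2 : s * s = x := by
        rw [← Q.tt]
        calc s * s = t * t * (t⁻¹ * (t⁻¹ * s) * t) * (t⁻¹ * s) := by group
          _ = t * t := by rw [h1]; group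
      calc s ^ 4 = (s * s) * (s * s) := by rw [pow_succ, pow_succ, pow_two]; group
        _ = 1 := by rw [h2, Q.x2]
  have hodd : Odd (S : Subgroup G).index := by
    rw [← Nat.not_even_iff_odd, even_iff_two_dvd]
    exact S.not_dvd_index
  refine Pk.false (m := (S : Subgroup G).index) (x := x) (u := u) (O := O) ?_
  refine ⟨hodd, ?_, ?_, ?_, Q.x1, ?_, fun v hv => Q.four hv, ?_, Q.gen, Q.odd, hO, ?_⟩
  · rw [← Nat.card_eq_fintype_card, ← (S : Subgroup G).card_mul_index]
    congr 1
    rw [Q.cardS, ha4]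
  · rw [pow_two, Q.uu]
  · rw [pow_two, Q.x2]
  · intro y hy
    refine Q.toCr.conj ?_ ?_
    · rintro rfl; rw [orderOf_one] at hy; omega
    · rw [← pow_two, ← hy, pow_orderOf_eq_one]
  · rintro g ⟨k, hk⟩
    have hpos := orderOf_pos g
    have hk0 : k ≠ 0 := by rintro rfl; omega
    have h2 : orderOf (g ^ k) = 8 := by
      rw [orderOf_pow_of_dvd hk0 ⟨8, by rw [hk]; ring⟩, hk]
      exact Nat.mul_div_cancel _ (Nat.pos_of_ne_zero hk0)
    obtain ⟨y, hy⟩ := to_S1 S (g ^ k) 3 (by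
      rw [show 2 ^ 3 = 8 by norm_num, ← h2, pow_orderOf_eq_one])
    have h3 := hS4 _ hy
    have h4 := orderOf_dvd_of_pow_eq_one h3
    rw [orderOf_cj, h2] at h4
    omega
  · rw [hcc, ha4]

theorem Qt.false (Q : Qt x a t u S) : False := by
  by_cases ha : a ^ 4 = 1
  · exact Q.small ha
  · exact Q.big ha
end P22
end Sq

open Pointwise
set_option linter.unusedSectionVars false
namespace Sq
open Finset
open scoped Classical
noncomputable section P23
universe u

variable {G : Type u} [Group G] [Finite G] {p : ℕ} {x : G}

theorem core (hp : Odd p) (H : Hy p x) (x1 : x ≠ 1) (cinv : ∀ v, v * v = 1 → Commute v x → v = 1 ∨ v = x)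
    (gen : Subgroup.closure {y | IsConj x y} = ⊤) :
    (∃ S : Sylow 2 G, Cr x S) ∧ ∃ N : Subgroup G, N.Normal ∧ Odd (Nat.card N) ∧ ∃ n, N.index = 2 ^ n := by
  obtain ⟨S, K⟩ := Cr.exists x1 H.x2 cinv gen (fun y hy => H.odd hp (IsConj.refl x) hy)
  refine ⟨⟨S, K⟩, ?_⟩
  rcases K.cases with h | ⟨a, t, u, Q⟩
  · exact K.cyc h
  · exact (Q.false).elim

theorem fix_syl (x2 : x * x = 1) (N : Subgroup G) [hN : N.Normal] (hodd : Odd (Nat.card N)) (q : ℕ) [Fact q.Prime] :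
    ∃ Q : Sylow q N, ∀ s : N, s ∈ Q → ∃ r : N, r ∈ Q ∧ (r : G) = x * s * x⁻¹ := by
  have h2 : IsPGroup 2 (Subgroup.zpowers (ConjAct.toConjAct x)) := by
    rintro ⟨y, hy⟩
    obtain ⟨k, rfl⟩ := Subgroup.mem_zpowers_iff.1 hy
    refine ⟨1, Subtype.ext ?_⟩
    show (ConjAct.toConjAct x ^ k) ^ (2 ^ 1) = 1
    rw [pow_one, pow_two, ← (Commute.refl _).mul_zpow, ← map_mul, x2, map_one, one_zpow]
  have hnd : ¬ 2 ∣ Nat.card (Sylow q N) := by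
    intro h
    obtain ⟨P⟩ : Nonempty (Sylow q N) := inferInstance
    have h1 : 2 ∣ Nat.card N := h.trans (P.card_dvd_index.trans (Subgroup.index_dvd_card _))
    exact Nat.not_odd_iff_even.2 (even_iff_two_dvd.2 h1) hodd
  obtain ⟨Q, hQ⟩ := h2.nonempty_fixed_point_of_prime_not_dvd_card (Sylow q N) hnd
  refine ⟨Q, fun s hs => ?_⟩
  have h3 : ConjAct.toConjAct x • Q = Q := hQ ⟨_, Subgroup.mem_zpowers _⟩
  refine ⟨ConjAct.toConjAct x • s, ?_, ?_⟩
  · rw [← h3]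
    exact Subgroup.smul_mem_pointwise_smul _ _ _ hs
  · exact ConjAct.toConjAct_smul x (s : G)

theorem stepE [hpp : Fact p.Prime] (hp : Odd p) (H : Hy p x) (ih : IH.{u} p (Nat.card G)) (x1 : x ≠ 1)
    (cinv : ∀ v, v * v = 1 → Commute v x → v = 1 ∨ v = x)
    (gen : Subgroup.closure {y | IsConj x y} = ⊤) : Gd p x := by
  obtain ⟨⟨S, K⟩, N, hN, hodd, n, hn⟩ := core hp H x1 cinv gen
  set C := Subgroup.centralizer ({x} : Set G) with hC
  refine stepC hp H ih C.index.primeFactorsList.length ?_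
  refine Nat.eq_prime_pow_of_unique_prime_dvd Subgroup.FiniteIndex.index_ne_zero ?_
  intro q hq hdvd
  by_contra hqp
  have : Fact q.Prime := ⟨hq⟩
  by_cases hq2 : q = 2
  · subst hq2
    have hle : (S : Subgroup G) ≤ C := fun s hs => mem_cent.2 (K.xc s hs).symm
    exact S.not_dvd_index (hdvd.trans (Subgroup.index_dvd_of_le hle))
  · obtain ⟨Q, hQ⟩ := fix_syl H.x2 N hodd q
    have hle : (Q : Subgroup N).map N.subtype ≤ C := by
      rintro _ ⟨s, hs, rfl⟩
      obtain ⟨r, hr, hre⟩ := hQ s hs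
      have hx' : x⁻¹ = x := inv_eq_of_mul_eq_one_left H.x2
      have h1 : x * ((s : G) * x * (s : G)⁻¹) = ((r * s⁻¹ : N) : G) := by
        show _ = (r : G) * (s : G)⁻¹
        rw [hre, hx']; group
      have h2 := H.pp _ (cj x (s : G))
      rw [h1] at h2
      have h3 : (r * s⁻¹ : N) ^ p = 1 := Subtype.ext h2
      obtain ⟨k, hk⟩ := (IsPGroup.iff_orderOf (p := q)).1 Q.2 ⟨r * s⁻¹, Q.mul_mem hr (Q.inv_mem hs)⟩
      rw [Subgroup.orderOf_mk] at hk
      have h4 := orderOf_dvd_of_pow_eq_one h3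
      have h5 : orderOf (r * s⁻¹ : N) = 1 := by
        refine Nat.eq_one_of_dvd_coprimes (a := p) (b := q ^ k) ?_ h4 (by rw [hk])
        exact Nat.Coprime.pow_right _ ((Nat.coprime_primes hpp.out hq).2 (Ne.symm hqp))
      have h6 : r = s := mul_inv_eq_one.1 (orderOf_eq_one_iff.1 h5)
      rw [h6] at hre
      refine mem_cent.2 ?_
      show x * (s : G) = s * x
      nth_rw 2 [hre]; group
    have h1 := hdvd.trans (Subgroup.index_dvd_of_le hle)
    rw [Subgroup.index_map_subtype, hn, hq.dvd_mul] at h1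
    rcases h1 with h1 | h1
    · exact Q.not_dvd_index h1
    · exact hq2 ((Nat.prime_dvd_prime_iff_eq hq Nat.prime_two).1 (hq.dvd_of_dvd_pow h1))

theorem main_ind [hpp : Fact p.Prime] (hp : Odd p) (n : ℕ) : IH.{u} p n := by
  induction n with
  | zero => intro L _ _ y h; omega
  | succ n ihn =>
    intro L _ _ x hc H
    have ih : IH.{u} p (Nat.card L) := fun L' _ _ y' h' H' => ihn L' y' (by omega) H'
    by_cases x1 : x = 1
    · refine ⟨⊥, inferInstance, IsPGroup.of_bot, fun y hy => ?_⟩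
      rw [x1] at hy ⊢
      rw [isConj_one_right.1 hy, one_mul]; exact Subgroup.one_mem _
    by_cases gen : Subgroup.closure {y | IsConj x y} = ⊤
    swap
    · exact stepA hp H ih gen
    by_cases hv : ∃ v, v ≠ 1 ∧ v ≠ x ∧ v * v = 1 ∧ Commute v x
    · obtain ⟨v, h1, h2, h3, h4⟩ := hv
      exact stepD hp H ih v h1 h2 h3 h4
    · refine stepE hp H ih x1 ?_ gen
      intro v h1 h2
      by_contra h
      push Not at h
      exact hv ⟨v, h.1, h.2, h1, h2⟩

theorem conj_pw {y z : G} (hy : y * y = 1) (hz : z * z = 1) (h : IsConj y z) (k : ℕ) : IsConj y (y * (y * z) ^ k) := by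
  induction k using Nat.twoStepInduction with
  | zero => rw [pow_zero, mul_one]
  | one => rwa [pow_one, ← mul_assoc, hy, one_mul]
  | more k ih _ =>
    have e : y * (y * z) ^ (k + 2) = (z * y) * (y * (y * z) ^ k) * (z * y)⁻¹ := by
      have hy' : y⁻¹ = y := inv_eq_of_mul_eq_one_left hy
      have hz' : z⁻¹ = z := inv_eq_of_mul_eq_one_left hz
      rw [mul_inv_rev, hy', hz', pow_succ, pow_succ']
      calc y * (y * z * (y * z) ^ k * (y * z)) = (y * y) * (z * (y * z) ^ k * (y * z)) := by simp only [mul_assoc]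
        _ = z * (y * y) * (y * z) ^ k * (y * z) := by rw [hy, one_mul, mul_one]
        _ = _ := by simp only [mul_assoc]
    rw [e]; exact cj' ih _

theorem final {x d : G} {K D : Set G} (hx : orderOf x = 2) (hd : 2 < orderOf d) (hK : ∀ y, y ∈ K ↔ IsConj x y)
    (hD : ∀ y, y ∈ D ↔ IsConj d y) (hKcard : 3 ≤ K.ncard) (hKD : ∀ g, (g = 1 ∨ g ∈ D) ↔ ∃ y ∈ K, ∃ z ∈ K, y * z = g) :
    ∃ (p r : ℕ), p.Prime ∧ Odd p ∧ 0 < r ∧ IsPGroup p (Subgroup.closure D) ∧ K.ncard = p ^ r := by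
  have hfin : Fintype G := Fintype.ofFinite G
  have hx2 : x * x = 1 := by rw [← pow_two, ← hx, pow_orderOf_eq_one]
  have hDo : ∀ e ∈ D, orderOf e = orderOf d := by
    intro e he
    obtain ⟨c, rfl⟩ := isConj_iff.1 ((hD e).1 he)
    exact orderOf_cj d c
  have hsq : ∀ y ∈ K, y * y = 1 := by
    intro y hy
    obtain ⟨c, rfl⟩ := isConj_iff.1 ((hK y).1 hy)
    calc c * x * c⁻¹ * (c * x * c⁻¹) = c * (x * x) * c⁻¹ := by group
      _ = 1 := by rw [hx2]; group
  have hprime : (orderOf d).Prime := by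
    obtain ⟨y, hy, z, hz, e⟩ := (hKD d).1 (Or.inr ((hD d).2 (IsConj.refl d)))
    have hyz := ((hK y).1 hy).symm.trans ((hK z).1 hz)
    have hmp : (orderOf d).minFac.Prime := Nat.minFac_prime (by omega)
    obtain ⟨k, hk⟩ := Nat.minFac_dvd (orderOf d)
    have hk0 : k ≠ 0 := by rintro rfl; omega
    have h1 : orderOf (d ^ k) = (orderOf d).minFac := by
      rw [orderOf_pow_of_dvd hk0 ⟨_, by rw [mul_comm]; exact hk⟩]
      nth_rw 1 [hk]
      exact Nat.mul_div_cancel _ (Nat.pos_of_ne_zero hk0)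
    have h2 := (hKD (d ^ k)).2 ⟨y, hy, y * (y * z) ^ k, (hK _).2 (((hK y).1 hy).trans (conj_pw (hsq y hy) (hsq z hz) hyz k)), by
      rw [← mul_assoc, hsq y hy, one_mul, e]⟩
    rcases h2 with h2 | h2
    · rw [h2, orderOf_one] at h1
      exact absurd h1.symm hmp.ne_one
    · rw [← hDo _ h2, h1]; exact hmp
  set p := orderOf d with hpd
  have hpp : Fact p.Prime := ⟨hprime⟩
  have hp : Odd p := hprime.odd_of_ne_two (by omega)
  have H : Hy p x := by
    refine ⟨hx2, fun y hy => ?_⟩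
    rcases (hKD (x * y)).2 ⟨x, (hK x).2 (IsConj.refl x), y, (hK y).2 hy, rfl⟩ with h | h
    · rw [h, one_pow]
    · rw [← hDo _ h, pow_orderOf_eq_one]
  obtain ⟨N, hN, hNp, hxN⟩ := main_ind hp (Nat.card G + 1) G x (by omega) H
  obtain ⟨r, hr⟩ := orb_card N hNp x (fun y => IsConj x y) (by
    intro y
    constructor
    · intro hy
      obtain ⟨k, hk⟩ := H.conj_in hp (IsConj.refl x) hy
      exact ⟨_, N.pow_mem (hxN y hy) k, hk⟩
    · rintro ⟨c, -, rfl⟩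
      exact cj x c)
  have hKr : K.ncard = p ^ r := by
    rw [← hr, show K = {y | IsConj x y} from Set.ext hK]; rfl
  refine ⟨p, r, hprime, hp, ?_, ?_, hKr⟩
  · rcases r with _ | r
    · rw [hKr, pow_zero] at hKcard; omega
    · omega
  · refine hNp.to_le ?_
    rw [Subgroup.closure_le]
    intro e he
    obtain ⟨y, hy, z, hz, rfl⟩ := (hKD e).1 (Or.inr he)
    obtain ⟨c, rfl⟩ := isConj_iff.1 ((hK y).1 hy)
    have h1 := hN.conj_mem _ (hxN (c⁻¹ * z * c) (by simpa using cj' ((hK z).1 hz) c⁻¹)) c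
    have e1 : c * (x * (c⁻¹ * z * c)) * c⁻¹ = c * x * c⁻¹ * z := by group
    rw [e1] at h1
    exact h1
end P23
end Sq

/-- **Theorem A, Case 2.a (second part).** If `x` is an involution of a finite group `G` whose
conjugacy class `K = x^G` has size at least 3 and satisfies `K² = {1} ∪ D` where `D = d^G`
is the conjugacy class of an element `d` of order greater than 2, then there exist an odd
prime `p` and a positive integer `r` such that `⟨D⟩` is a `p`-group and `|K| = p^r`. -/
theorem square_of_class_case_2a_pgroup
    {G : Type*} [Group G] [Fintype G] (x d : G)
    (hx : orderOf x = 2) (hd : 2 < orderOf d)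
    (K D : Set G) (hK : K = conjClass x) (hD : D = conjClass d)
    (hKcard : 3 ≤ K.ncard)
    (hKD : K * K = {1} ∪ D) :
    ∃ (p r : ℕ), p.Prime ∧ Odd p ∧ 0 < r ∧
      IsPGroup p (Subgroup.closure D) ∧ K.ncard = p ^ r := by
  refine Sq.final hx hd ?_ ?_ hKcard ?_
  · intro y
    rw [hK, isConj_iff]
    constructor
    · rintro ⟨g, rfl⟩; exact ⟨g⁻¹, by rw [inv_inv]⟩
    · rintro ⟨g, rfl⟩; exact ⟨g⁻¹, by rw [inv_inv]⟩
  · intro y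
    rw [hD, isConj_iff]
    constructor
    · rintro ⟨g, rfl⟩; exact ⟨g⁻¹, by rw [inv_inv]⟩
    · rintro ⟨g, rfl⟩; exact ⟨g⁻¹, by rw [inv_inv]⟩
  · intro g
    rw [← Set.mem_mul, hKD, Set.mem_union, Set.mem_singleton_iff]
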